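/- Let S ∈ (0,∞) and let γ₁, γ₂ be Jordan curves in ℝ² of Lebesgue measure zero that intersect at finitely many points, each admitting a solution Γ¹, Γ² to the curvature flow problem with stopping time S; write cf(γ_i,t) = Γ^i(S¹,t) for t ∈ (0,S) and cf(γ_i,0) = γ_i. Let T ∈ (0,S) and let p_T ∈ cf(γ₁,T) ∩ cf(γ₂,T) be a point of intersection at time T. Then there is a continuous trajectory p : [0,T] → ℝ² such that p(t) ∈ cf(γ₁,t) ∩ cf(γ₂,t) for all t ∈ [0,T] and p(T) = p_T. -/

import Mathlib

open Set Filter Metric Real MeasureTheory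

noncomputable section

/-- The Euclidean plane. -/
abbrev E2 := EuclideanSpace ℝ (Fin 2)

/-- `φ` is a parametrization of the curve `γ`: a continuous injective map from the unit
circle onto `γ` (such a map is automatically a homeomorphism onto its image). -/
def IsParam (γ : Set E2) (φ : Circle → E2) : Prop :=
  Continuous φ ∧ Function.Injective φ ∧ Set.range φ = γ

/-- A Jordan curve in the plane: the image of a continuous injective map from the
unit circle. -/
def IsJordanCurve (γ : Set E2) : Prop :=
  ∃ φ : Circle → E2, IsParam γ φ

/-- The Fréchet distance between two Jordan curves. -/
noncomputable def frechetDist (γ₁ γ₂ : Set E2) : ℝ :=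
  sInf { d : ℝ | ∃ φ₁ φ₂ : Circle → E2, IsParam γ₁ φ₁ ∧ IsParam γ₂ φ₂ ∧
    d = ⨆ x : Circle, ‖φ₁ x - φ₂ x‖ }

/-- The curvature vector of a curve `c` parametrized by angle, at parameter `x`:
`kn = (1/‖c'‖) ∂ₓ(c'/‖c'‖)`. -/
noncomputable def curvatureVector (c : ℝ → E2) (x : ℝ) : E2 :=
  ‖deriv c x‖⁻¹ • deriv (fun y => ‖deriv c y‖⁻¹ • deriv c y) x

/-- A solution to the curvature flow problem with initial curve `γ₀` and stopping time `T`: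
a smooth map `Γ : S¹ × (0,T) → ℝ²` (with `S¹` parametrized by angle, i.e. `Γ` is `2π`-periodic
in the space variable), injective on `S¹` with nonvanishing space derivative for each fixed
time, satisfying `∂ₜΓ = kn` and converging to `γ₀` in Fréchet distance as `t → 0⁺`. -/
structure CurvatureFlowSolution (γ₀ : Set E2) (T : ℝ) where
  Γ : ℝ → ℝ → E2
  periodic : ∀ t, Function.Periodic (fun x => Γ x t) (2 * π)
  smooth : ContDiffOn ℝ (⊤ : ℕ∞) (fun p : ℝ × ℝ => Γ p.1 p.2) (univ ×ˢ Ioo 0 T)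
  inj : ∀ t ∈ Ioo 0 T, ∀ x ∈ Ico 0 (2 * π), ∀ y ∈ Ico 0 (2 * π), Γ x t = Γ y t → x = y
  deriv_ne : ∀ t ∈ Ioo 0 T, ∀ x : ℝ, deriv (fun y => Γ y t) x ≠ 0
  flow : ∀ t ∈ Ioo 0 T, ∀ x : ℝ,
    deriv (fun s => Γ x s) t = curvatureVector (fun y => Γ y t) x
  init : Tendsto (fun t => frechetDist (Set.range (fun x => Γ x t)) γ₀)
    (nhdsWithin 0 (Ioi 0)) (nhds 0)

/-- The evolved curve at time `t` (by convention, the initial curve at `t = 0`). -/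
noncomputable def CurvatureFlowSolution.cf {γ₀ : Set E2} {T : ℝ}
    (sol : CurvatureFlowSolution γ₀ T) (t : ℝ) : Set E2 :=
  if t = 0 then γ₀ else Set.range (fun x => sol.Γ x t)

/-- A set consisting of exactly two points. -/
def HasTwoPoints (s : Set E2) : Prop := ∃ a b : E2, a ≠ b ∧ s = {a, b}

section Auxiliary

open scoped ContDiff Topology

/-- Smoothness of a (curried) function on the strip `ℝ × (0, S)`. -/
def StripSmooth (S : ℝ) (f : ℝ → ℝ → ℝ) : Prop :=
  ContDiffOn ℝ ∞ (fun p : ℝ × ℝ => f p.1 p.2) (univ ×ˢ Ioo 0 S)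

/-- The partial derivative in the space variable. -/
def dx (f : ℝ → ℝ → ℝ) : ℝ → ℝ → ℝ := fun x t => deriv (fun y => f y t) x

/-- The partial derivative in the time variable. -/
def dt (f : ℝ → ℝ → ℝ) : ℝ → ℝ → ℝ := fun x t => deriv (fun s => f x s) t

lemma isOpen_strip (S : ℝ) : IsOpen ((univ : Set ℝ) ×ˢ Ioo 0 S) := isOpen_univ.prod isOpen_Ioo

lemma dx_congr {f g : ℝ → ℝ → ℝ} {t : ℝ} (h : ∀ x, f x t = g x t) (x : ℝ) :
    dx f x t = dx g x t := by
  have : (fun y => f y t) = fun y => g y t := funext h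
  simp only [dx, this]

lemma dt_congr {S : ℝ} {f g : ℝ → ℝ → ℝ} {x t : ℝ} (h : ∀ s ∈ Ioo 0 S, f x s = g x s)
    (ht : t ∈ Ioo 0 S) : dt f x t = dt g x t := by
  apply Filter.EventuallyEq.deriv_eq
  filter_upwards [isOpen_Ioo.mem_nhds ht] with s hs using h s hs

namespace StripSmooth

variable {S : ℝ} {f g : ℝ → ℝ → ℝ}

lemma contDiffAt (hf : StripSmooth S f) {x t : ℝ} (ht : t ∈ Ioo 0 S) :
    ContDiffAt ℝ ∞ (fun p : ℝ × ℝ => f p.1 p.2) (x, t) :=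
  ContDiffOn.contDiffAt hf ((isOpen_strip S).mem_nhds ⟨mem_univ _, ht⟩)

lemma continuousOn (hf : StripSmooth S f) :
    ContinuousOn (fun p : ℝ × ℝ => f p.1 p.2) (univ ×ˢ Ioo 0 S) := ContDiffOn.continuousOn hf

lemma hasFDerivAt (hf : StripSmooth S f) {x t : ℝ} (ht : t ∈ Ioo 0 S) :
    HasFDerivAt (fun p : ℝ × ℝ => f p.1 p.2)
      (fderiv ℝ (fun p : ℝ × ℝ => f p.1 p.2) (x, t)) (x, t) :=
  ((hf.contDiffAt ht).differentiableAt (by simp)).hasFDerivAt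

lemma hasDerivAt_fderiv_x (hf : StripSmooth S f) {x t : ℝ} (ht : t ∈ Ioo 0 S) :
    HasDerivAt (fun y => f y t) (fderiv ℝ (fun p : ℝ × ℝ => f p.1 p.2) (x, t) (1, 0)) x := by
  have h1 : HasDerivAt (fun y : ℝ => (y, t)) ((1 : ℝ), (0 : ℝ)) x :=
    (hasDerivAt_id x).prodMk (hasDerivAt_const x t)
  exact (hf.hasFDerivAt ht).comp_hasDerivAt x h1

lemma hasDerivAt_fderiv_t (hf : StripSmooth S f) {x t : ℝ} (ht : t ∈ Ioo 0 S) :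
    HasDerivAt (fun s => f x s) (fderiv ℝ (fun p : ℝ × ℝ => f p.1 p.2) (x, t) (0, 1)) t := by
  have h1 : HasDerivAt (fun s : ℝ => (x, s)) ((0 : ℝ), (1 : ℝ)) t :=
    (hasDerivAt_const t x).prodMk (hasDerivAt_id t)
  exact (hf.hasFDerivAt ht).comp_hasDerivAt t h1

lemma dx_eq_fderiv (hf : StripSmooth S f) {x t : ℝ} (ht : t ∈ Ioo 0 S) :
    dx f x t = fderiv ℝ (fun p : ℝ × ℝ => f p.1 p.2) (x, t) (1, 0) :=
  (hf.hasDerivAt_fderiv_x ht).deriv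

lemma dt_eq_fderiv (hf : StripSmooth S f) {x t : ℝ} (ht : t ∈ Ioo 0 S) :
    dt f x t = fderiv ℝ (fun p : ℝ × ℝ => f p.1 p.2) (x, t) (0, 1) :=
  (hf.hasDerivAt_fderiv_t ht).deriv

lemma hasDerivAt_x (hf : StripSmooth S f) {t : ℝ} (ht : t ∈ Ioo 0 S) (x : ℝ) :
    HasDerivAt (fun y => f y t) (dx f x t) x := by
  rw [hf.dx_eq_fderiv ht]; exact hf.hasDerivAt_fderiv_x ht

lemma hasDerivAt_t (hf : StripSmooth S f) {t : ℝ} (ht : t ∈ Ioo 0 S) (x : ℝ) :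
    HasDerivAt (fun s => f x s) (dt f x t) t := by
  rw [hf.dt_eq_fderiv ht]; exact hf.hasDerivAt_fderiv_t ht

lemma contDiffOn_fderiv (hf : StripSmooth S f) :
    ContDiffOn ℝ ∞ (fderiv ℝ (fun p : ℝ × ℝ => f p.1 p.2)) (univ ×ˢ Ioo 0 S) :=
  ContDiffOn.fderiv_of_isOpen hf (isOpen_strip S) (by simp)

protected lemma dx (hf : StripSmooth S f) : StripSmooth S (dx f) := by
  have h : ContDiffOn ℝ ∞
      (fun p : ℝ × ℝ => fderiv ℝ (fun p : ℝ × ℝ => f p.1 p.2) p (1, 0)) (univ ×ˢ Ioo 0 S) :=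
    hf.contDiffOn_fderiv.clm_apply contDiffOn_const
  exact h.congr fun p hp => hf.dx_eq_fderiv hp.2

protected lemma dt (hf : StripSmooth S f) : StripSmooth S (dt f) := by
  have h : ContDiffOn ℝ ∞
      (fun p : ℝ × ℝ => fderiv ℝ (fun p : ℝ × ℝ => f p.1 p.2) p (0, 1)) (univ ×ˢ Ioo 0 S) :=
    hf.contDiffOn_fderiv.clm_apply contDiffOn_const
  exact h.congr fun p hp => hf.dt_eq_fderiv hp.2

lemma dt_dx (hf : StripSmooth S f) {t : ℝ} (ht : t ∈ Ioo 0 S) (x : ℝ) :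
    dt (dx f) x t = dx (dt f) x t := by
  set F : ℝ × ℝ → ℝ := fun p => f p.1 p.2 with hF
  have hd : DifferentiableAt ℝ (fderiv ℝ F) (x, t) :=
    ((hf.contDiffOn_fderiv.contDiffAt ((isOpen_strip S).mem_nhds ⟨mem_univ _, ht⟩)).differentiableAt
      (by simp))
  have hnhds : ∀ᶠ p in 𝓝 (x, t), p ∈ (univ : Set ℝ) ×ˢ Ioo 0 S :=
    (isOpen_strip S).mem_nhds ⟨mem_univ _, ht⟩
  have e1 : (fun p : ℝ × ℝ => dx f p.1 p.2) =ᶠ[𝓝 (x, t)] fun p => fderiv ℝ F p (1, 0) := by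
    filter_upwards [hnhds] with p hp using hf.dx_eq_fderiv hp.2
  have e2 : (fun p : ℝ × ℝ => dt f p.1 p.2) =ᶠ[𝓝 (x, t)] fun p => fderiv ℝ F p (0, 1) := by
    filter_upwards [hnhds] with p hp using hf.dt_eq_fderiv hp.2
  rw [hf.dx.dt_eq_fderiv ht, hf.dt.dx_eq_fderiv ht, e1.fderiv_eq, e2.fderiv_eq,
    (hd.hasFDerivAt.clm_apply (hasFDerivAt_const ((1 : ℝ), (0 : ℝ)) (x, t))).fderiv,
    (hd.hasFDerivAt.clm_apply (hasFDerivAt_const ((0 : ℝ), (1 : ℝ)) (x, t))).fderiv]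
  have hs : IsSymmSndFDerivAt ℝ F (x, t) :=
    (hf.contDiffAt ht).isSymmSndFDerivAt (by simpa using WithTop.coe_le_coe.2 (le_top (a := (2 : ℕ∞))))
  simpa using hs.eq (0, 1) (1, 0)

lemma const (S c : ℝ) : StripSmooth S fun _ _ => c := contDiffOn_const

lemma time {ρ : ℝ → ℝ} (h : ContDiff ℝ ∞ ρ) (S : ℝ) : StripSmooth S fun _ t => ρ t :=
  (h.comp contDiff_snd).contDiffOn

lemma add (hf : StripSmooth S f) (hg : StripSmooth S g) :
    StripSmooth S fun x t => f x t + g x t := ContDiffOn.add hf hg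

lemma sub (hf : StripSmooth S f) (hg : StripSmooth S g) :
    StripSmooth S fun x t => f x t - g x t := ContDiffOn.sub hf hg

lemma neg (hf : StripSmooth S f) : StripSmooth S fun x t => - f x t := ContDiffOn.neg hf

lemma mul (hf : StripSmooth S f) (hg : StripSmooth S g) :
    StripSmooth S fun x t => f x t * g x t := ContDiffOn.mul hf hg

lemma pow (hf : StripSmooth S f) (n : ℕ) : StripSmooth S fun x t => f x t ^ n :=
  ContDiffOn.pow hf n

lemma inv (hf : StripSmooth S f) (h : ∀ x, ∀ t ∈ Ioo 0 S, f x t ≠ 0) :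
    StripSmooth S fun x t => (f x t)⁻¹ := ContDiffOn.inv hf fun p hp => h p.1 p.2 hp.2

lemma sqrt (hf : StripSmooth S f) (h : ∀ x, ∀ t ∈ Ioo 0 S, f x t ≠ 0) :
    StripSmooth S fun x t => √(f x t) := ContDiffOn.sqrt hf fun p hp => h p.1 p.2 hp.2

lemma sum {ι : Type*} {F : ι → ℝ → ℝ → ℝ} (s : Finset ι) (h : ∀ i ∈ s, StripSmooth S (F i)) :
    StripSmooth S fun x t => ∑ i ∈ s, F i x t :=
  ContDiffOn.sum (f := fun i (p : ℝ × ℝ) => F i p.1 p.2) h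

lemma comp_reparam (hf : StripSmooth S f) {φ : ℝ → ℝ} (hφ : ContDiff ℝ ∞ φ) :
    StripSmooth S fun x t => f (φ x) t := by
  have h : ContDiffOn ℝ ∞ (fun p : ℝ × ℝ => (φ p.1, p.2)) (univ ×ˢ Ioo 0 S) :=
    ((hφ.comp contDiff_fst).prodMk contDiff_snd).contDiffOn
  exact ContDiffOn.comp hf h fun p hp => ⟨mem_univ _, hp.2⟩

lemma contDiff_x (hf : StripSmooth S f) {t : ℝ} (ht : t ∈ Ioo 0 S) :
    ContDiff ℝ ∞ fun x => f x t := by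
  rw [contDiff_iff_contDiffAt]
  intro x
  exact ContDiffAt.comp (g := fun p : ℝ × ℝ => f p.1 p.2) (f := fun y : ℝ => (y, t)) x
    (hf.contDiffAt ht) (contDiffAt_id.prodMk contDiffAt_const)

lemma continuous_x (hf : StripSmooth S f) {t : ℝ} (ht : t ∈ Ioo 0 S) :
    Continuous fun x => f x t := (hf.contDiff_x ht).continuous

lemma exists_bound (hf : StripSmooth S f) {a b c d : ℝ} (hc : 0 < c) (hd : d < S) :
    ∃ C, 0 < C ∧ ∀ x ∈ Icc a b, ∀ t ∈ Icc c d, |f x t| ≤ C := by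
  have hcont : ContinuousOn (fun p : ℝ × ℝ => f p.1 p.2) (Icc a b ×ˢ Icc c d) :=
    hf.continuousOn.mono fun p hp => ⟨mem_univ _, hc.trans_le hp.2.1, hp.2.2.trans_lt hd⟩
  obtain ⟨C, hC⟩ := (isCompact_Icc.prod isCompact_Icc).exists_bound_of_continuousOn hcont
  refine ⟨max C 1, by positivity, fun x hx t ht => (hC (x, t) ⟨hx, ht⟩).trans (le_max_left _ _)⟩

end StripSmooth

section calculus
variable {S : ℝ} {f g : ℝ → ℝ → ℝ} {t : ℝ}

lemma dx_add (hf : StripSmooth S f) (hg : StripSmooth S g) (ht : t ∈ Ioo 0 S) (x : ℝ) :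
    dx (fun x t => f x t + g x t) x t = dx f x t + dx g x t :=
  ((hf.hasDerivAt_x ht x).add (hg.hasDerivAt_x ht x)).deriv

lemma dx_sub (hf : StripSmooth S f) (hg : StripSmooth S g) (ht : t ∈ Ioo 0 S) (x : ℝ) :
    dx (fun x t => f x t - g x t) x t = dx f x t - dx g x t :=
  ((hf.hasDerivAt_x ht x).sub (hg.hasDerivAt_x ht x)).deriv

lemma dx_mul (hf : StripSmooth S f) (hg : StripSmooth S g) (ht : t ∈ Ioo 0 S) (x : ℝ) :
    dx (fun x t => f x t * g x t) x t = dx f x t * g x t + f x t * dx g x t :=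
  ((hf.hasDerivAt_x ht x).mul (hg.hasDerivAt_x ht x)).deriv

lemma dx_neg (hf : StripSmooth S f) (ht : t ∈ Ioo 0 S) (x : ℝ) :
    dx (fun x t => - f x t) x t = - dx f x t := (hf.hasDerivAt_x ht x).neg.deriv

lemma dx_pow (hf : StripSmooth S f) (n : ℕ) (ht : t ∈ Ioo 0 S) (x : ℝ) :
    dx (fun x t => f x t ^ n) x t = n * f x t ^ (n - 1) * dx f x t :=
  ((hf.hasDerivAt_x ht x).pow n).deriv

lemma dx_const_mul (c : ℝ) (hf : StripSmooth S f) (ht : t ∈ Ioo 0 S) (x : ℝ) :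
    dx (fun x t => c * f x t) x t = c * dx f x t :=
  ((hf.hasDerivAt_x ht x).const_mul c).deriv

lemma dt_sub (hf : StripSmooth S f) (hg : StripSmooth S g) (ht : t ∈ Ioo 0 S) (x : ℝ) :
    dt (fun x t => f x t - g x t) x t = dt f x t - dt g x t :=
  ((hf.hasDerivAt_t ht x).sub (hg.hasDerivAt_t ht x)).deriv

lemma dt_mul (hf : StripSmooth S f) (hg : StripSmooth S g) (ht : t ∈ Ioo 0 S) (x : ℝ) :
    dt (fun x t => f x t * g x t) x t = dt f x t * g x t + f x t * dt g x t :=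
  ((hf.hasDerivAt_t ht x).mul (hg.hasDerivAt_t ht x)).deriv

lemma dt_const_mul (c : ℝ) (hf : StripSmooth S f) (ht : t ∈ Ioo 0 S) (x : ℝ) :
    dt (fun x t => c * f x t) x t = c * dt f x t :=
  ((hf.hasDerivAt_t ht x).const_mul c).deriv

lemma dx_sum {ι : Type*} {F : ι → ℝ → ℝ → ℝ} (s : Finset ι) (h : ∀ i ∈ s, StripSmooth S (F i))
    (ht : t ∈ Ioo 0 S) (x : ℝ) :
    dx (fun x t => ∑ i ∈ s, F i x t) x t = ∑ i ∈ s, dx (F i) x t :=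
  (HasDerivAt.fun_sum fun i hi => (h i hi).hasDerivAt_x ht x).deriv

lemma dx_periodic {L : ℝ} (h : ∀ x, f (x + L) t = f x t) (x : ℝ) :
    dx f (x + L) t = dx f x t := by
  have : (fun y => f (y + L) t) = fun y => f y t := funext h
  simp only [dx]
  rw [← deriv_comp_add_const (f := fun y => f y t), this]

lemma dt_periodic {L : ℝ} {x : ℝ} (h : ∀ t ∈ Ioo 0 S, f (x + L) t = f x t) (ht : t ∈ Ioo 0 S) :
    dt f (x + L) t = dt f x t :=
  dt_congr (f := fun x t => f (x + L) t) h ht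

end calculus

/-- The inverse speed `1 / ‖Γₓ‖` of the family of plane curves `Γ = (X, Y)`. -/
def invSpeed (X Y : ℝ → ℝ → ℝ) : ℝ → ℝ → ℝ :=
  fun x t => √((dx X x t ^ 2 + dx Y x t ^ 2)⁻¹)

/-- The signed curvature of the family of plane curves `Γ = (X, Y)`. -/
def signedCurv (X Y : ℝ → ℝ → ℝ) : ℝ → ℝ → ℝ :=
  fun x t => (dx X x t * dx (dx Y) x t - dx Y x t * dx (dx X) x t) * invSpeed X Y x t ^ 3

section immersion
variable {S : ℝ} {X Y : ℝ → ℝ → ℝ}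

lemma invSpeed_pos (imm : ∀ x, ∀ t ∈ Ioo 0 S, 0 < dx X x t ^ 2 + dx Y x t ^ 2)
    {x t : ℝ} (ht : t ∈ Ioo 0 S) : 0 < invSpeed X Y x t :=
  Real.sqrt_pos.2 (inv_pos.2 (imm x t ht))

lemma invSpeed_sq (imm : ∀ x, ∀ t ∈ Ioo 0 S, 0 < dx X x t ^ 2 + dx Y x t ^ 2)
    {x t : ℝ} (ht : t ∈ Ioo 0 S) :
    invSpeed X Y x t ^ 2 * (dx X x t ^ 2 + dx Y x t ^ 2) = 1 := by
  have := imm x t ht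
  rw [invSpeed, Real.sq_sqrt (by positivity), inv_mul_cancel₀ this.ne']

lemma StripSmooth.invSpeed (hX : StripSmooth S X) (hY : StripSmooth S Y)
    (imm : ∀ x, ∀ t ∈ Ioo 0 S, 0 < dx X x t ^ 2 + dx Y x t ^ 2) :
    StripSmooth S (invSpeed X Y) :=
  (((hX.dx.pow 2).add (hY.dx.pow 2)).inv fun x t ht => (imm x t ht).ne').sqrt
    fun x t ht => (inv_pos.2 (imm x t ht)).ne'

lemma dx_invSpeed (hX : StripSmooth S X) (hY : StripSmooth S Y)
    (imm : ∀ x, ∀ t ∈ Ioo 0 S, 0 < dx X x t ^ 2 + dx Y x t ^ 2) {x t : ℝ} (ht : t ∈ Ioo 0 S) :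
    dx (invSpeed X Y) x t = - invSpeed X Y x t ^ 3 *
      (dx X x t * dx (dx X) x t + dx Y x t * dx (dx Y) x t) := by
  have e : ∀ x, invSpeed X Y x t ^ 2 * (dx X x t ^ 2 + dx Y x t ^ 2) = 1 :=
    fun x => invSpeed_sq imm ht
  have h1 := ((((hX.invSpeed hY imm).hasDerivAt_x ht x).pow 2).mul
    (((hX.dx.hasDerivAt_x ht x).pow 2).add ((hY.dx.hasDerivAt_x ht x).pow 2)))
  have h2 : HasDerivAt (fun x => invSpeed X Y x t ^ 2 * (dx X x t ^ 2 + dx Y x t ^ 2)) 0 x := by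
    simp only [e]; exact hasDerivAt_const _ _
  have h3 := h1.unique h2
  simp at h3
  have hp := invSpeed_pos imm (x := x) ht
  have := e x
  have h4 : invSpeed X Y x t * (2 * dx (invSpeed X Y) x t * (dx X x t ^ 2 + dx Y x t ^ 2) +
    2 * invSpeed X Y x t * (dx X x t * dx (dx X) x t + dx Y x t * dx (dx Y) x t)) = 0 := by
    linear_combination h3
  have h5 := (mul_eq_zero.1 h4).resolve_left hp.ne'
  linear_combination (-dx (invSpeed X Y) x t) * this + invSpeed X Y x t ^ 2 / 2 * h5

lemma dx_invSpeed_mul_dx_fst (hX : StripSmooth S X) (hY : StripSmooth S Y)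
    (imm : ∀ x, ∀ t ∈ Ioo 0 S, 0 < dx X x t ^ 2 + dx Y x t ^ 2) {x t : ℝ} (ht : t ∈ Ioo 0 S) :
    dx (fun x t => invSpeed X Y x t * dx X x t) x t = - (signedCurv X Y x t * dx Y x t) := by
  rw [dx_mul (hX.invSpeed hY imm) hX.dx ht x, dx_invSpeed hX hY imm ht, signedCurv]
  linear_combination (-invSpeed X Y x t * dx (dx X) x t) * invSpeed_sq imm (x := x) ht

lemma dx_invSpeed_mul_dx_snd (hX : StripSmooth S X) (hY : StripSmooth S Y)
    (imm : ∀ x, ∀ t ∈ Ioo 0 S, 0 < dx X x t ^ 2 + dx Y x t ^ 2) {x t : ℝ} (ht : t ∈ Ioo 0 S) :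
    dx (fun x t => invSpeed X Y x t * dx Y x t) x t = signedCurv X Y x t * dx X x t := by
  rw [dx_mul (hX.invSpeed hY imm) hY.dx ht x, dx_invSpeed hX hY imm ht, signedCurv]
  linear_combination (-invSpeed X Y x t * dx (dx Y) x t) * invSpeed_sq imm (x := x) ht

end immersion

/-- An embedded `L`-periodic solution of curve shortening flow on the time interval `(0, S)`,
in coordinates. -/
structure NormalFlow (S L : ℝ) where
  X : ℝ → ℝ → ℝ
  Y : ℝ → ℝ → ℝ
  smX : StripSmooth S X
  smY : StripSmooth S Y
  perX : ∀ x, ∀ t ∈ Ioo 0 S, X (x + L) t = X x t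
  perY : ∀ x, ∀ t ∈ Ioo 0 S, Y (x + L) t = Y x t
  imm : ∀ x, ∀ t ∈ Ioo 0 S, 0 < dx X x t ^ 2 + dx Y x t ^ 2
  flowX : ∀ x, ∀ t ∈ Ioo 0 S, dt X x t = -(signedCurv X Y x t * invSpeed X Y x t * dx Y x t)
  flowY : ∀ x, ∀ t ∈ Ioo 0 S, dt Y x t = signedCurv X Y x t * invSpeed X Y x t * dx X x t
  inj : ∀ t ∈ Ioo 0 S, ∀ x y, X x t = X y t → Y x t = Y y t → ∃ n : ℤ, y = x + n * L

namespace NormalFlow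
variable {S L : ℝ} (Γ : NormalFlow S L)

/-- The inverse speed of a flow. -/
def h : ℝ → ℝ → ℝ := invSpeed Γ.X Γ.Y

/-- The signed curvature of a flow. -/
def κ : ℝ → ℝ → ℝ := signedCurv Γ.X Γ.Y

/-- First component of the unit tangent. -/
def c : ℝ → ℝ → ℝ := fun x t => Γ.h x t * dx Γ.X x t

/-- Second component of the unit tangent. -/
def s : ℝ → ℝ → ℝ := fun x t => Γ.h x t * dx Γ.Y x t

lemma h_pos {x t : ℝ} (ht : t ∈ Ioo 0 S) : 0 < Γ.h x t := invSpeed_pos Γ.imm ht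

lemma h_sq {x t : ℝ} (ht : t ∈ Ioo 0 S) :
    Γ.h x t ^ 2 * (dx Γ.X x t ^ 2 + dx Γ.Y x t ^ 2) = 1 := invSpeed_sq Γ.imm ht

lemma sm_h : StripSmooth S Γ.h := Γ.smX.invSpeed Γ.smY Γ.imm

lemma sm_κ : StripSmooth S Γ.κ :=
  ((Γ.smX.dx.mul Γ.smY.dx.dx).sub (Γ.smY.dx.mul Γ.smX.dx.dx)).mul (Γ.sm_h.pow 3)

lemma sm_c : StripSmooth S Γ.c := Γ.sm_h.mul Γ.smX.dx

lemma sm_s : StripSmooth S Γ.s := Γ.sm_h.mul Γ.smY.dx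

lemma c_sq_add_s_sq {x t : ℝ} (ht : t ∈ Ioo 0 S) : Γ.c x t ^ 2 + Γ.s x t ^ 2 = 1 := by
  have := Γ.h_sq (x := x) ht
  simp only [c, s]; linear_combination this

lemma dt_h_aux {x t : ℝ} (ht : t ∈ Ioo 0 S) :
    dt Γ.h x t = - Γ.h x t ^ 3 *
      (dx Γ.X x t * dx (dt Γ.X) x t + dx Γ.Y x t * dx (dt Γ.Y) x t) := by
  have e : ∀ s ∈ Ioo 0 S, Γ.h x s ^ 2 * (dx Γ.X x s ^ 2 + dx Γ.Y x s ^ 2) = 1 :=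
    fun x => Γ.h_sq
  have h1 := (((Γ.sm_h.hasDerivAt_t ht x).pow 2).mul
    (((Γ.smX.dx.hasDerivAt_t ht x).pow 2).add ((Γ.smY.dx.hasDerivAt_t ht x).pow 2)))
  have h2 : HasDerivAt (fun s => Γ.h x s ^ 2 * (dx Γ.X x s ^ 2 + dx Γ.Y x s ^ 2)) 0 t := by
    refine (hasDerivAt_const t (1 : ℝ)).congr_of_eventuallyEq ?_
    filter_upwards [isOpen_Ioo.mem_nhds ht] with s hs using e s hs
  have h3 := h1.unique h2
  simp [Γ.smX.dt_dx ht, Γ.smY.dt_dx ht] at h3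
  have hp := Γ.h_pos (x := x) ht
  have := e t ht
  have h4 : Γ.h x t * (2 * dt Γ.h x t * (dx Γ.X x t ^ 2 + dx Γ.Y x t ^ 2) + 2 * Γ.h x t *
    (dx Γ.X x t * dx (dt Γ.X) x t + dx Γ.Y x t * dx (dt Γ.Y) x t)) = 0 := by
    linear_combination h3
  have h5 := (mul_eq_zero.1 h4).resolve_left hp.ne'
  linear_combination (-dt Γ.h x t) * this + Γ.h x t ^ 2 / 2 * h5

lemma dx_c {x t : ℝ} (ht : t ∈ Ioo 0 S) : dx Γ.c x t = - (Γ.κ x t * dx Γ.Y x t) :=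
  dx_invSpeed_mul_dx_fst Γ.smX Γ.smY Γ.imm ht

lemma dx_s {x t : ℝ} (ht : t ∈ Ioo 0 S) : dx Γ.s x t = Γ.κ x t * dx Γ.X x t :=
  dx_invSpeed_mul_dx_snd Γ.smX Γ.smY Γ.imm ht

lemma dt_X {x t : ℝ} (ht : t ∈ Ioo 0 S) : dt Γ.X x t = - (Γ.κ x t * Γ.s x t) := by
  rw [Γ.flowX x t ht]; simp only [κ, s, h]; ring

lemma dt_Y {x t : ℝ} (ht : t ∈ Ioo 0 S) : dt Γ.Y x t = Γ.κ x t * Γ.c x t := by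
  rw [Γ.flowY x t ht]; simp only [κ, c, h]; ring

lemma dx_dt_X {x t : ℝ} (ht : t ∈ Ioo 0 S) :
    dx (dt Γ.X) x t = - (dx Γ.κ x t * Γ.s x t) - Γ.κ x t ^ 2 * dx Γ.X x t := by
  rw [dx_congr (g := fun x t => -(Γ.κ x t * Γ.s x t)) (fun x => Γ.dt_X (x := x) ht), dx_neg (Γ.sm_κ.mul Γ.sm_s) ht,
    dx_mul Γ.sm_κ Γ.sm_s ht, Γ.dx_s ht]
  ring

lemma dx_dt_Y {x t : ℝ} (ht : t ∈ Ioo 0 S) :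
    dx (dt Γ.Y) x t = dx Γ.κ x t * Γ.c x t - Γ.κ x t ^ 2 * dx Γ.Y x t := by
  rw [dx_congr (g := fun x t => Γ.κ x t * Γ.c x t) (fun x => Γ.dt_Y (x := x) ht), dx_mul Γ.sm_κ Γ.sm_c ht, Γ.dx_c ht]
  ring

lemma dt_h {x t : ℝ} (ht : t ∈ Ioo 0 S) : dt Γ.h x t = Γ.κ x t ^ 2 * Γ.h x t := by
  rw [Γ.dt_h_aux ht, Γ.dx_dt_X ht, Γ.dx_dt_Y ht]
  simp only [c, s]
  linear_combination Γ.h x t * Γ.κ x t ^ 2 * Γ.h_sq (x := x) ht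

/-- The arclength derivative. -/
def D (f : ℝ → ℝ → ℝ) : ℝ → ℝ → ℝ := fun x t => Γ.h x t * dx f x t

lemma sm_D {f : ℝ → ℝ → ℝ} (hf : StripSmooth S f) : StripSmooth S (Γ.D f) := Γ.sm_h.mul hf.dx

lemma dt_D {f : ℝ → ℝ → ℝ} (hf : StripSmooth S f) {x t : ℝ} (ht : t ∈ Ioo 0 S) :
    dt (Γ.D f) x t = Γ.κ x t ^ 2 * Γ.D f x t + Γ.D (dt f) x t := by
  have h1 : dt (Γ.D f) x t = _ := dt_mul Γ.sm_h hf.dx ht x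
  rw [h1, Γ.dt_h ht, hf.dt_dx ht, D, D]
  ring

lemma dt_c {x t : ℝ} (ht : t ∈ Ioo 0 S) : dt Γ.c x t = - (Γ.D Γ.κ x t * Γ.s x t) := by
  have h1 : dt Γ.c x t = _ := dt_mul Γ.sm_h Γ.smX.dx ht x
  rw [h1, Γ.dt_h ht, Γ.smX.dt_dx ht, Γ.dx_dt_X ht]
  simp only [D]; ring

lemma dt_s {x t : ℝ} (ht : t ∈ Ioo 0 S) : dt Γ.s x t = Γ.D Γ.κ x t * Γ.c x t := by
  have h1 : dt Γ.s x t = _ := dt_mul Γ.sm_h Γ.smY.dx ht x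
  rw [h1, Γ.dt_h ht, Γ.smY.dt_dx ht, Γ.dx_dt_Y ht]
  simp only [D]; ring

lemma κ_eq {x t : ℝ} (ht : t ∈ Ioo 0 S) :
    Γ.κ x t = Γ.h x t * (Γ.c x t * dx Γ.s x t - Γ.s x t * dx Γ.c x t) := by
  rw [Γ.dx_s ht, Γ.dx_c ht]
  simp only [c, s]
  linear_combination (-Γ.κ x t) * Γ.h_sq (x := x) ht

/-- The evolution equation of the curvature. -/
lemma dt_κ {x t : ℝ} (ht : t ∈ Ioo 0 S) :
    dt Γ.κ x t = Γ.D (Γ.D Γ.κ) x t + Γ.κ x t ^ 3 := by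
  have h1 : dt Γ.κ x t = _ := dt_congr (S := S)
    (g := fun x t => Γ.h x t * (Γ.c x t * dx Γ.s x t - Γ.s x t * dx Γ.c x t))
    (fun t ht => Γ.κ_eq ht) ht
  have sDκ := Γ.sm_D Γ.sm_κ
  have e1 : dt (dx Γ.s) x t = _ := (Γ.sm_s.dt_dx ht x).trans
    ((dx_congr (g := fun x t => Γ.D Γ.κ x t * Γ.c x t) (fun x => Γ.dt_s (x := x) ht) x).trans (dx_mul sDκ Γ.sm_c ht x))
  have e2 : dt (dx Γ.c) x t = _ := (Γ.sm_c.dt_dx ht x).trans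
    ((dx_congr (g := fun x t => -(Γ.D Γ.κ x t * Γ.s x t)) (fun x => Γ.dt_c (x := x) ht) x).trans ((dx_neg (sDκ.mul Γ.sm_s) ht x).trans
      (congrArg Neg.neg (dx_mul sDκ Γ.sm_s ht x))))
  rw [h1, dt_mul Γ.sm_h ((Γ.sm_c.mul Γ.sm_s.dx).sub (Γ.sm_s.mul Γ.sm_c.dx)) ht,
    dt_sub (Γ.sm_c.mul Γ.sm_s.dx) (Γ.sm_s.mul Γ.sm_c.dx) ht, dt_mul Γ.sm_c Γ.sm_s.dx ht,
    dt_mul Γ.sm_s Γ.sm_c.dx ht, e1, e2, Γ.dt_h ht, Γ.dt_c ht, Γ.dt_s ht]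
  have k := Γ.κ_eq (x := x) ht
  have p := Γ.c_sq_add_s_sq (x := x) ht
  have d : Γ.D (Γ.D Γ.κ) x t = Γ.h x t * dx (Γ.D Γ.κ) x t := rfl
  rw [d]
  linear_combination (-Γ.κ x t ^ 2) * k + Γ.h x t * dx (Γ.D Γ.κ) x t * p

lemma h_periodic {t : ℝ} (ht : t ∈ Ioo 0 S) (x : ℝ) : Γ.h (x + L) t = Γ.h x t := by
  simp only [h, invSpeed, dx_periodic (fun x => Γ.perX x t ht),
    dx_periodic (fun x => Γ.perY x t ht)]

lemma D_periodic {f : ℝ → ℝ → ℝ} {t : ℝ} (hf : ∀ x, f (x + L) t = f x t) (ht : t ∈ Ioo 0 S)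
    (x : ℝ) : Γ.D f (x + L) t = Γ.D f x t := by
  simp only [D, Γ.h_periodic ht, dx_periodic hf]

lemma κ_periodic {t : ℝ} (ht : t ∈ Ioo 0 S) (x : ℝ) : Γ.κ (x + L) t = Γ.κ x t := by
  have hX := dx_periodic (fun x => Γ.perX x t ht)
  have hY := dx_periodic (fun x => Γ.perY x t ht)
  have := Γ.h_periodic ht x
  simp only [h] at this
  simp only [κ, signedCurv, hX, hY, this, dx_periodic hX, dx_periodic hY]

end NormalFlow

lemma deriv_deriv_nonpos_of_isLocalMax {f : ℝ → ℝ} {x : ℝ} (h : IsLocalMax f x)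
    (hc : ContinuousAt f x) : deriv (deriv f) x ≤ 0 := by
  by_contra! hpos
  have hmin := isLocalMin_of_deriv_deriv_pos hpos h.deriv_eq_zero hc
  have hconst : f =ᶠ[𝓝 x] fun _ => f x := by
    filter_upwards [h, hmin] with y h1 h2 using le_antisymm h1 h2
  have : deriv (deriv f) x = 0 := by
    rw [hconst.deriv.deriv_eq]; simp
  linarith

/-- A scalar maximum principle for periodic functions. -/
lemma lt_of_periodic_max_principle {S L : ℝ} (hL : 0 < L) {f : ℝ → ℝ → ℝ}
    (hf : StripSmooth S f)
    {t₀ t₁ B Λ : ℝ} (h0 : 0 < t₀) (h1 : t₁ < S)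
    (hper : ∀ t ∈ Ioo 0 S, ∀ x, f (x + L) t = f x t)
    (hstart : ∀ x, f x t₀ < B)
    (hstep : ∀ x, ∀ t ∈ Ioc t₀ t₁, f x t = B + Λ * (t - t₀) → dx f x t = 0 →
      dx (dx f) x t ≤ 0 → dt f x t < Λ) :
    ∀ x, ∀ t ∈ Icc t₀ t₁, f x t < B + Λ * (t - t₀) := by
  by_contra! hcon
  obtain ⟨x₁, s₁, hs₁, hbad⟩ := hcon
  have hred : ∀ x, ∀ t ∈ Ioo 0 S, ∃ y ∈ Icc 0 L, f y t = f x t := by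
    intro x t ht
    have hp : Function.Periodic (fun x => f x t) L := hper t ht
    obtain ⟨y, hy, hxy⟩ := hp.exists_mem_Ico₀ hL x
    exact ⟨y, Ico_subset_Icc_self hy, hxy.symm⟩
  have hI : Icc t₀ t₁ ⊆ Ioo 0 S := fun t ht => ⟨h0.trans_le ht.1, ht.2.trans_lt h1⟩
  set K : Set (ℝ × ℝ) := {p | p ∈ Icc 0 L ×ˢ Icc t₀ t₁ ∧ 0 ≤ f p.1 p.2 - (B + Λ * (p.2 - t₀))}
  have hK : IsCompact K := by
    have hcomp : IsCompact (Icc 0 L ×ˢ Icc t₀ t₁) := isCompact_Icc.prod isCompact_Icc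
    have hcont : ContinuousOn (fun p : ℝ × ℝ => f p.1 p.2 - (B + Λ * (p.2 - t₀)))
        (Icc 0 L ×ˢ Icc t₀ t₁) :=
      (hf.continuousOn.mono fun p hp => ⟨mem_univ _, hI hp.2⟩).sub (by fun_prop)
    exact hcomp.of_isClosed_subset (hcont.preimage_isClosed_of_isClosed hcomp.isClosed isClosed_Ici)
      fun p hp => hp.1
  have hne : K.Nonempty := by
    obtain ⟨y, hy, hyx⟩ := hred x₁ s₁ (hI hs₁)
    exact ⟨(y, s₁), ⟨hy, hs₁⟩, by simp only [hyx]; linarith⟩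
  obtain ⟨⟨x, t⟩, ⟨⟨hx, ht⟩, hge⟩, hmin⟩ := hK.exists_isMinOn hne continuous_snd.continuousOn
  simp only at hx ht hge
  have htI := hI ht
  have hlt : t₀ < t := by
    rcases ht.1.lt_or_eq with h | h
    · exact h
    · subst h; have := hstart x; simp at hge; linarith
  have hbefore : ∀ y, ∀ s ∈ Ico t₀ t, f y s < B + Λ * (s - t₀) := by
    intro y s hs
    by_contra! hc
    have hsI : s ∈ Icc t₀ t₁ := ⟨hs.1, hs.2.le.trans ht.2⟩
    obtain ⟨z, hz, hzy⟩ := hred y s (hI hsI)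
    have : t ≤ s := hmin (a := (z, s)) ⟨⟨hz, hsI⟩, by simp only [hzy]; linarith⟩
    exact absurd hs.2 this.not_gt
  have hle : ∀ y, f y t ≤ B + Λ * (t - t₀) := by
    intro y
    have h1 : Tendsto (fun s => f y s) (𝓝[<] t) (𝓝 (f y t)) :=
      (hf.hasDerivAt_t htI y).continuousAt.tendsto.mono_left nhdsWithin_le_nhds
    have h2 : Tendsto (fun s => B + Λ * (s - t₀)) (𝓝[<] t) (𝓝 (B + Λ * (t - t₀))) :=
      (by fun_prop : Continuous fun s => B + Λ * (s - t₀)).continuousAt.tendsto.mono_left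
        nhdsWithin_le_nhds
    refine le_of_tendsto_of_tendsto h1 h2 ?_
    filter_upwards [Ioo_mem_nhdsLT hlt] with s hs using (hbefore y s ⟨hs.1.le, hs.2⟩).le
  have heq : f x t = B + Λ * (t - t₀) := le_antisymm (hle x) (by linarith)
  have hmax : IsLocalMax (fun y => f y t) x := Eventually.of_forall fun y => by
    simp only [heq]; exact hle y
  have hd := hstep x t ⟨hlt, ht.2⟩ heq hmax.deriv_eq_zero
    (deriv_deriv_nonpos_of_isLocalMax hmax (hf.continuous_x htI).continuousAt)
  -- the time derivative of `f - (B + Λ (t - t₀))` at the first touching time is nonnegative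
  have hg : HasDerivAt (fun s => f x s - (B + Λ * (s - t₀))) (dt f x t - Λ) t := by
    have h2 : HasDerivAt (fun s => B + Λ * (s - t₀)) Λ t := by
      simpa using (((hasDerivAt_id t).sub_const t₀).const_mul Λ).const_add B
    exact (hf.hasDerivAt_t htI x).sub h2
  have hslope := (hasDerivAt_iff_tendsto_slope.1 hg).mono_left (nhdsWithin_mono t
    (fun s (hs : s ∈ Iio t) => ne_of_lt hs))
  have : 0 ≤ dt f x t - Λ := by
    refine ge_of_tendsto hslope ?_
    filter_upwards [Ioo_mem_nhdsLT hlt] with s hs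
    rw [slope_def_field]
    have h3 := hbefore x s ⟨hs.1.le, hs.2⟩
    apply div_nonneg_of_nonpos <;> linarith [hs.2]
  linarith

lemma sum_inv_sq_le (n : ℕ) :
    ∑ i ∈ Finset.range (n + 1), 1 / ((i : ℝ) + 1) ^ 2 ≤ 2 - 1 / ((n : ℝ) + 1) := by
  induction n with
  | zero => norm_num
  | succ n ih =>
    rw [Finset.sum_range_succ]
    have : 1 / (((n + 1 : ℕ) : ℝ) + 1) ^ 2 ≤ 1 / ((n : ℝ) + 1) - 1 / (((n + 1 : ℕ) : ℝ) + 1) := by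
      push_cast
      rw [div_sub_div _ _ (by positivity) (by positivity), div_le_div_iff₀ (by positivity)
        (by positivity)]
      nlinarith [Nat.cast_nonneg (α := ℝ) n]
    linarith

lemma sum_antidiagonal_inv_sq_le (n : ℕ) :
    ∑ p ∈ Finset.HasAntidiagonal.antidiagonal n, ((n : ℝ) + 1) ^ 2 / (((p.1 : ℝ) + 1) * ((p.2 : ℝ) + 1)) ^ 2
      ≤ 8 := by
  have h1 : ∑ p ∈ Finset.HasAntidiagonal.antidiagonal n, 1 / ((p.1 : ℝ) + 1) ^ 2 ≤ 2 := by
    rw [Finset.Nat.sum_antidiagonal_eq_sum_range_succ_mk]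
    have := sum_inv_sq_le n
    have : 0 < 1 / ((n : ℝ) + 1) := by positivity
    simp only
    linarith
  have h2 : ∑ p ∈ Finset.HasAntidiagonal.antidiagonal n, 1 / ((p.2 : ℝ) + 1) ^ 2 ≤ 2 := by
    rw [← Finset.Nat.sum_antidiagonal_swap]; exact h1
  calc _ ≤ ∑ p ∈ Finset.HasAntidiagonal.antidiagonal n,
        (2 * (1 / ((p.1 : ℝ) + 1) ^ 2) + 2 * (1 / ((p.2 : ℝ) + 1) ^ 2)) := by
        apply Finset.sum_le_sum
        intro p hp
        have hp' : (n : ℝ) = p.1 + p.2 := by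
          rw [← Finset.HasAntidiagonal.mem_antidiagonal.1 hp]; push_cast; ring
        have e : 2 * (1 / ((p.1 : ℝ) + 1) ^ 2) + 2 * (1 / ((p.2 : ℝ) + 1) ^ 2) =
            (2 * ((p.2 : ℝ) + 1) ^ 2 + 2 * ((p.1 : ℝ) + 1) ^ 2) /
              (((p.1 : ℝ) + 1) * ((p.2 : ℝ) + 1)) ^ 2 := by
          field_simp
        rw [e, hp']
        gcongr
        nlinarith [sq_nonneg ((p.1 : ℝ) - p.2), Nat.cast_nonneg (α := ℝ) p.1,
          Nat.cast_nonneg (α := ℝ) p.2]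
    _ ≤ 8 := by
        rw [Finset.sum_add_distrib, ← Finset.mul_sum, ← Finset.mul_sum]; linarith

lemma sum_range_antidiagonal_le {A B : ℕ → ℝ} (hA : ∀ n, 0 ≤ A n) (hB : ∀ n, 0 ≤ B n) (N : ℕ) :
    ∑ n ∈ Finset.range N, ∑ p ∈ Finset.HasAntidiagonal.antidiagonal n, A p.1 * B p.2 ≤
      (∑ n ∈ Finset.range N, A n) * ∑ n ∈ Finset.range N, B n := by
  set F := (Finset.range N ×ˢ Finset.range N).filter fun p : ℕ × ℕ => p.1 + p.2 < N with hF
  have h1 : ∑ n ∈ Finset.range N, ∑ p ∈ Finset.HasAntidiagonal.antidiagonal n, A p.1 * B p.2 =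
      ∑ p ∈ F, A p.1 * B p.2 := by
    rw [← Finset.sum_fiberwise_of_maps_to (s := F) (t := Finset.range N) (g := fun p => p.1 + p.2)
      (by intro p hp; simpa [hF] using (Finset.mem_filter.1 hp).2)]
    refine Finset.sum_congr rfl fun n hn => Finset.sum_congr ?_ fun _ _ => rfl
    ext p
    simp only [Finset.HasAntidiagonal.mem_antidiagonal, hF, Finset.mem_filter, Finset.mem_product,
      Finset.mem_range] at hn ⊢
    omega
  rw [h1, Finset.sum_mul_sum, ← Finset.sum_product']
  exact Finset.sum_le_sum_of_subset_of_nonneg (Finset.filter_subset _ _)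
    fun p _ _ => mul_nonneg (hA _) (hB _)

/-- Weighted `ℓ²` sequences form an algebra under convolution. -/
lemma weighted_conv_le (f g : ℕ → ℝ) (N : ℕ) :
    ∑ n ∈ Finset.range N, ((n : ℝ) + 1) ^ 2 * (∑ p ∈ Finset.HasAntidiagonal.antidiagonal n, f p.1 * g p.2) ^ 2 ≤
      8 * (∑ n ∈ Finset.range N, ((n : ℝ) + 1) ^ 2 * f n ^ 2) *
        ∑ n ∈ Finset.range N, ((n : ℝ) + 1) ^ 2 * g n ^ 2 := by
  have key : ∀ n : ℕ, ((n : ℝ) + 1) ^ 2 * (∑ p ∈ Finset.HasAntidiagonal.antidiagonal n, f p.1 * g p.2) ^ 2 ≤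
      8 * ∑ p ∈ Finset.HasAntidiagonal.antidiagonal n,
        (((p.1 : ℝ) + 1) ^ 2 * f p.1 ^ 2) * (((p.2 : ℝ) + 1) ^ 2 * g p.2 ^ 2) := by
    intro n
    have hcs := Finset.sum_mul_sq_le_sq_mul_sq (Finset.HasAntidiagonal.antidiagonal n)
      (fun p => (((p.1 : ℝ) + 1) * ((p.2 : ℝ) + 1))⁻¹)
      (fun p => (((p.1 : ℝ) + 1) * f p.1) * (((p.2 : ℝ) + 1) * g p.2))
    have e1 : ∀ p : ℕ × ℕ, (((p.1 : ℝ) + 1) * ((p.2 : ℝ) + 1))⁻¹ *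
        ((((p.1 : ℝ) + 1) * f p.1) * (((p.2 : ℝ) + 1) * g p.2)) = f p.1 * g p.2 := by
      intro p; field_simp
    simp only [e1] at hcs
    have h8 := sum_antidiagonal_inv_sq_le n
    have e2 : ∑ p ∈ Finset.HasAntidiagonal.antidiagonal n,
        ((n : ℝ) + 1) ^ 2 / (((p.1 : ℝ) + 1) * ((p.2 : ℝ) + 1)) ^ 2 = ((n : ℝ) + 1) ^ 2 *
        ∑ p ∈ Finset.HasAntidiagonal.antidiagonal n, ((((p.1 : ℝ) + 1) * ((p.2 : ℝ) + 1))⁻¹) ^ 2 := by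
      rw [Finset.mul_sum]
      refine Finset.sum_congr rfl fun p _ => ?_
      rw [inv_pow, div_eq_mul_inv]
    rw [e2] at h8
    calc _ ≤ ((n : ℝ) + 1) ^ 2 * _ := mul_le_mul_of_nonneg_left hcs (by positivity)
      _ ≤ 8 * ∑ p ∈ Finset.HasAntidiagonal.antidiagonal n,
          ((((p.1 : ℝ) + 1) * f p.1) * (((p.2 : ℝ) + 1) * g p.2)) ^ 2 := by
        rw [← mul_assoc]
        exact mul_le_mul_of_nonneg_right h8 (Finset.sum_nonneg fun _ _ => sq_nonneg _)
      _ = _ := by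
        congr 1
        exact Finset.sum_congr rfl fun p _ => by ring
  calc _ ≤ ∑ n ∈ Finset.range N, 8 * ∑ p ∈ Finset.HasAntidiagonal.antidiagonal n,
        (((p.1 : ℝ) + 1) ^ 2 * f p.1 ^ 2) * (((p.2 : ℝ) + 1) ^ 2 * g p.2 ^ 2) :=
        Finset.sum_le_sum fun n _ => key n
    _ ≤ _ := by
        rw [← Finset.mul_sum, mul_assoc]
        exact mul_le_mul_of_nonneg_left (sum_range_antidiagonal_le
          (A := fun n => ((n : ℝ) + 1) ^ 2 * f n ^ 2) (B := fun n => ((n : ℝ) + 1) ^ 2 * g n ^ 2)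
          (fun n => by positivity) (fun n => by positivity) N) (by norm_num)

/-- The Cauchy square of a sequence. -/
def cauchySq (a : ℕ → ℝ) (n : ℕ) : ℝ :=
  ∑ p ∈ Finset.HasAntidiagonal.antidiagonal n, a p.1 * a p.2

/-- The cubic reaction term in the evolution of the Taylor coefficients of the curvature. -/
def cubicTerm (a : ℕ → ℝ) (n : ℕ) : ℝ :=
  ∑ p ∈ Finset.HasAntidiagonal.antidiagonal n,
    ((n : ℝ) + 1) / ((p.1 : ℝ) + 1) * (cauchySq a p.1 * a p.2)

lemma sum_antidiagonal_succ_mul (u v : ℕ → ℝ) (n : ℕ) :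
    ((n : ℝ) + 1) * ∑ p ∈ Finset.HasAntidiagonal.antidiagonal (n + 1), u p.1 * v p.2 =
      ∑ p ∈ Finset.HasAntidiagonal.antidiagonal n,
        (((p.1 : ℝ) + 1) * u (p.1 + 1) * v p.2 + u p.1 * (((p.2 : ℝ) + 1) * v (p.2 + 1))) := by
  have h1 := Finset.Nat.sum_antidiagonal_succ (n := n) (f := fun p => (p.1 : ℝ) * (u p.1 * v p.2))
  have h2 := Finset.Nat.sum_antidiagonal_succ' (n := n) (f := fun p => (p.2 : ℝ) * (u p.1 * v p.2))
  have h3 : ((n : ℝ) + 1) * ∑ p ∈ Finset.HasAntidiagonal.antidiagonal (n + 1), u p.1 * v p.2 =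
      ∑ p ∈ Finset.HasAntidiagonal.antidiagonal (n + 1), (p.1 : ℝ) * (u p.1 * v p.2) +
      ∑ p ∈ Finset.HasAntidiagonal.antidiagonal (n + 1), (p.2 : ℝ) * (u p.1 * v p.2) := by
    rw [← Finset.sum_add_distrib, Finset.mul_sum]
    refine Finset.sum_congr rfl fun p hp => ?_
    have : (n : ℝ) + 1 = p.1 + p.2 := by
      exact_mod_cast (Finset.HasAntidiagonal.mem_antidiagonal.1 hp).symm
    rw [this]; ring
  rw [h3, h1, h2, Finset.sum_add_distrib]
  push_cast
  simp only [zero_mul, zero_add]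
  congr 1 <;> exact Finset.sum_congr rfl fun p _ => by ring

lemma cubicTerm_succ (a : ℕ → ℝ) (n : ℕ) :
    cubicTerm a (n + 1) = cauchySq a 0 * a (n + 1) +
      ∑ p ∈ Finset.HasAntidiagonal.antidiagonal n, (cauchySq a (p.1 + 1) * a p.2 +
        1 / ((p.1 : ℝ) + 1) * (cauchySq a p.1 * (((p.2 : ℝ) + 1) * a (p.2 + 1)))) := by
  have h1 := Finset.Nat.sum_antidiagonal_succ (n := n) (f := fun p => cauchySq a p.1 * a p.2)
  have h2 := Finset.Nat.sum_antidiagonal_succ' (n := n)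
    (f := fun p => (p.2 : ℝ) / ((p.1 : ℝ) + 1) * (cauchySq a p.1 * a p.2))
  have h3 : cubicTerm a (n + 1) =
      ∑ p ∈ Finset.HasAntidiagonal.antidiagonal (n + 1), cauchySq a p.1 * a p.2 +
      ∑ p ∈ Finset.HasAntidiagonal.antidiagonal (n + 1),
        (p.2 : ℝ) / ((p.1 : ℝ) + 1) * (cauchySq a p.1 * a p.2) := by
    rw [← Finset.sum_add_distrib, cubicTerm]
    refine Finset.sum_congr rfl fun p hp => ?_
    have : ((n + 1 : ℕ) : ℝ) = p.1 + p.2 := by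
      exact_mod_cast (Finset.HasAntidiagonal.mem_antidiagonal.1 hp).symm
    rw [this]; field_simp; ring
  rw [h3, h1, h2, Finset.sum_add_distrib]
  push_cast
  simp only [zero_div, zero_mul, zero_add, add_assoc]
  congr 2
  exact Finset.sum_congr rfl fun p _ => by ring

lemma pow_mul_conv (ρ : ℝ) (u v : ℕ → ℝ) (n : ℕ) :
    ρ ^ n * ∑ p ∈ Finset.HasAntidiagonal.antidiagonal n, u p.1 * v p.2 =
      ∑ p ∈ Finset.HasAntidiagonal.antidiagonal n, (ρ ^ p.1 * u p.1) * (ρ ^ p.2 * v p.2) := by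
  rw [Finset.mul_sum]
  refine Finset.sum_congr rfl fun p hp => ?_
  rw [← Finset.HasAntidiagonal.mem_antidiagonal.1 hp, pow_add]; ring

/-- The algebraic inequality behind the analyticity estimate. -/
lemma gevrey_inequality (a : ℕ → ℝ) {ρ : ℝ} (h0 : 0 ≤ ρ) (h1 : ρ ≤ 1 / 8) (N : ℕ) :
    ∑ n ∈ Finset.range N, (((n : ℝ) + 1) ^ 2 * (2 * (ρ ^ n * a n) *
        (n * ρ ^ (n - 1) * a n + ρ ^ n * cubicTerm a n) -
        2 * (ρ ^ n * (((n : ℝ) + 1) * a (n + 1))) ^ 2)) ≤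
      2 * (∑ n ∈ Finset.range N, ((n : ℝ) + 1) ^ 2 * (ρ ^ n * a n) ^ 2) +
        64 * (∑ n ∈ Finset.range N, ((n : ℝ) + 1) ^ 2 * (ρ ^ n * a n) ^ 2) ^ 3 := by
  set Ψ := ∑ n ∈ Finset.range N, ((n : ℝ) + 1) ^ 2 * (ρ ^ n * a n) ^ 2 with hΨ
  have hΨ0 : 0 ≤ Ψ := Finset.sum_nonneg fun n _ => by positivity
  set G := ∑ n ∈ Finset.range N, (n : ℝ) ^ 2 * ((n : ℝ) + 1) ^ 2 * (ρ ^ (n - 1) * a n) ^ 2 with hG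
  have hG0 : 0 ≤ G := Finset.sum_nonneg fun n _ => by positivity
  set δ : ℕ → ℝ := fun n => ∑ p ∈ Finset.HasAntidiagonal.antidiagonal n,
    (ρ ^ p.1 * (cauchySq a p.1 / ((p.1 : ℝ) + 1))) * (ρ ^ p.2 * a p.2) with hδ
  have eδ : ∀ n, ρ ^ n * cubicTerm a n = ((n : ℝ) + 1) * δ n := by
    intro n
    rw [hδ]
    simp only
    rw [← pow_mul_conv ρ (fun i => cauchySq a i / ((i : ℝ) + 1)), cubicTerm, ← mul_assoc,
      mul_comm ((n : ℝ) + 1), mul_assoc]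
    congr 1
    rw [Finset.mul_sum]
    exact Finset.sum_congr rfl fun p _ => by ring
  have epow : ∀ n : ℕ, (n : ℝ) * ρ ^ n = n * (ρ * ρ ^ (n - 1)) := by
    intro n
    rcases n with _ | n
    · simp
    · rw [Nat.add_sub_cancel, pow_succ']
  have hconv1 : ∑ n ∈ Finset.range N, ((n : ℝ) + 1) ^ 2 * δ n ^ 2 ≤
      8 * (∑ n ∈ Finset.range N, ((n : ℝ) + 1) ^ 2 *
        (ρ ^ n * (cauchySq a n / ((n : ℝ) + 1))) ^ 2) * Ψ :=
    weighted_conv_le (fun i => ρ ^ i * (cauchySq a i / ((i : ℝ) + 1))) (fun j => ρ ^ j * a j) N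
  have hconv2 : ∑ n ∈ Finset.range N, ((n : ℝ) + 1) ^ 2 *
        (ρ ^ n * (cauchySq a n / ((n : ℝ) + 1))) ^ 2 ≤ 8 * Ψ * Ψ := by
    refine le_trans (Finset.sum_le_sum fun n _ => ?_)
      (weighted_conv_le (fun i => ρ ^ i * a i) (fun j => ρ ^ j * a j) N)
    rw [← pow_mul_conv ρ a a, ← cauchySq]
    have : (ρ ^ n * (cauchySq a n / ((n : ℝ) + 1))) ^ 2 =
        (ρ ^ n * cauchySq a n) ^ 2 / ((n : ℝ) + 1) ^ 2 := by rw [← div_pow]; ring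
    rw [this]
    apply mul_le_mul_of_nonneg_left _ (by positivity)
    apply div_le_self (sq_nonneg _)
    nlinarith [Nat.cast_nonneg (α := ℝ) n]
  have hδΨ : ∑ n ∈ Finset.range N, ((n : ℝ) + 1) ^ 2 * δ n ^ 2 ≤ 64 * Ψ ^ 3 := by
    calc _ ≤ 8 * (8 * Ψ * Ψ) * Ψ := hconv1.trans (by gcongr)
      _ = _ := by ring
  have hgood : G / 2 ≤ ∑ n ∈ Finset.range N, ((n : ℝ) + 1) ^ 2 *
      (2 * (ρ ^ n * (((n : ℝ) + 1) * a (n + 1))) ^ 2) := by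
    have e : G ≤ ∑ n ∈ Finset.range (N + 1),
        (n : ℝ) ^ 2 * ((n : ℝ) + 1) ^ 2 * (ρ ^ (n - 1) * a n) ^ 2 :=
      Finset.sum_le_sum_of_subset_of_nonneg (Finset.range_mono (Nat.le_succ N))
        fun _ _ _ => by positivity
    rw [Finset.sum_range_succ'] at e
    simp only [Nat.cast_zero, ne_eq, OfNat.ofNat_ne_zero, not_false_eq_true, zero_pow, zero_mul,
      add_zero, Nat.add_sub_cancel] at e
    calc G / 2 ≤ (∑ n ∈ Finset.range N, (((n + 1 : ℕ) : ℝ)) ^ 2 * (((n + 1 : ℕ) : ℝ) + 1) ^ 2 *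
        (ρ ^ n * a (n + 1)) ^ 2) / 2 := by linarith
      _ ≤ _ := by
        rw [Finset.sum_div]
        refine Finset.sum_le_sum fun n _ => ?_
        push_cast
        have : ((n : ℝ) + 1 + 1) ^ 2 ≤ 4 * ((n : ℝ) + 1) ^ 2 := by
          nlinarith [Nat.cast_nonneg (α := ℝ) n]
        calc ((n : ℝ) + 1) ^ 2 * ((n : ℝ) + 1 + 1) ^ 2 * (ρ ^ n * a (n + 1)) ^ 2 / 2
            ≤ ((n : ℝ) + 1) ^ 2 * (4 * ((n : ℝ) + 1) ^ 2) * (ρ ^ n * a (n + 1)) ^ 2 / 2 := by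
              gcongr
          _ = _ := by ring
  have hterm : ∀ n ∈ Finset.range N, ((n : ℝ) + 1) ^ 2 * (2 * (ρ ^ n * a n) *
        (n * ρ ^ (n - 1) * a n + ρ ^ n * cubicTerm a n)) ≤
      (2 * ρ + 2 * ρ ^ 2) * ((n : ℝ) ^ 2 * ((n : ℝ) + 1) ^ 2 * (ρ ^ (n - 1) * a n) ^ 2) +
        2 * (((n : ℝ) + 1) ^ 2 * (ρ ^ n * a n) ^ 2) + ((n : ℝ) + 1) ^ 2 * δ n ^ 2 := by
    intro n _
    rw [eδ]
    have e1 : 2 * (ρ ^ n * a n) * (n * ρ ^ (n - 1) * a n) =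
        2 * ρ * (n * (ρ ^ (n - 1) * a n) ^ 2) := by
      linear_combination 2 * a n ^ 2 * ρ ^ (n - 1) * epow n
    have e2 : 2 * (ρ ^ n * a n) * (((n : ℝ) + 1) * δ n) ≤
        ((n : ℝ) + 1) ^ 2 * (ρ ^ n * a n) ^ 2 + δ n ^ 2 := by
      nlinarith [sq_nonneg (((n : ℝ) + 1) * (ρ ^ n * a n) - δ n)]
    have e3 : ((n : ℝ) + 1) ^ 2 * (ρ ^ n * a n) ^ 2 ≤
        2 * ρ ^ 2 * (n ^ 2 * (ρ ^ (n - 1) * a n) ^ 2) + 2 * (ρ ^ n * a n) ^ 2 := by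
      have : (n : ℝ) ^ 2 * (ρ ^ n * a n) ^ 2 = ρ ^ 2 * (n ^ 2 * (ρ ^ (n - 1) * a n) ^ 2) := by
        linear_combination a n ^ 2 * (n * ρ ^ n + n * (ρ * ρ ^ (n - 1))) * epow n
      nlinarith [sq_nonneg (((n : ℝ) - 1) * (ρ ^ n * a n))]
    have e4 : (n : ℝ) ≤ n ^ 2 := by exact_mod_cast Nat.le_self_pow two_ne_zero n
    have e5 : 2 * ρ * (n * (ρ ^ (n - 1) * a n) ^ 2) ≤
        2 * ρ * ((n : ℝ) ^ 2 * (ρ ^ (n - 1) * a n) ^ 2) := by gcongr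
    calc _ ≤ ((n : ℝ) + 1) ^ 2 * (2 * ρ * ((n : ℝ) ^ 2 * (ρ ^ (n - 1) * a n) ^ 2) +
          (2 * ρ ^ 2 * (n ^ 2 * (ρ ^ (n - 1) * a n) ^ 2) + 2 * (ρ ^ n * a n) ^ 2) + δ n ^ 2) := by
          apply mul_le_mul_of_nonneg_left _ (by positivity)
          rw [mul_add, e1]; linarith
      _ = _ := by ring
  have hsum := Finset.sum_le_sum hterm
  rw [Finset.sum_add_distrib, Finset.sum_add_distrib, ← Finset.mul_sum, ← Finset.mul_sum,
    ← hG, ← hΨ] at hsum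
  have hsplit : ∑ n ∈ Finset.range N, (((n : ℝ) + 1) ^ 2 * (2 * (ρ ^ n * a n) *
        (n * ρ ^ (n - 1) * a n + ρ ^ n * cubicTerm a n) -
        2 * (ρ ^ n * (((n : ℝ) + 1) * a (n + 1))) ^ 2)) =
      ∑ n ∈ Finset.range N, ((n : ℝ) + 1) ^ 2 * (2 * (ρ ^ n * a n) *
        (n * ρ ^ (n - 1) * a n + ρ ^ n * cubicTerm a n)) -
      ∑ n ∈ Finset.range N, ((n : ℝ) + 1) ^ 2 *
      (2 * (ρ ^ n * (((n : ℝ) + 1) * a (n + 1))) ^ 2) := by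
    rw [← Finset.sum_sub_distrib]
    exact Finset.sum_congr rfl fun n _ => by ring
  rw [hsplit]
  have : (2 * ρ + 2 * ρ ^ 2) * G ≤ G / 2 := by
    have : 2 * ρ + 2 * ρ ^ 2 ≤ 1 / 2 := by nlinarith
    nlinarith
  linarith

namespace NormalFlow
variable {S L : ℝ} (Γ : NormalFlow S L)

/-- Taylor coefficients of the curvature in arclength. -/
def coeff : ℕ → ℝ → ℝ → ℝ
  | 0 => Γ.κ
  | n + 1 => fun x t => ((n : ℝ) + 1)⁻¹ * Γ.D (coeff n) x t

lemma sm_coeff (n : ℕ) : StripSmooth S (Γ.coeff n) := by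
  induction n with
  | zero => exact Γ.sm_κ
  | succ n ih => exact (StripSmooth.const S _).mul (Γ.sm_D ih)

lemma D_coeff (n : ℕ) (x t : ℝ) :
    Γ.D (Γ.coeff n) x t = ((n : ℝ) + 1) * Γ.coeff (n + 1) x t := by
  rw [coeff]; field_simp

lemma coeff_periodic {t : ℝ} (ht : t ∈ Ioo 0 S) (n : ℕ) (x : ℝ) :
    Γ.coeff n (x + L) t = Γ.coeff n x t := by
  induction n generalizing x with
  | zero => exact Γ.κ_periodic ht x
  | succ n ih => simp only [coeff, Γ.D_periodic ih ht]

lemma D_add {f g : ℝ → ℝ → ℝ} (hf : StripSmooth S f) (hg : StripSmooth S g) {t : ℝ}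
    (ht : t ∈ Ioo 0 S) (x : ℝ) :
    Γ.D (fun x t => f x t + g x t) x t = Γ.D f x t + Γ.D g x t := by
  simp only [D, dx_add hf hg ht]; ring

lemma D_mul {f g : ℝ → ℝ → ℝ} (hf : StripSmooth S f) (hg : StripSmooth S g) {t : ℝ}
    (ht : t ∈ Ioo 0 S) (x : ℝ) :
    Γ.D (fun x t => f x t * g x t) x t = Γ.D f x t * g x t + f x t * Γ.D g x t := by
  simp only [D, dx_mul hf hg ht]; ring

lemma D_const_mul (c : ℝ) {f : ℝ → ℝ → ℝ} (hf : StripSmooth S f) {t : ℝ}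
    (ht : t ∈ Ioo 0 S) (x : ℝ) :
    Γ.D (fun x t => c * f x t) x t = c * Γ.D f x t := by
  simp only [D, dx_const_mul c hf ht]; ring

lemma D_sum {ι : Type*} {F : ι → ℝ → ℝ → ℝ} (s : Finset ι) (h : ∀ i ∈ s, StripSmooth S (F i))
    {t : ℝ} (ht : t ∈ Ioo 0 S) (x : ℝ) :
    Γ.D (fun x t => ∑ i ∈ s, F i x t) x t = ∑ i ∈ s, Γ.D (F i) x t := by
  simp only [D, dx_sum s h ht, Finset.mul_sum]

lemma D_congr {f g : ℝ → ℝ → ℝ} {t : ℝ} (h : ∀ x, f x t = g x t) (x : ℝ) :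
    Γ.D f x t = Γ.D g x t := by simp only [D, dx_congr h]

lemma sm_cauchySq (n : ℕ) : StripSmooth S fun x t => cauchySq (fun i => Γ.coeff i x t) n :=
  StripSmooth.sum (F := fun p : ℕ × ℕ => fun x t => Γ.coeff p.1 x t * Γ.coeff p.2 x t) _
    fun p _ => (Γ.sm_coeff p.1).mul (Γ.sm_coeff p.2)

lemma sm_cubicTerm (n : ℕ) : StripSmooth S fun x t => cubicTerm (fun i => Γ.coeff i x t) n :=
  StripSmooth.sum (F := fun p : ℕ × ℕ => fun x t => ((n : ℝ) + 1) / ((p.1 : ℝ) + 1) *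
      (cauchySq (fun i => Γ.coeff i x t) p.1 * Γ.coeff p.2 x t)) _
    fun p _ => (StripSmooth.const S _).mul ((Γ.sm_cauchySq p.1).mul (Γ.sm_coeff p.2))

lemma D_cauchySq (n : ℕ) {t : ℝ} (ht : t ∈ Ioo 0 S) (x : ℝ) :
    Γ.D (fun x t => cauchySq (fun i => Γ.coeff i x t) n) x t =
      ((n : ℝ) + 1) * cauchySq (fun i => Γ.coeff i x t) (n + 1) := by
  rw [cauchySq, sum_antidiagonal_succ_mul (fun i => Γ.coeff i x t) (fun i => Γ.coeff i x t)]
  unfold cauchySq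
  rw [Γ.D_sum (F := fun p : ℕ × ℕ => fun x t => Γ.coeff p.1 x t * Γ.coeff p.2 x t) _
    (fun p _ => (Γ.sm_coeff p.1).mul (Γ.sm_coeff p.2)) ht]
  refine Finset.sum_congr rfl fun p _ => ?_
  rw [Γ.D_mul (Γ.sm_coeff p.1) (Γ.sm_coeff p.2) ht, D_coeff, D_coeff]

lemma D_cubicTerm (n : ℕ) {t : ℝ} (ht : t ∈ Ioo 0 S) (x : ℝ) :
    Γ.D (fun x t => cubicTerm (fun i => Γ.coeff i x t) n) x t = ((n : ℝ) + 1) *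
      (cubicTerm (fun i => Γ.coeff i x t) (n + 1) - Γ.κ x t ^ 2 * Γ.coeff (n + 1) x t) := by
  have e0 : cauchySq (fun i => Γ.coeff i x t) 0 = Γ.κ x t ^ 2 := by
    simp [cauchySq, coeff, sq]
  rw [cubicTerm_succ, e0, add_sub_cancel_left, Finset.mul_sum]
  unfold cubicTerm
  rw [Γ.D_sum (F := fun p : ℕ × ℕ => fun x t => ((n : ℝ) + 1) / ((p.1 : ℝ) + 1) *
      (cauchySq (fun i => Γ.coeff i x t) p.1 * Γ.coeff p.2 x t)) _
    (fun p _ => (StripSmooth.const S _).mul ((Γ.sm_cauchySq p.1).mul (Γ.sm_coeff p.2))) ht]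
  refine Finset.sum_congr rfl fun p _ => ?_
  rw [Γ.D_const_mul _ ((Γ.sm_cauchySq p.1).mul (Γ.sm_coeff p.2)) ht,
    Γ.D_mul (Γ.sm_cauchySq p.1) (Γ.sm_coeff p.2) ht, D_coeff, Γ.D_cauchySq _ ht]
  field_simp

/-- The evolution equation of the Taylor coefficients. -/
lemma dt_coeff (n : ℕ) {t : ℝ} (ht : t ∈ Ioo 0 S) (x : ℝ) :
    dt (Γ.coeff n) x t =
      Γ.D (Γ.D (Γ.coeff n)) x t + cubicTerm (fun i => Γ.coeff i x t) n := by
  induction n generalizing x with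
  | zero =>
    rw [coeff, Γ.dt_κ ht]
    simp [cubicTerm, cauchySq, coeff]; ring
  | succ n ih =>
    have sa := Γ.sm_coeff n
    have h1 : dt (Γ.coeff (n + 1)) x t = _ := dt_const_mul ((n : ℝ) + 1)⁻¹ (Γ.sm_D sa) ht x
    have h2 : Γ.D (Γ.D (Γ.coeff (n + 1))) x t =
        ((n : ℝ) + 1)⁻¹ * Γ.D (Γ.D (Γ.D (Γ.coeff n))) x t := by
      rw [Γ.D_congr (f := Γ.D (Γ.coeff (n + 1)))
        (g := fun x t => ((n : ℝ) + 1)⁻¹ * Γ.D (Γ.D (Γ.coeff n)) x t)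
        (fun x => Γ.D_const_mul _ (Γ.sm_D sa) ht x),
        Γ.D_const_mul _ (Γ.sm_D (Γ.sm_D sa)) ht]
    have h3 := Γ.D_congr (g := fun x t => Γ.D (Γ.D (Γ.coeff n)) x t +
      cubicTerm (fun i => Γ.coeff i x t) n) ih x
    rw [h1, h2, Γ.dt_D sa ht, h3, Γ.D_add (Γ.sm_D (Γ.sm_D sa)) (Γ.sm_cubicTerm n) ht,
      Γ.D_cubicTerm n ht, D_coeff]
    have : ((n : ℝ) + 1) ≠ 0 := by positivity
    field_simp
    ring

/-- The weighted `ℓ²` energy of the Taylor coefficients. -/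
def energy (N : ℕ) (t₀ : ℝ) : ℝ → ℝ → ℝ := fun x t =>
  ∑ n ∈ Finset.range N, ((n : ℝ) + 1) ^ 2 * ((t - t₀) ^ n * Γ.coeff n x t) ^ 2

lemma sm_scaled (n : ℕ) (t₀ : ℝ) : StripSmooth S fun x t => (t - t₀) ^ n * Γ.coeff n x t :=
  (StripSmooth.time (ρ := fun t => (t - t₀) ^ n) (by fun_prop) S).mul (Γ.sm_coeff n)

lemma sm_energy (N : ℕ) (t₀ : ℝ) : StripSmooth S (Γ.energy N t₀) :=
  StripSmooth.sum (F := fun n : ℕ => fun x t =>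
    ((n : ℝ) + 1) ^ 2 * ((t - t₀) ^ n * Γ.coeff n x t) ^ 2) _
    fun n _ => (StripSmooth.const S _).mul ((Γ.sm_scaled n t₀).pow 2)

lemma D_sq {f : ℝ → ℝ → ℝ} (hf : StripSmooth S f) {t : ℝ} (ht : t ∈ Ioo 0 S) (x : ℝ) :
    Γ.D (fun x t => f x t ^ 2) x t = 2 * (f x t * Γ.D f x t) := by
  simp only [D, dx_pow hf 2 ht]; push_cast; ring

lemma D_D_sq {f : ℝ → ℝ → ℝ} (hf : StripSmooth S f) {t : ℝ} (ht : t ∈ Ioo 0 S) (x : ℝ) :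
    Γ.D (Γ.D (fun x t => f x t ^ 2)) x t =
      2 * (Γ.D f x t ^ 2 + f x t * Γ.D (Γ.D f) x t) := by
  rw [Γ.D_congr (f := Γ.D (fun x t => f x t ^ 2)) (g := fun x t => 2 * (f x t * Γ.D f x t))
    (fun x => Γ.D_sq hf ht x), Γ.D_const_mul _ (hf.mul (Γ.sm_D hf)) ht, Γ.D_mul hf (Γ.sm_D hf) ht]
  ring

lemma D_time_mul {f : ℝ → ℝ → ℝ} {ρ : ℝ → ℝ} (hf : StripSmooth S f) {t : ℝ} (ht : t ∈ Ioo 0 S)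
    (x : ℝ) : Γ.D (fun x t => ρ t * f x t) x t = ρ t * Γ.D f x t := by
  have : dx (fun x t => ρ t * f x t) x t = ρ t * dx f x t := dx_const_mul (ρ t) hf ht x
  simp only [D, this]; ring

lemma D_D_energy (N : ℕ) (t₀ : ℝ) {t : ℝ} (ht : t ∈ Ioo 0 S) (x : ℝ) :
    Γ.D (Γ.D (Γ.energy N t₀)) x t = ∑ n ∈ Finset.range N, ((n : ℝ) + 1) ^ 2 *
      (2 * (((t - t₀) ^ n * (((n : ℝ) + 1) * Γ.coeff (n + 1) x t)) ^ 2 +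
        ((t - t₀) ^ n * Γ.coeff n x t) * ((t - t₀) ^ n * Γ.D (Γ.D (Γ.coeff n)) x t))) := by
  have s2 := fun n => (Γ.sm_scaled n t₀).pow 2
  have e1 : ∀ x, Γ.D (Γ.energy N t₀) x t = ∑ n ∈ Finset.range N, ((n : ℝ) + 1) ^ 2 *
      Γ.D (fun x t => ((t - t₀) ^ n * Γ.coeff n x t) ^ 2) x t := by
    intro x
    have := Γ.D_sum (F := fun n : ℕ => fun x t =>
      ((n : ℝ) + 1) ^ 2 * ((t - t₀) ^ n * Γ.coeff n x t) ^ 2) (Finset.range N)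
      (fun n _ => (StripSmooth.const S _).mul (s2 n)) ht x
    rw [show Γ.D (Γ.energy N t₀) x t = _ from this]
    exact Finset.sum_congr rfl fun n _ => Γ.D_const_mul _ (s2 n) ht x
  rw [Γ.D_congr (g := fun x t => ∑ n ∈ Finset.range N, ((n : ℝ) + 1) ^ 2 *
      Γ.D (fun x t => ((t - t₀) ^ n * Γ.coeff n x t) ^ 2) x t) e1,
    Γ.D_sum (F := fun n : ℕ => fun x t => ((n : ℝ) + 1) ^ 2 *
      Γ.D (fun x t => ((t - t₀) ^ n * Γ.coeff n x t) ^ 2) x t) _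
      (fun n _ => (StripSmooth.const S _).mul (Γ.sm_D (s2 n))) ht]
  refine Finset.sum_congr rfl fun n _ => ?_
  rw [Γ.D_const_mul _ (Γ.sm_D (s2 n)) ht, Γ.D_D_sq (Γ.sm_scaled n t₀) ht,
    Γ.D_congr (f := Γ.D fun x t => (t - t₀) ^ n * Γ.coeff n x t)
      (g := fun x t => (t - t₀) ^ n * Γ.D (Γ.coeff n) x t)
      (fun x => Γ.D_time_mul (ρ := fun t => (t - t₀) ^ n) (Γ.sm_coeff n) ht x),
    Γ.D_time_mul (ρ := fun t => (t - t₀) ^ n) (Γ.sm_coeff n) ht x,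
    Γ.D_time_mul (ρ := fun t => (t - t₀) ^ n) (Γ.sm_D (Γ.sm_coeff n)) ht x, D_coeff]

lemma dt_energy (N : ℕ) (t₀ : ℝ) {t : ℝ} (ht : t ∈ Ioo 0 S) (x : ℝ) :
    dt (Γ.energy N t₀) x t = ∑ n ∈ Finset.range N, ((n : ℝ) + 1) ^ 2 *
      (2 * ((t - t₀) ^ n * Γ.coeff n x t) * (n * (t - t₀) ^ (n - 1) * Γ.coeff n x t +
        (t - t₀) ^ n * dt (Γ.coeff n) x t)) := by
  have : HasDerivAt (fun t => Γ.energy N t₀ x t) (∑ n ∈ Finset.range N, ((n : ℝ) + 1) ^ 2 *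
      (2 * ((t - t₀) ^ n * Γ.coeff n x t) * (n * (t - t₀) ^ (n - 1) * Γ.coeff n x t +
        (t - t₀) ^ n * dt (Γ.coeff n) x t))) t := by
    refine HasDerivAt.fun_sum fun n _ => ?_
    have h1 : HasDerivAt (fun t => (t - t₀) ^ n) (n * (t - t₀) ^ (n - 1)) t := by
      simpa using ((hasDerivAt_id t).sub_const t₀).fun_pow n
    have h2 := ((h1.mul ((Γ.sm_coeff n).hasDerivAt_t ht x)).fun_pow 2).const_mul (((n : ℝ) + 1) ^ 2)
    exact h2.congr_deriv (by push_cast; simp only [pow_one, Pi.mul_apply])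
  exact this.deriv

lemma dt_energy_le (N : ℕ) {t₀ t : ℝ} (ht : t ∈ Ioo 0 S) (h0 : t₀ ≤ t) (h1 : t - t₀ ≤ 1 / 8)
    (x : ℝ) : dt (Γ.energy N t₀) x t - Γ.D (Γ.D (Γ.energy N t₀)) x t ≤
      2 * Γ.energy N t₀ x t + 64 * Γ.energy N t₀ x t ^ 3 := by
  refine le_trans (le_of_eq ?_)
    (gevrey_inequality (fun n => Γ.coeff n x t) (ρ := t - t₀) (by linarith) h1 N)
  rw [Γ.dt_energy N t₀ ht, Γ.D_D_energy N t₀ ht, ← Finset.sum_sub_distrib]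
  refine Finset.sum_congr rfl fun n _ => ?_
  rw [Γ.dt_coeff n ht]
  ring

/-- Interior analyticity estimate for the curvature. -/
theorem exists_coeff_bound (hL : 0 < L) {t₁ : ℝ} (ht₁ : t₁ ∈ Ioo 0 S) :
    ∃ C R : ℝ, 0 < C ∧ 0 < R ∧ ∀ n x, |Γ.coeff n x t₁| ≤ C * R ^ n := by
  obtain ⟨C, hC, hCb⟩ := Γ.sm_κ.exists_bound (a := 0) (b := L) (c := t₁ / 2) (d := t₁)
    (by linarith [ht₁.1]) ht₁.2
  have hκ : ∀ x, ∀ t ∈ Icc (t₁ / 2) t₁, Γ.κ x t ^ 2 ≤ C ^ 2 := by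
    intro x t ht
    have htI : t ∈ Ioo 0 S := ⟨by linarith [ht.1, ht₁.1], ht.2.trans_lt ht₁.2⟩
    have hp : Function.Periodic (fun x => Γ.κ x t) L := Γ.κ_periodic htI
    obtain ⟨y, hy, hxy⟩ := hp.exists_mem_Ico₀ hL x
    rw [hxy]
    exact sq_le_sq' (abs_le.1 (hCb y (Ico_subset_Icc_self hy) t ht)).1
      (abs_le.1 (hCb y (Ico_subset_Icc_self hy) t ht)).2
  set B := C ^ 2 + 1
  have hB : 0 < B := by positivity
  set Λ := 4 * B + 512 * B ^ 3 + 1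
  have hΛ : 0 < Λ := by positivity
  set τ := min (1 / 8) (min (B / Λ) (t₁ / 2))
  have hτ : 0 < τ := lt_min (by norm_num) (lt_min (by positivity) (by linarith [ht₁.1]))
  have hτ1 : τ ≤ 1 / 8 := min_le_left _ _
  have hτ2 : Λ * τ ≤ B := by
    have : τ ≤ B / Λ := (min_le_right _ _).trans (min_le_left _ _)
    rw [le_div_iff₀ hΛ] at this; linarith
  have hτ3 : τ ≤ t₁ / 2 := (min_le_right _ _).trans (min_le_right _ _)
  have key : ∀ N x, Γ.energy N (t₁ - τ) x t₁ ≤ 2 * B := by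
    intro N x
    have hmain := lt_of_periodic_max_principle hL (Γ.sm_energy N (t₁ - τ)) (t₀ := t₁ - τ)
      (t₁ := t₁) (B := B) (Λ := Λ) (by linarith [ht₁.1]) ht₁.2
      (fun t ht x => by simp only [energy, Γ.coeff_periodic ht])
      (fun x => by
        have hk := hκ x (t₁ - τ) ⟨by linarith, by linarith⟩
        rcases N with _ | N
        · simp only [energy, Finset.range_zero, Finset.sum_empty]; exact hB
        · rw [energy, Finset.sum_range_succ', Finset.sum_eq_zero]
          · simp only [coeff]; simp; linarith
          · intro n _; simp)
      (fun x t ht htouch hdx hdxx => by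
        have htI : t ∈ Ioo 0 S := ⟨by linarith [ht.1, ht₁.1], ht.2.trans_lt ht₁.2⟩
        have h1 := Γ.dt_energy_le N htI ht.1.le (by linarith [ht.2]) x
        have h2 : Γ.D (Γ.D (Γ.energy N (t₁ - τ))) x t ≤ 0 := by
          have : dx (Γ.D (Γ.energy N (t₁ - τ))) x t = _ :=
            dx_mul Γ.sm_h (Γ.sm_energy N (t₁ - τ)).dx htI x
          rw [D, this, hdx, mul_zero, zero_add, ← mul_assoc]
          exact mul_nonpos_of_nonneg_of_nonpos (mul_self_nonneg _) hdxx
        have h3 : Γ.energy N (t₁ - τ) x t ≤ 2 * B := by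
          rw [htouch]
          have : Λ * (t - (t₁ - τ)) ≤ Λ * τ := by
            apply mul_le_mul_of_nonneg_left _ hΛ.le; linarith [ht.2]
          linarith
        have h4 : 0 ≤ Γ.energy N (t₁ - τ) x t := Finset.sum_nonneg fun n _ => by positivity
        have h5 : Γ.energy N (t₁ - τ) x t ^ 3 ≤ (2 * B) ^ 3 := by gcongr
        have h6 : (2 * B) ^ 3 = 8 * B ^ 3 := by ring
        change dt (Γ.energy N (t₁ - τ)) x t < 4 * B + 512 * B ^ 3 + 1
        linarith)
    have := hmain x t₁ ⟨by linarith, le_refl _⟩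
    have e : t₁ - (t₁ - τ) = τ := by ring
    rw [e] at this
    linarith
  refine ⟨2 * B + 1, τ⁻¹, by positivity, by positivity, fun n x => ?_⟩
  have h1 := key (n + 1) x
  rw [energy, Finset.sum_range_succ, sub_sub_cancel] at h1
  have h2 : 0 ≤ ∑ i ∈ Finset.range n, ((i : ℝ) + 1) ^ 2 * (τ ^ i * Γ.coeff i x t₁) ^ 2 :=
    Finset.sum_nonneg fun n _ => by positivity
  have h3 : (τ ^ n * Γ.coeff n x t₁) ^ 2 ≤ 2 * B := by
    have : (1 : ℝ) ≤ ((n : ℝ) + 1) ^ 2 := by nlinarith [Nat.cast_nonneg (α := ℝ) n]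
    nlinarith [sq_nonneg (τ ^ n * Γ.coeff n x t₁)]
  have h4 : |τ ^ n * Γ.coeff n x t₁| ≤ 2 * B + 1 := by
    apply abs_le_of_sq_le_sq _ (by positivity)
    nlinarith
  rw [abs_mul, abs_of_pos (by positivity : 0 < τ ^ n)] at h4
  rw [inv_pow, ← div_eq_mul_inv, le_div_iff₀ (by positivity)]
  linarith

end NormalFlow

lemma dx_reparam {S : ℝ} {f : ℝ → ℝ → ℝ} (hf : StripSmooth S f) {φ : ℝ → ℝ}
    (hφ : ContDiff ℝ ∞ φ) {t : ℝ} (ht : t ∈ Ioo 0 S) (x : ℝ) :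
    dx (fun x t => f (φ x) t) x t = deriv φ x * dx f (φ x) t := by
  have h1 : HasDerivAt φ (deriv φ x) x :=
    (hφ.contDiffAt.differentiableAt (by simp)).hasDerivAt
  rw [mul_comm]
  exact ((hf.hasDerivAt_x ht (φ x)).comp x h1).deriv

lemma contDiff_deriv_of_contDiff_infty {φ : ℝ → ℝ} (hφ : ContDiff ℝ ∞ φ) :
    ContDiff ℝ ∞ (deriv φ) := (contDiff_infty_iff_deriv.1 hφ).2

lemma dx_dx_reparam {S : ℝ} {f : ℝ → ℝ → ℝ} (hf : StripSmooth S f) {φ : ℝ → ℝ}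
    (hφ : ContDiff ℝ ∞ φ) {t : ℝ} (ht : t ∈ Ioo 0 S) (x : ℝ) :
    dx (dx (fun x t => f (φ x) t)) x t =
      deriv (deriv φ) x * dx f (φ x) t + deriv φ x ^ 2 * dx (dx f) (φ x) t := by
  rw [dx_congr (f := dx fun x t => f (φ x) t) (g := fun x t => deriv φ x * dx f (φ x) t)
    (fun x => dx_reparam hf hφ ht x)]
  have h1 : HasDerivAt (deriv φ) (deriv (deriv φ) x) x :=
    ((contDiff_deriv_of_contDiff_infty hφ).contDiffAt.differentiableAt (by simp)).hasDerivAt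
  have h2 : HasDerivAt φ (deriv φ x) x :=
    (hφ.contDiffAt.differentiableAt (by simp)).hasDerivAt
  have h3 := (h1.mul ((hf.dx.hasDerivAt_x ht (φ x)).comp x h2)).deriv
  refine Eq.trans h3 ?_
  simp only [Function.comp]; ring

lemma invSpeed_reparam {S : ℝ} {X Y : ℝ → ℝ → ℝ} (hX : StripSmooth S X) (hY : StripSmooth S Y)
    {φ : ℝ → ℝ} (hφ : ContDiff ℝ ∞ φ) {t : ℝ} (ht : t ∈ Ioo 0 S) (x : ℝ) :
    invSpeed (fun x t => X (φ x) t) (fun x t => Y (φ x) t) x t =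
      |deriv φ x|⁻¹ * invSpeed X Y (φ x) t := by
  rw [invSpeed, dx_reparam hX hφ ht, dx_reparam hY hφ ht, invSpeed, mul_pow, mul_pow, ← mul_add,
    mul_inv, Real.sqrt_mul (by positivity), Real.sqrt_inv, Real.sqrt_sq_eq_abs]

lemma signedCurv_reparam {S : ℝ} {X Y : ℝ → ℝ → ℝ} (hX : StripSmooth S X) (hY : StripSmooth S Y)
    {φ : ℝ → ℝ} (hφ : ContDiff ℝ ∞ φ) {t : ℝ} (ht : t ∈ Ioo 0 S) (x : ℝ) :
    signedCurv (fun x t => X (φ x) t) (fun x t => Y (φ x) t) x t =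
      deriv φ x ^ 3 * |deriv φ x|⁻¹ ^ 3 * signedCurv X Y (φ x) t := by
  rw [signedCurv, dx_reparam hX hφ ht, dx_reparam hY hφ ht, dx_dx_reparam hX hφ ht,
    dx_dx_reparam hY hφ ht, invSpeed_reparam hX hY hφ ht, signedCurv]
  ring

namespace NormalFlow
variable {S L : ℝ} (Γ : NormalFlow S L)

/-- Change of the space parameter. -/
def reparam {L' : ℝ} (φ : ℝ → ℝ) (hφ : ContDiff ℝ ∞ φ) (hd : ∀ x, deriv φ x ≠ 0) (e : ℤ)
    (hper : ∀ x, φ (x + L') = φ x + e * L)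
    (hinj : ∀ x y, ∀ n : ℤ, φ y = φ x + n * L → ∃ m : ℤ, y = x + m * L') : NormalFlow S L' where
  X := fun x t => Γ.X (φ x) t
  Y := fun x t => Γ.Y (φ x) t
  smX := Γ.smX.comp_reparam hφ
  smY := Γ.smY.comp_reparam hφ
  perX x t ht := by
    have : Function.Periodic (fun x => Γ.X x t) L := fun x => Γ.perX x t ht
    rw [hper]; exact this.int_mul e (φ x)
  perY x t ht := by
    have : Function.Periodic (fun x => Γ.Y x t) L := fun x => Γ.perY x t ht
    rw [hper]; exact this.int_mul e (φ x)
  imm x t ht := by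
    rw [dx_reparam Γ.smX hφ ht, dx_reparam Γ.smY hφ ht, mul_pow, mul_pow, ← mul_add]
    have := Γ.imm (φ x) t ht
    have := hd x
    positivity
  flowX x t ht := by
    rw [signedCurv_reparam Γ.smX Γ.smY hφ ht, invSpeed_reparam Γ.smX Γ.smY hφ ht,
      dx_reparam Γ.smY hφ ht]
    have h1 := Γ.flowX (φ x) t ht
    have h2 : deriv φ x ^ 4 * |deriv φ x|⁻¹ ^ 4 = 1 := by
      rw [inv_pow, ← abs_pow, abs_of_nonneg (by positivity)]
      exact mul_inv_cancel₀ (pow_ne_zero _ (hd x))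
    change dt Γ.X (φ x) t = _
    rw [h1]
    linear_combination (signedCurv Γ.X Γ.Y (φ x) t * invSpeed Γ.X Γ.Y (φ x) t *
      dx Γ.Y (φ x) t) * h2
  flowY x t ht := by
    rw [signedCurv_reparam Γ.smX Γ.smY hφ ht, invSpeed_reparam Γ.smX Γ.smY hφ ht,
      dx_reparam Γ.smX hφ ht]
    have h1 := Γ.flowY (φ x) t ht
    have h2 : deriv φ x ^ 4 * |deriv φ x|⁻¹ ^ 4 = 1 := by
      rw [inv_pow, ← abs_pow, abs_of_nonneg (by positivity)]
      exact mul_inv_cancel₀ (pow_ne_zero _ (hd x))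
    change dt Γ.Y (φ x) t = _
    rw [h1]
    linear_combination -(signedCurv Γ.X Γ.Y (φ x) t * invSpeed Γ.X Γ.Y (φ x) t *
      dx Γ.X (φ x) t) * h2
  inj t ht x y hX hY := by
    obtain ⟨n, hn⟩ := Γ.inj t ht _ _ hX hY
    exact hinj x y n hn

lemma exists_arclength (hL : 0 < L) {t₁ : ℝ} (ht₁ : t₁ ∈ Ioo 0 S) :
    ∃ L' : ℝ, 0 < L' ∧ ∃ Γ' : NormalFlow S L', (∀ x, Γ'.h x t₁ = 1) ∧ ∃ φ : ℝ ≃ₜ ℝ,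
      ∀ x t, Γ'.X x t = Γ.X (φ x) t ∧ Γ'.Y x t = Γ.Y (φ x) t := by
  set v : ℝ → ℝ := fun x => (Γ.h x t₁)⁻¹ with hv
  have hvpos : ∀ x, 0 < v x := fun x => inv_pos.2 (Γ.h_pos ht₁)
  have hvsm : ContDiff ℝ ∞ v := (Γ.sm_h.contDiff_x ht₁).inv fun x => (Γ.h_pos ht₁).ne'
  have hvper : Function.Periodic v L := fun x => by simp only [hv, Γ.h_periodic ht₁]
  set ℓ : ℝ → ℝ := fun x => ∫ y in (0 : ℝ)..x, v y with hℓ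
  have hder : ∀ x, HasDerivAt ℓ (v x) x := fun x =>
    (hvsm.continuous.integral_hasStrictDerivAt 0 x).hasDerivAt
  have hderiv : deriv ℓ = v := funext fun x => (hder x).deriv
  have hℓsm : ContDiff ℝ ∞ ℓ := contDiff_infty_iff_deriv.2
    ⟨fun x => (hder x).differentiableAt, by rw [hderiv]; exact hvsm⟩
  have hmono : StrictMono ℓ := strictMono_of_deriv_pos fun x => by rw [hderiv]; exact hvpos x
  have hℓper : ∀ x, ℓ (x + L) = ℓ x + ℓ L := by
    intro x
    have h1 := hvper.intervalIntegral_add_eq x 0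
    have h2 := intervalIntegral.integral_add_adjacent_intervals (a := 0) (b := x) (c := x + L)
      (hvsm.continuous.intervalIntegrable _ _) (hvsm.continuous.intervalIntegrable (μ := volume) _ _)
    simp only [hℓ, ← h2, h1, zero_add]
  have h00 : ℓ 0 = 0 := by simp [hℓ]
  have hLpos : 0 < ℓ L := by rw [← h00]; exact hmono hL
  have hshift : ∀ (n : ℤ) x, ℓ (x + n * L) = ℓ x + n * ℓ L := by
    have hp : Function.Periodic (fun x => ℓ x - x / L * ℓ L) L := fun x => by
      simp only [hℓper]; field_simp; ring
    intro n x
    have := hp.int_mul n x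
    have e : (x + n * L) / L = x / L + n := by field_simp
    rw [e] at this
    linarith
  have hsurj : Function.Surjective ℓ := by
    intro y
    obtain ⟨N, hN⟩ := exists_nat_gt (|y| / ℓ L)
    rw [div_lt_iff₀ hLpos] at hN
    have e1 := hshift N 0
    have e2 := hshift (-N) 0
    push_cast at e1 e2
    simp only [h00, zero_add] at e1 e2
    have := abs_lt.1 hN
    have hN0 : -(N : ℝ) * L ≤ N * L := by
      have : (0 : ℝ) ≤ N * L := by positivity
      linarith
    obtain ⟨x, -, hx⟩ := intermediate_value_Icc hN0 hℓsm.continuous.continuousOn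
      (show y ∈ Icc _ _ by rw [e1, e2]; constructor <;> linarith)
    exact ⟨x, hx⟩
  set Φ : ℝ ≃ₜ ℝ := (hmono.orderIsoOfSurjective ℓ hsurj).toHomeomorph
  have hΦ : ∀ x, Φ x = ℓ x := fun x => rfl
  have hsymm : ∀ x, ℓ (Φ.symm x) = x := fun x => Φ.apply_symm_apply x
  have hψ : ContDiff ℝ ∞ Φ.symm := Homeomorph.contDiff_symm_deriv (f := Φ)
    (fun x => (hvpos x).ne') hder hℓsm
  have hψd : ∀ x, deriv Φ.symm x = Γ.h (Φ.symm x) t₁ := by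
    intro x
    have h1 : HasDerivAt Φ.symm (v (Φ.symm x))⁻¹ x :=
      HasDerivAt.of_local_left_inverse Φ.symm.continuous.continuousAt (hder _) (hvpos _).ne'
        (Eventually.of_forall hsymm)
    rw [h1.deriv, hv]; simp
  refine ⟨ℓ L, hLpos, Γ.reparam Φ.symm hψ (fun x => ?_) 1 (fun x => ?_) ?_, fun x => ?_,
    Φ.symm, fun x t => ⟨rfl, rfl⟩⟩
  · rw [hψd]; exact (Γ.h_pos ht₁).ne'
  · apply hmono.injective
    have := hshift 1 (Φ.symm x)
    push_cast at this ⊢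
    rw [this, hsymm, hsymm, one_mul]
  · intro x y n h
    refine ⟨n, ?_⟩
    have := congrArg ℓ h
    rwa [hshift, hsymm, hsymm] at this
  · change invSpeed (fun x t => Γ.X (Φ.symm x) t) (fun x t => Γ.Y (Φ.symm x) t) x t₁ = 1
    rw [invSpeed_reparam Γ.smX Γ.smY hψ ht₁, hψd, abs_of_pos (Γ.h_pos ht₁)]
    exact inv_mul_cancel₀ (Γ.h_pos ht₁).ne'

/-- Shift and possibly reverse the space parameter. -/
def affine (σ b : ℝ) (hσ : σ = 1 ∨ σ = -1) : NormalFlow S L :=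
  Γ.reparam (fun x => σ * x + b) (by fun_prop)
    (fun x => by
      have : HasDerivAt (fun x => σ * x + b) σ x := by
        simpa using ((hasDerivAt_id x).const_mul σ).add_const b
      rw [this.deriv]; rcases hσ with h | h <;> simp [h])
    (if σ = 1 then 1 else -1)
    (fun x => by rcases hσ with h | h <;> norm_num [h] <;> ring)
    (fun x y n h => by
      rcases hσ with h' | h' <;> subst h'
      · exact ⟨n, by linarith⟩
      · exact ⟨-n, by push_cast; linarith⟩)

lemma affine_X (σ b : ℝ) (hσ : σ = 1 ∨ σ = -1) (x t : ℝ) :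
    (Γ.affine σ b hσ).X x t = Γ.X (σ * x + b) t := rfl

lemma affine_Y (σ b : ℝ) (hσ : σ = 1 ∨ σ = -1) (x t : ℝ) :
    (Γ.affine σ b hσ).Y x t = Γ.Y (σ * x + b) t := rfl

lemma affine_h (σ b : ℝ) (hσ : σ = 1 ∨ σ = -1) {t : ℝ} (ht : t ∈ Ioo 0 S) (x : ℝ) :
    (Γ.affine σ b hσ).h x t = Γ.h (σ * x + b) t := by
  have h1 : HasDerivAt (fun x => σ * x + b) σ x := by
    simpa using ((hasDerivAt_id x).const_mul σ).add_const b
  have : (Γ.affine σ b hσ).h x t = _ :=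
    invSpeed_reparam Γ.smX Γ.smY (φ := fun x => σ * x + b) (by fun_prop) ht x
  rw [this, h1.deriv]
  rcases hσ with h | h <;> simp [h] <;> rfl

end NormalFlow

namespace CurvatureFlowSolution
variable {γ₀ : Set E2} {S : ℝ} (sol : CurvatureFlowSolution γ₀ S)

/-- Coordinate functions of a solution. -/
def coord (i : Fin 2) : ℝ → ℝ → ℝ := fun x t => sol.Γ x t i

lemma sm_coord (i : Fin 2) : StripSmooth S (sol.coord i) :=
  ((EuclideanSpace.proj i : E2 →L[ℝ] ℝ).contDiff).comp_contDiffOn sol.smooth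

lemma differentiableAt_x {t : ℝ} (ht : t ∈ Ioo 0 S) (x : ℝ) :
    DifferentiableAt ℝ (fun y => sol.Γ y t) x := by
  have h1 : DifferentiableAt ℝ (fun p : ℝ × ℝ => sol.Γ p.1 p.2) (x, t) :=
    ((sol.smooth.contDiffAt ((isOpen_strip S).mem_nhds ⟨mem_univ _, ht⟩)).differentiableAt
      (by simp))
  have h2 : DifferentiableAt ℝ (fun y : ℝ => (y, t)) x := by fun_prop
  exact DifferentiableAt.comp (g := fun p : ℝ × ℝ => sol.Γ p.1 p.2) x h1 h2

lemma differentiableAt_t {t : ℝ} (ht : t ∈ Ioo 0 S) (x : ℝ) :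
    DifferentiableAt ℝ (fun s => sol.Γ x s) t := by
  have h1 : DifferentiableAt ℝ (fun p : ℝ × ℝ => sol.Γ p.1 p.2) (x, t) :=
    ((sol.smooth.contDiffAt ((isOpen_strip S).mem_nhds ⟨mem_univ _, ht⟩)).differentiableAt
      (by simp))
  have h2 : DifferentiableAt ℝ (fun s : ℝ => (x, s)) t := by fun_prop
  exact DifferentiableAt.comp (g := fun p : ℝ × ℝ => sol.Γ p.1 p.2) t h1 h2

end CurvatureFlowSolution

lemma hasDerivAt_coord {f : ℝ → E2} {f' : E2} {x : ℝ} (h : HasDerivAt f f' x) (i : Fin 2) :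
    HasDerivAt (fun y => f y i) (f' i) x :=
  (EuclideanSpace.proj i : E2 →L[ℝ] ℝ).hasFDerivAt.comp_hasDerivAt x h

lemma hasDerivAt_of_coord {f : ℝ → E2} {f' : E2} {x : ℝ}
    (h : ∀ i, HasDerivAt (fun y => f y i) (f' i) x) : HasDerivAt f f' x := by
  rw [hasDerivAt_iff_hasFDerivAt, ← hasFDerivWithinAt_univ, hasFDerivWithinAt_euclidean]
  intro i
  rw [hasFDerivWithinAt_univ]
  refine (h i).hasFDerivAt.congr_fderiv ?_
  ext; simp

namespace CurvatureFlowSolution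
variable {γ₀ : Set E2} {S : ℝ} (sol : CurvatureFlowSolution γ₀ S)

lemma dx_coord (i : Fin 2) {t : ℝ} (ht : t ∈ Ioo 0 S) (x : ℝ) :
    dx (sol.coord i) x t = deriv (fun y => sol.Γ y t) x i :=
  (hasDerivAt_coord (sol.differentiableAt_x ht x).hasDerivAt i).deriv

lemma dt_coord (i : Fin 2) {t : ℝ} (ht : t ∈ Ioo 0 S) (x : ℝ) :
    dt (sol.coord i) x t = deriv (fun s => sol.Γ x s) t i :=
  (hasDerivAt_coord (sol.differentiableAt_t ht x).hasDerivAt i).deriv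

lemma coord_imm (x t : ℝ) (ht : t ∈ Ioo 0 S) :
    0 < dx (sol.coord 0) x t ^ 2 + dx (sol.coord 1) x t ^ 2 := by
  have h1 : 0 < ‖deriv (fun y => sol.Γ y t) x‖ ^ 2 := by
    have := sol.deriv_ne t ht x
    positivity
  rwa [EuclideanSpace.norm_sq_eq, Fin.sum_univ_two, Real.norm_eq_abs, Real.norm_eq_abs, sq_abs,
    sq_abs, ← sol.dx_coord 0 ht, ← sol.dx_coord 1 ht] at h1

lemma inv_norm_deriv {t : ℝ} (ht : t ∈ Ioo 0 S) (x : ℝ) :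
    ‖deriv (fun y => sol.Γ y t) x‖⁻¹ = invSpeed (sol.coord 0) (sol.coord 1) x t := by
  rw [invSpeed, Real.sqrt_inv, EuclideanSpace.norm_eq, Fin.sum_univ_two, Real.norm_eq_abs,
    Real.norm_eq_abs, sq_abs, sq_abs, ← sol.dx_coord 0 ht, ← sol.dx_coord 1 ht]

lemma curvatureVector_eq {t : ℝ} (ht : t ∈ Ioo 0 S) (x : ℝ) :
    curvatureVector (fun y => sol.Γ y t) x 0 =
      -(signedCurv (sol.coord 0) (sol.coord 1) x t * invSpeed (sol.coord 0) (sol.coord 1) x t *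
        dx (sol.coord 1) x t) ∧
    curvatureVector (fun y => sol.Γ y t) x 1 =
      signedCurv (sol.coord 0) (sol.coord 1) x t * invSpeed (sol.coord 0) (sol.coord 1) x t *
        dx (sol.coord 0) x t := by
  set X := sol.coord 0
  set Y := sol.coord 1
  have hX := sol.sm_coord 0
  have hY := sol.sm_coord 1
  have sh : StripSmooth S (invSpeed X Y) := hX.invSpeed hY sol.coord_imm
  have h1 : (fun y => ‖deriv (fun y => sol.Γ y t) y‖⁻¹ • deriv (fun y => sol.Γ y t) y) =
      fun y => !₂[invSpeed X Y y t * dx X y t, invSpeed X Y y t * dx Y y t] := by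
    ext y i
    rw [sol.inv_norm_deriv ht]
    fin_cases i
    · simp [X, Y, sol.dx_coord 0 ht]
    · simp [X, Y, sol.dx_coord 1 ht]
  have h2 : HasDerivAt (fun y => !₂[invSpeed X Y y t * dx X y t, invSpeed X Y y t * dx Y y t])
      !₂[- (signedCurv X Y x t * dx Y x t), signedCurv X Y x t * dx X x t] x := by
    apply hasDerivAt_of_coord
    intro i
    fin_cases i
    · simp only [Fin.zero_eta, Fin.isValue, Matrix.cons_val_zero]
      rw [← dx_invSpeed_mul_dx_fst hX hY sol.coord_imm ht]
      exact (sh.mul hX.dx).hasDerivAt_x ht x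
    · simp only [Fin.mk_one, Fin.isValue, Matrix.cons_val_one]
      rw [← dx_invSpeed_mul_dx_snd hX hY sol.coord_imm ht]
      exact (sh.mul hY.dx).hasDerivAt_x ht x
  rw [curvatureVector, h1, h2.deriv, sol.inv_norm_deriv ht]
  constructor <;> simp <;> ring

/-- The coordinate form of a solution. -/
def toNormalFlow : NormalFlow S (2 * π) where
  X := sol.coord 0
  Y := sol.coord 1
  smX := sol.sm_coord 0
  smY := sol.sm_coord 1
  perX x t _ := congrArg (fun v : E2 => v 0) (sol.periodic t x)
  perY x t _ := congrArg (fun v : E2 => v 1) (sol.periodic t x)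
  imm := sol.coord_imm
  flowX x t ht := by rw [sol.dt_coord 0 ht, sol.flow t ht, (sol.curvatureVector_eq ht x).1]
  flowY x t ht := by rw [sol.dt_coord 1 ht, sol.flow t ht, (sol.curvatureVector_eq ht x).2]
  inj t ht x y h1 h2 := by
    have hxy : sol.Γ x t = sol.Γ y t := by
      ext i
      fin_cases i
      · exact h1
      · exact h2
    have hp := sol.periodic t
    obtain ⟨m, hm, -⟩ := existsUnique_add_zsmul_mem_Ico Real.two_pi_pos x 0
    obtain ⟨n, hn, -⟩ := existsUnique_add_zsmul_mem_Ico Real.two_pi_pos y 0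
    rw [zero_add] at hm hn
    have := sol.inj t ht _ hm _ hn (by
      rw [show sol.Γ (x + m • (2 * π)) t = sol.Γ x t from hp.zsmul m x,
        show sol.Γ (y + n • (2 * π)) t = sol.Γ y t from hp.zsmul n y, hxy])
    refine ⟨m - n, ?_⟩
    simp only [zsmul_eq_mul] at this
    push_cast
    linarith

end CurvatureFlowSolution

section identity
variable {a : ℕ → ℝ → ℝ} {C R : ℝ}

lemma abs_le_of_taylor_bound
    (hd : ∀ n x, HasDerivAt (a n) (((n : ℝ) + 1) * a (n + 1) x) x)
    (hb : ∀ n x, |a n x| ≤ C * R ^ n) {s : ℝ} (hs : ∀ n, a n s = 0) (m n : ℕ) {x : ℝ}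
    (hx : s ≤ x) : |a n x| ≤ C * (n + m).choose m * R ^ (n + m) * (x - s) ^ m := by
  induction m generalizing n x with
  | zero => simpa using hb n x
  | succ m ih =>
    set K : ℝ := C * (n + 1 + m).choose m * R ^ (n + 1 + m) * ((n : ℝ) + 1)
    have hB : ∀ y, HasDerivAt (fun y => K / (m + 1) * (y - s) ^ (m + 1)) (K * (y - s) ^ m) y := by
      intro y
      have := (((hasDerivAt_id y).sub_const s).fun_pow (m + 1)).const_mul (K / (m + 1))
      refine this.congr_deriv ?_
      simp only [id, Nat.add_sub_cancel, Nat.cast_add, Nat.cast_one]; field_simp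
    have h1 := image_norm_le_of_norm_deriv_right_le_deriv_boundary
      (f := a n) (f' := fun y => ((n : ℝ) + 1) * a (n + 1) y) (a := s) (b := x)
      (fun y _ => (hd n y).continuousAt.continuousWithinAt)
      (fun y _ => (hd n y).hasDerivWithinAt)
      (B := fun y => K / (m + 1) * (y - s) ^ (m + 1)) (by simp [hs n]) hB
      (fun y hy => by
        rw [Real.norm_eq_abs, abs_mul, abs_of_pos (by positivity : (0 : ℝ) < (n : ℝ) + 1)]
        have := ih (n + 1) hy.1
        calc _ ≤ ((n : ℝ) + 1) * _ := mul_le_mul_of_nonneg_left this (by positivity)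
          _ = _ := by ring)
      ⟨hx, le_refl x⟩
    refine (show |a n x| ≤ _ from h1).trans (le_of_eq ?_)
    have hch : ((n : ℝ) + 1) * (n + 1 + m).choose m = (m + 1) * (n + (m + 1)).choose (m + 1) := by
      have := Nat.choose_succ_right_eq (n + 1 + m) m
      have e : n + 1 + m - m = n + 1 := by omega
      rw [e] at this
      have e' : n + (m + 1) = n + 1 + m := by ring
      rw [e', mul_comm, mul_comm ((m : ℝ) + 1)]
      exact_mod_cast this.symm
    have e' : n + 1 + m = n + (m + 1) := by ring
    have hK : K / (m + 1) = C * (n + (m + 1)).choose (m + 1) * R ^ (n + (m + 1)) := by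
      rw [div_eq_iff (by positivity)]
      simp only [K]
      rw [e'] at hch ⊢
      linear_combination (C * R ^ (n + (m + 1))) * hch
    rw [hK]

lemma eq_zero_step_of_taylor_bound (hR : 0 < R) (hC : 0 < C)
    (hd : ∀ n x, HasDerivAt (a n) (((n : ℝ) + 1) * a (n + 1) x) x)
    (hb : ∀ n x, |a n x| ≤ C * R ^ n) {s : ℝ} (hs : ∀ n, a n s = 0) {x : ℝ}
    (hx : s ≤ x) (hx' : x ≤ s + (4 * R)⁻¹) (n : ℕ) : a n x = 0 := by
  have h1 : ∀ m : ℕ, |a n x| ≤ C * (2 * R) ^ n * (1 / 2) ^ m := by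
    intro m
    have hxs : 0 ≤ x - s := by linarith
    have h2 : R * (x - s) ≤ 1 / 4 := by
      have : x - s ≤ (4 * R)⁻¹ := by linarith
      calc R * (x - s) ≤ R * (4 * R)⁻¹ := by gcongr
        _ = 1 / 4 := by field_simp
    have h3 : ((n + m).choose m : ℝ) ≤ 2 ^ (n + m) := by
      exact_mod_cast Nat.choose_le_two_pow (n + m) m
    calc _ ≤ _ := abs_le_of_taylor_bound hd hb hs m n hx
      _ ≤ C * 2 ^ (n + m) * R ^ (n + m) * (x - s) ^ m := by gcongr
      _ = C * (2 * R) ^ n * (2 * (R * (x - s))) ^ m := by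
        simp only [mul_pow, pow_add]; ring
      _ ≤ _ := by gcongr; linarith
  have h2 : Tendsto (fun m : ℕ => C * (2 * R) ^ n * (1 / 2 : ℝ) ^ m) atTop (𝓝 0) := by
    simpa using (tendsto_pow_atTop_nhds_zero_of_lt_one (by norm_num : (0 : ℝ) ≤ 1 / 2)
      (by norm_num)).const_mul (C * (2 * R) ^ n)
  have := ge_of_tendsto' h2 h1
  exact abs_nonpos_iff.1 this

lemma eq_zero_right_of_taylor_bound (hR : 0 < R) (hC : 0 < C)
    (hd : ∀ n x, HasDerivAt (a n) (((n : ℝ) + 1) * a (n + 1) x) x)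
    (hb : ∀ n x, |a n x| ≤ C * R ^ n) {s : ℝ} (hs : ∀ n, a n s = 0) {x : ℝ}
    (hx : s ≤ x) (n : ℕ) : a n x = 0 := by
  have h1 : ∀ k : ℕ, ∀ n, ∀ y, s ≤ y → y ≤ s + k * (4 * R)⁻¹ → a n y = 0 := by
    intro k
    induction k with
    | zero => intro n y h1 h2; rw [le_antisymm (by simpa using h2) h1]; exact hs n
    | succ k ih =>
      intro n y h1 h2
      rcases le_total y (s + k * (4 * R)⁻¹) with h | h
      · exact ih n y h1 h
      · refine eq_zero_step_of_taylor_bound hR hC hd hb (fun n => ih n _ ?_ (le_refl _)) h ?_ n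
        · have : 0 < (4 * R)⁻¹ := by positivity
          nlinarith [Nat.cast_nonneg (α := ℝ) k]
        · push_cast at h2; linarith
  obtain ⟨k, hk⟩ := exists_nat_gt ((x - s) / (4 * R)⁻¹)
  rw [div_lt_iff₀ (by positivity)] at hk
  exact h1 k n x hx (by linarith)

/-- Functions with factorially bounded derivatives that vanish near a point vanish everywhere. -/
lemma eq_zero_of_taylor_bound (hR : 0 < R) (hC : 0 < C)
    (hd : ∀ n x, HasDerivAt (a n) (((n : ℝ) + 1) * a (n + 1) x) x)
    (hb : ∀ n x, |a n x| ≤ C * R ^ n) {s : ℝ} (hs : ∀ᶠ x in 𝓝 s, a 0 x = 0) (x : ℝ) :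
    a 0 x = 0 := by
  have h0 : ∀ n, ∀ᶠ x in 𝓝 s, a n x = 0 := by
    intro n
    induction n with
    | zero => exact hs
    | succ n ih =>
      filter_upwards [ih.eventually_nhds] with y hy
      have h1 : HasDerivAt (a n) 0 y := (hasDerivAt_const y (0 : ℝ)).congr_of_eventuallyEq hy
      have h2 := (hd n y).unique h1
      have : ((n : ℝ) + 1) ≠ 0 := by positivity
      exact (mul_eq_zero.1 h2).resolve_left this
  have hs' : ∀ n, a n s = 0 := fun n => (h0 n).self_of_nhds
  rcases le_total s x with h | h
  · exact eq_zero_right_of_taylor_bound hR hC hd hb hs' h 0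
  · have := eq_zero_right_of_taylor_bound (a := fun n x => (-1) ^ n * a n (-x)) (s := -s) hR hC
      (fun n x => by
        have h1 := ((hd n (-x)).scomp x (hasDerivAt_neg x)).const_mul ((-1 : ℝ) ^ n)
        refine h1.congr_deriv ?_
        simp only [smul_eq_mul, pow_succ]; ring)
      (fun n x => by
        have := hb n (-x)
        rwa [abs_mul, abs_pow, abs_neg, abs_one, one_pow, one_mul])
      (fun n => by simp [hs' n]) (neg_le_neg h) 0
    simpa using this

end identity

namespace NormalFlow
variable {S L₁ L₂ : ℝ}

lemma hasDerivAt_coeff (Γ : NormalFlow S L₁) {t : ℝ} (ht : t ∈ Ioo 0 S)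
    (hh : ∀ x, Γ.h x t = 1) (n : ℕ) (x : ℝ) :
    HasDerivAt (fun x => Γ.coeff n x t) (((n : ℝ) + 1) * Γ.coeff (n + 1) x t) x := by
  rw [← Γ.D_coeff, D, hh, one_mul]
  exact (Γ.sm_coeff n).hasDerivAt_x ht x

/-- Two flows parametrized by arclength at time `t` that agree at time `t` near one point agree
everywhere at time `t`. -/
lemma eq_of_eventuallyEq (Γ₁ : NormalFlow S L₁) (Γ₂ : NormalFlow S L₂) (hL₁ : 0 < L₁)
    (hL₂ : 0 < L₂) {t : ℝ} (ht : t ∈ Ioo 0 S) (hh₁ : ∀ x, Γ₁.h x t = 1)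
    (hh₂ : ∀ x, Γ₂.h x t = 1) {x₀ : ℝ}
    (he : ∀ᶠ x in 𝓝 x₀, Γ₁.X x t = Γ₂.X x t ∧ Γ₁.Y x t = Γ₂.Y x t) :
    L₁ = L₂ ∧ ∀ x, Γ₁.X x t = Γ₂.X x t ∧ Γ₁.Y x t = Γ₂.Y x t := by
  have hX : (fun x => Γ₁.X x t) =ᶠ[𝓝 x₀] fun x => Γ₂.X x t := he.mono fun x h => h.1
  have hY : (fun x => Γ₁.Y x t) =ᶠ[𝓝 x₀] fun x => Γ₂.Y x t := he.mono fun x h => h.2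
  have hX' : (fun x => dx Γ₁.X x t) =ᶠ[𝓝 x₀] fun x => dx Γ₂.X x t := hX.deriv
  have hY' : (fun x => dx Γ₁.Y x t) =ᶠ[𝓝 x₀] fun x => dx Γ₂.Y x t := hY.deriv
  have hX'' : (fun x => dx (dx Γ₁.X) x t) =ᶠ[𝓝 x₀] fun x => dx (dx Γ₂.X) x t := hX'.deriv
  have hY'' : (fun x => dx (dx Γ₁.Y) x t) =ᶠ[𝓝 x₀] fun x => dx (dx Γ₂.Y) x t := hY'.deriv
  have hκ : ∀ᶠ x in 𝓝 x₀, Γ₁.κ x t - Γ₂.κ x t = 0 := by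
    filter_upwards [hX', hY', hX'', hY''] with x h1 h2 h3 h4
    simp only [κ, signedCurv, invSpeed, h1, h2, h3, h4, sub_self]
  obtain ⟨C₁, R₁, hC₁, hR₁, hb₁⟩ := Γ₁.exists_coeff_bound hL₁ ht
  obtain ⟨C₂, R₂, hC₂, hR₂, hb₂⟩ := Γ₂.exists_coeff_bound hL₂ ht
  have hκall : ∀ x, Γ₁.κ x t = Γ₂.κ x t := by
    intro x
    refine sub_eq_zero.1 (eq_zero_of_taylor_bound
      (a := fun n x => Γ₁.coeff n x t - Γ₂.coeff n x t) (R := max R₁ R₂) (C := C₁ + C₂)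
      (lt_max_of_lt_left hR₁) (by positivity) (fun n x => ?_) (fun n x => ?_) hκ x)
    · exact ((Γ₁.hasDerivAt_coeff ht hh₁ n x).sub (Γ₂.hasDerivAt_coeff ht hh₂ n x)).congr_deriv
        (by ring)
    · calc _ ≤ |Γ₁.coeff n x t| + |Γ₂.coeff n x t| := abs_sub _ _
        _ ≤ C₁ * R₁ ^ n + C₂ * R₂ ^ n := add_le_add (hb₁ n x) (hb₂ n x)
        _ ≤ C₁ * (max R₁ R₂) ^ n + C₂ * (max R₁ R₂) ^ n := by
          gcongr
          · exact le_max_left _ _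
          · exact le_max_right _ _
        _ = _ := by ring
  have hX0 : ∀ x, dx Γ₁.X x t = Γ₁.c x t ∧ dx Γ₂.X x t = Γ₂.c x t ∧
      dx Γ₁.Y x t = Γ₁.s x t ∧ dx Γ₂.Y x t = Γ₂.s x t := fun x => by
    simp [c, s, hh₁, hh₂]
  have hcs : ∀ x, (Γ₁.c x t - Γ₂.c x t) ^ 2 + (Γ₁.s x t - Γ₂.s x t) ^ 2 = 0 := by
    have hd : ∀ x, HasDerivAt (fun x => (Γ₁.c x t - Γ₂.c x t) ^ 2 + (Γ₁.s x t - Γ₂.s x t) ^ 2)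
        0 x := by
      intro x
      have h1 := (((Γ₁.sm_c.hasDerivAt_x ht x).fun_sub (Γ₂.sm_c.hasDerivAt_x ht x)).fun_pow 2).fun_add
        (((Γ₁.sm_s.hasDerivAt_x ht x).fun_sub (Γ₂.sm_s.hasDerivAt_x ht x)).fun_pow 2)
      refine h1.congr_deriv ?_
      obtain ⟨e1, e2, e3, e4⟩ := hX0 x
      rw [Γ₁.dx_c ht, Γ₂.dx_c ht, Γ₁.dx_s ht, Γ₂.dx_s ht, hκall, e1, e2, e3, e4]
      push_cast; ring
    intro x
    have h1 := is_const_of_deriv_eq_zero (fun x => (hd x).differentiableAt)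
      (fun x => (hd x).deriv) x x₀
    obtain ⟨e1, e2, e3, e4⟩ := hX0 x₀
    have h2 : dx Γ₁.X x₀ t = dx Γ₂.X x₀ t := hX'.self_of_nhds
    have h3 : dx Γ₁.Y x₀ t = dx Γ₂.Y x₀ t := hY'.self_of_nhds
    rw [h1, ← e1, ← e2, ← e3, ← e4, h2, h3]
    ring
  have hXall : ∀ x, Γ₁.X x t = Γ₂.X x t := by
    intro x
    have hd : ∀ x, HasDerivAt (fun x => Γ₁.X x t - Γ₂.X x t) 0 x := fun x => by
      refine ((Γ₁.smX.hasDerivAt_x ht x).fun_sub (Γ₂.smX.hasDerivAt_x ht x)).congr_deriv ?_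
      obtain ⟨e1, e2, e3, e4⟩ := hX0 x
      rw [e1, e2]
      nlinarith [hcs x, sq_nonneg (Γ₁.s x t - Γ₂.s x t)]
    have h1 := is_const_of_deriv_eq_zero (fun x => (hd x).differentiableAt)
      (fun x => (hd x).deriv) x x₀
    have h2 := hX.self_of_nhds
    simp only at h2
    linarith
  have hYall : ∀ x, Γ₁.Y x t = Γ₂.Y x t := by
    intro x
    have hd : ∀ x, HasDerivAt (fun x => Γ₁.Y x t - Γ₂.Y x t) 0 x := fun x => by
      refine ((Γ₁.smY.hasDerivAt_x ht x).fun_sub (Γ₂.smY.hasDerivAt_x ht x)).congr_deriv ?_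
      obtain ⟨e1, e2, e3, e4⟩ := hX0 x
      rw [e3, e4]
      nlinarith [hcs x, sq_nonneg (Γ₁.c x t - Γ₂.c x t)]
    have h1 := is_const_of_deriv_eq_zero (fun x => (hd x).differentiableAt)
      (fun x => (hd x).deriv) x x₀
    have h2 := hY.self_of_nhds
    simp only at h2
    linarith
  refine ⟨?_, fun x => ⟨hXall x, hYall x⟩⟩
  obtain ⟨m, hm⟩ := Γ₁.inj t ht 0 (0 + L₂) (by rw [hXall, hXall, Γ₂.perX _ t ht])
    (by rw [hYall, hYall, Γ₂.perY _ t ht])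
  obtain ⟨n, hn⟩ := Γ₂.inj t ht 0 (0 + L₁) (by rw [← hXall, ← hXall, Γ₁.perX _ t ht])
    (by rw [← hYall, ← hYall, Γ₁.perY _ t ht])
  simp only [zero_add] at hm hn
  have hm1 : (1 : ℝ) ≤ m := by
    have : (0 : ℝ) < m := by
      by_contra! h; nlinarith
    exact_mod_cast (Int.cast_pos.1 this)
  have hn1 : (1 : ℝ) ≤ n := by
    have : (0 : ℝ) < n := by
      by_contra! h; nlinarith
    exact_mod_cast (Int.cast_pos.1 this)
  apply le_antisymm <;> nlinarith

end NormalFlow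

section frequency

lemma frequency_numerator_le {C H D y P W E f R H' D' : ℝ} (hC : 0 ≤ C) (hy : 0 ≤ y) (hyH : y ≤ H)
    (hW : 0 ≤ W) (hD : 0 ≤ D) (hP : P ^ 2 ≤ (H - y) * W) (hE : E ^ 2 ≤ (H - y) * f)
    (hf0 : 0 ≤ f) (hf : f ≤ C * (D + H)) (hR : R ^ 2 ≤ C * y * (D + H)) (hDE : D = E / 2 - P)
    (hH' : H' = -2 * D + 2 * E + R) (hD' : D' ≤ C * D - 2 * W + f / 2) :
    D' * H - D * H' ≤ 3 * C * ((D + H) * H) := by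
  have hH : 0 ≤ H := hy.trans hyH
  set g := (D + H) * H with hg
  have hg0 : 0 ≤ g := by positivity
  have hfH : f * H ≤ C * g := by
    rw [hg, ← mul_assoc]; exact mul_le_mul_of_nonneg_right hf hH
  have hyf : y * f ≤ C * g := by nlinarith
  have hD2 : D ^ 2 ≤ H * (f / 2 + 2 * W) := by
    have h1 : D ^ 2 ≤ E ^ 2 / 2 + 2 * P ^ 2 := by
      rw [hDE]; nlinarith [sq_nonneg (E / 2 + P)]
    nlinarith [mul_nonneg hy hW, mul_nonneg hy hf0]
  have hDR2 : (D * R) ^ 2 ≤ (C * g + 2 * (y * W)) ^ 2 := by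
    have h1 : (D * R) ^ 2 ≤ (H * (f / 2 + 2 * W)) * (C * y * (D + H)) := by
      rw [mul_pow]
      exact mul_le_mul hD2 hR (sq_nonneg _) (by positivity)
    have h2 : (H * (f / 2 + 2 * W)) * (C * y * (D + H)) = C * g * (y * f / 2 + 2 * (y * W)) := by
      rw [hg]; ring
    have h3 : C * g * (y * f / 2 + 2 * (y * W)) ≤ C * g * (C * g + 2 * (y * W)) := by
      gcongr; linarith [mul_nonneg hy hf0]
    have h4 : 0 ≤ y * W := mul_nonneg hy hW
    have h5 : 0 ≤ C * g := mul_nonneg hC hg0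
    nlinarith [mul_nonneg h4 h5]
  have hDR : -(D * R) ≤ C * g + 2 * (y * W) :=
    (neg_le_abs _).trans (abs_le_of_sq_le_sq hDR2 (by positivity))
  have hD'H : D' * H ≤ C * D * H - 2 * W * H + f * H / 2 := by
    have := mul_le_mul_of_nonneg_right hD' hH
    linarith
  have hDH : C * D * H ≤ C * g := by
    rw [hg]; nlinarith [mul_nonneg hC (sq_nonneg H)]
  have hkey : -(D * (-2 * D + 2 * E)) ≤ 2 * ((H - y) * W) := by
    have : -(D * (-2 * D + 2 * E)) = 2 * P ^ 2 - E ^ 2 / 2 := by rw [hDE]; ring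
    nlinarith [sq_nonneg E]
  rw [hH']
  nlinarith

lemma frequency_deriv_ge {C H D y E f R H' : ℝ} (hC : 0 ≤ C) (hy : 0 ≤ y) (hyH : y ≤ H)
    (hD : 0 ≤ D) (hE : E ^ 2 ≤ (H - y) * f) (hf0 : 0 ≤ f) (hf : f ≤ C * (D + H))
    (hR : R ^ 2 ≤ C * y * (D + H)) (hH' : H' = -2 * D + 2 * E + R) :
    -((3 + 2 * C) * (D + H)) ≤ H' := by
  have hH : 0 ≤ H := hy.trans hyH
  have h1 : -(H + f) ≤ 2 * E := by
    refine neg_le_of_abs_le (abs_le_of_sq_le_sq ?_ (by positivity))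
    nlinarith [sq_nonneg (H - f), mul_nonneg hy hf0]
  have h2 : -(C * H + (D + H)) ≤ 2 * R := by
    refine neg_le_of_abs_le (abs_le_of_sq_le_sq ?_ (by positivity))
    have : C * y * (D + H) ≤ C * H * (D + H) := by gcongr
    nlinarith [sq_nonneg (C * H - (D + H))]
  rw [hH']
  nlinarith [mul_nonneg hC hD, mul_nonneg hC hH]

lemma eq_zero_of_frequency_le {H D H' D' : ℝ → ℝ} {K t₀ t₁ : ℝ} (ht : t₀ ≤ t₁) (hK : 0 ≤ K)
    (hH : ∀ t ∈ Icc t₀ t₁, HasDerivAt H (H' t) t) (hD : ∀ t ∈ Icc t₀ t₁, HasDerivAt D (D' t) t)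
    (hH0 : ∀ t ∈ Icc t₀ t₁, 0 ≤ H t) (hD0 : ∀ t ∈ Icc t₀ t₁, 0 ≤ D t)
    (hN : ∀ t ∈ Icc t₀ t₁, D' t * H t - D t * H' t ≤ K * ((D t + H t) * H t))
    (hHD : ∀ t ∈ Icc t₀ t₁, -(K * (D t + H t)) ≤ H' t) (h1 : H t₁ = 0) : H t₀ = 0 := by
  by_contra h0
  have hpos : 0 < H t₀ := lt_of_le_of_ne (hH0 t₀ (left_mem_Icc.2 ht)) (Ne.symm h0)
  have hcH : ContinuousOn H (Icc t₀ t₁) := fun t h => (hH t h).continuousAt.continuousWithinAt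
  obtain ⟨t₂, ⟨ht₂, hH2⟩, hleast⟩ : ∃ t₂, IsLeast (Icc t₀ t₁ ∩ H ⁻¹' {0}) t₂ := by
    refine IsCompact.exists_isLeast ?_ ⟨t₁, right_mem_Icc.2 ht, h1⟩
    exact isCompact_Icc.of_isClosed_subset
      (hcH.preimage_isClosed_of_isClosed isClosed_Icc isClosed_singleton) inter_subset_left
  have hlt : t₀ < t₂ := lt_of_le_of_ne ht₂.1 (by rintro rfl; exact h0 hH2)
  have hmem : ∀ t ∈ Ico t₀ t₂, t ∈ Icc t₀ t₁ := fun t h => ⟨h.1, h.2.le.trans ht₂.2⟩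
  have hHpos : ∀ t ∈ Ico t₀ t₂, 0 < H t := fun t h =>
    lt_of_le_of_ne (hH0 t (hmem t h)) fun he => absurd (hleast ⟨hmem t h, he.symm⟩) (not_le.2 h.2)
  have hdG : ∀ t ∈ Ico t₀ t₂, HasDerivAt (fun t => (D t / H t + 1) * exp (-(K * t)))
      (((D' t * H t - D t * H' t) / H t ^ 2 - K * (D t / H t + 1)) * exp (-(K * t))) t := by
    intro t h
    have := (((hD t (hmem t h)).fun_div (hH t (hmem t h)) (hHpos t h).ne').add_const 1).fun_mul
      (((hasDerivAt_id t).const_mul K).fun_neg.exp)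
    refine this.congr_deriv ?_
    simp only [id]; ring
  have hG : AntitoneOn (fun t => (D t / H t + 1) * exp (-(K * t))) (Ico t₀ t₂) := by
    refine antitoneOn_of_deriv_nonpos (convex_Ico _ _)
      (fun t h => (hdG t h).continuousAt.continuousWithinAt)
      (fun t h => (hdG t (interior_subset h)).differentiableAt.differentiableWithinAt) ?_
    intro t h
    have h := interior_subset h
    rw [(hdG t h).deriv]
    refine mul_nonpos_of_nonpos_of_nonneg ?_ (exp_pos _).le
    have hp := hHpos t h
    have := hN t (hmem t h)
    rw [sub_nonpos, div_le_iff₀ (by positivity)]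
    calc _ ≤ _ := this
      _ = _ := by field_simp
  set M := (D t₀ / H t₀ + 1) * exp (-(K * t₀)) * exp (K * t₂) with hM
  have hM0 : 0 ≤ M := by
    have := div_nonneg (hD0 t₀ (left_mem_Icc.2 ht)) hpos.le
    positivity
  have hDH : ∀ t ∈ Ico t₀ t₂, D t + H t ≤ M * H t := by
    intro t h
    have h2 := hG (left_mem_Ico.2 hlt) h h.1
    have hp := hHpos t h
    have h3 : D t / H t + 1 ≤ M := by
      have : D t / H t + 1 = (D t / H t + 1) * exp (-(K * t)) * exp (K * t) := by
        rw [mul_assoc, ← exp_add]; simp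
      rw [this, hM]
      refine mul_le_mul h2 (exp_le_exp.2 ?_) (exp_pos _).le ?_
      · exact mul_le_mul_of_nonneg_left h.2.le hK
      · have := div_nonneg (hD0 t₀ (left_mem_Icc.2 ht)) hpos.le
        positivity
    calc D t + H t = (D t / H t + 1) * H t := by field_simp
      _ ≤ _ := by gcongr
  have hdH : ∀ t ∈ Icc t₀ t₁, HasDerivAt (fun t => H t * exp (K * M * t))
      ((H' t + K * M * H t) * exp (K * M * t)) t := by
    intro t h
    refine ((hH t h).fun_mul ((hasDerivAt_id t).const_mul (K * M)).exp).congr_deriv ?_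
    simp only [id]; ring
  have hmono : MonotoneOn (fun t => H t * exp (K * M * t)) (Icc t₀ t₂) := by
    refine monotoneOn_of_deriv_nonneg (convex_Icc _ _)
      (fun t h => (hdH t ⟨h.1, h.2.trans ht₂.2⟩).continuousAt.continuousWithinAt)
      (fun t h => (hdH t ⟨(interior_subset h).1,
        (interior_subset h).2.trans ht₂.2⟩).differentiableAt.differentiableWithinAt) ?_
    intro t h
    rw [interior_Icc] at h
    have h' : t ∈ Ico t₀ t₂ := ⟨h.1.le, h.2⟩
    rw [(hdH t (hmem t h')).deriv]
    refine mul_nonneg ?_ (exp_pos _).le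
    have h2 := hHD t (hmem t h')
    have h3 := mul_le_mul_of_nonneg_left (hDH t h') hK
    linarith
  have h2 := hmono (left_mem_Icc.2 hlt.le) (right_mem_Icc.2 hlt.le) hlt.le
  have h3 : H t₂ = 0 := hH2
  simp only [h3, zero_mul] at h2
  exact absurd h2 (not_le.2 (by positivity))

end frequency

lemma integral_mul_sq_le {f g : ℝ → ℝ} {L : ℝ} (hL : 0 ≤ L) (hf : Continuous f)
    (hg : Continuous g) : (∫ x in (0)..L, f x * g x) ^ 2
      ≤ (∫ x in (0)..L, f x ^ 2) * ∫ x in (0)..L, g x ^ 2 := by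
  have h : ∀ s : ℝ, 0 ≤ (∫ x in (0)..L, f x ^ 2) * (s * s) + (2 * ∫ x in (0)..L, f x * g x) * s
      + ∫ x in (0)..L, g x ^ 2 := by
    intro s
    have e : ∫ x in (0)..L, (s * f x + g x) ^ 2 = (∫ x in (0)..L, f x ^ 2) * (s * s)
        + (2 * ∫ x in (0)..L, f x * g x) * s + ∫ x in (0)..L, g x ^ 2 := by
      rw [← intervalIntegral.integral_const_mul, ← intervalIntegral.integral_mul_const,
        ← intervalIntegral.integral_mul_const, ← intervalIntegral.integral_add,
        ← intervalIntegral.integral_add]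
      · congr 1; ext x; ring
      all_goals exact Continuous.intervalIntegrable (by fun_prop) _ _
    rw [← e]
    exact intervalIntegral.integral_nonneg hL fun x _ => sq_nonneg _
  have := discrim_le_zero h
  rw [discrim] at this
  nlinarith

namespace StripSmooth
variable {S L t : ℝ} {f g : ℝ → ℝ → ℝ}

lemma hasDerivAt_integral (hf : StripSmooth S f) (ht : t ∈ Ioo 0 S) (L : ℝ) :
    HasDerivAt (fun s => ∫ x in (0)..L, f x s) (∫ x in (0)..L, dt f x t) t := by
  obtain ⟨c, hc0, hct⟩ := exists_between ht.1
  obtain ⟨d, htd, hdS⟩ := exists_between ht.2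
  have hmem : ∀ s ∈ Icc c d, s ∈ Ioo 0 S := fun s h => ⟨hc0.trans_le h.1, h.2.trans_lt hdS⟩
  obtain ⟨C, hC, hb⟩ := hf.dt.exists_bound (a := min 0 L) (b := max 0 L) hc0 hdS
  refine (intervalIntegral.hasDerivAt_integral_of_dominated_loc_of_deriv_le
    (F := fun s x => f x s) (F' := fun s x => dt f x s)
    (s := Icc c d) (bound := fun _ => C) (Icc_mem_nhds hct htd) ?_ ?_ ?_ ?_ ?_ ?_).2
  · filter_upwards [Icc_mem_nhds hct htd] with s hs
    exact (hf.continuous_x (hmem s hs)).aestronglyMeasurable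
  · exact (hf.continuous_x ht).intervalIntegrable _ _
  · exact (hf.dt.continuous_x ht).aestronglyMeasurable
  · exact .of_forall fun x hx s hs => hb x (Ioc_subset_Icc_self hx) s hs
  · exact intervalIntegrable_const
  · exact .of_forall fun x hx s hs => hf.hasDerivAt_t (hmem s hs) x

lemma integral_dx_eq_zero (hf : StripSmooth S f) (ht : t ∈ Ioo 0 S)
    (hp : ∀ x, f (x + L) t = f x t) : ∫ x in (0)..L, _root_.dx f x t = 0 := by
  rw [intervalIntegral.integral_eq_sub_of_hasDerivAt (fun x _ => hf.hasDerivAt_x ht x)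
    ((hf.dx.continuous_x ht).intervalIntegrable _ _)]
  have := hp 0
  rw [zero_add] at this
  rw [this, sub_self]

lemma integral_dx_mul (hf : StripSmooth S f) (hg : StripSmooth S g) (ht : t ∈ Ioo 0 S)
    (hpf : ∀ x, f (x + L) t = f x t) (hpg : ∀ x, g (x + L) t = g x t) :
    ∫ x in (0)..L, f x t * _root_.dx g x t = - ∫ x in (0)..L, _root_.dx f x t * g x t := by
  have h := (hf.mul hg).integral_dx_eq_zero ht (L := L) (fun x => by simp only [hpf, hpg])
  rw [intervalIntegral.integral_congr (fun x _ => dx_mul hf hg ht x),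
    intervalIntegral.integral_add (((hf.dx.mul hg).continuous_x ht).intervalIntegrable _ _)
    (((hf.mul hg.dx).continuous_x ht).intervalIntegrable _ _)] at h
  linarith

end StripSmooth

lemma sq_linear_form_le {B K a g₁ g₂ g₃ g₄ v z u w : ℝ} (h₁ : |g₁| ≤ B) (h₂ : |g₂| ≤ B)
    (h₃ : |g₃| ≤ B) (h₄ : |g₄| ≤ B) (ha : 0 < a) (hK : |a⁻¹| ≤ K) :
    (g₁ * v + g₂ * z + g₃ * u + g₄ * w) ^ 2
      ≤ 4 * B ^ 2 * (1 + K) * (u ^ 2 + v ^ 2 + z ^ 2 + a * w ^ 2) := by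
  have hB : ∀ g : ℝ, |g| ≤ B → g ^ 2 ≤ B ^ 2 := fun g hg => by
    rw [← sq_abs g]; exact pow_le_pow_left₀ (abs_nonneg g) hg 2
  have hK0 : 0 ≤ K := (abs_nonneg _).trans hK
  have hw : w ^ 2 ≤ K * (a * w ^ 2) := by
    have h := mul_le_mul_of_nonneg_right ((le_abs_self _).trans hK)
      (by positivity : 0 ≤ a * w ^ 2)
    calc w ^ 2 = a⁻¹ * (a * w ^ 2) := by field_simp
      _ ≤ _ := h
  have h5 : (g₁ * v + g₂ * z + g₃ * u + g₄ * w) ^ 2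
      ≤ 4 * (g₁ ^ 2 * v ^ 2 + g₂ ^ 2 * z ^ 2 + g₃ ^ 2 * u ^ 2 + g₄ ^ 2 * w ^ 2) := by
    nlinarith [sq_nonneg (g₁ * v - g₂ * z), sq_nonneg (g₁ * v - g₃ * u),
      sq_nonneg (g₁ * v - g₄ * w), sq_nonneg (g₂ * z - g₃ * u), sq_nonneg (g₂ * z - g₄ * w),
      sq_nonneg (g₃ * u - g₄ * w)]
  have h6 : g₁ ^ 2 * v ^ 2 + g₂ ^ 2 * z ^ 2 + g₃ ^ 2 * u ^ 2 + g₄ ^ 2 * w ^ 2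
      ≤ B ^ 2 * (v ^ 2 + z ^ 2 + u ^ 2 + w ^ 2) := by
    nlinarith [mul_le_mul_of_nonneg_right (hB _ h₁) (sq_nonneg v),
      mul_le_mul_of_nonneg_right (hB _ h₂) (sq_nonneg z),
      mul_le_mul_of_nonneg_right (hB _ h₃) (sq_nonneg u),
      mul_le_mul_of_nonneg_right (hB _ h₄) (sq_nonneg w)]
  have h7 : v ^ 2 + z ^ 2 + u ^ 2 + w ^ 2 ≤ (1 + K) * (u ^ 2 + v ^ 2 + z ^ 2 + a * w ^ 2) := by
    have : 0 ≤ K * (u ^ 2 + v ^ 2 + z ^ 2) := by positivity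
    nlinarith [mul_nonneg ha.le (sq_nonneg w)]
  have h8 := mul_le_mul_of_nonneg_left h7 (sq_nonneg B)
  linarith

/-- Backward uniqueness for a parabolic equation coupled to an ordinary differential equation. -/
theorem backward_unique {S L t₀ t₁ : ℝ} (hL : 0 < L) (ht₀ : 0 < t₀) (h01 : t₀ ≤ t₁) (ht₁ : t₁ < S)
    {a u v α₁ α₂ α₃ α₄ β₁ β₂ : ℝ → ℝ → ℝ} (sa : StripSmooth S a) (su : StripSmooth S u)
    (sv : StripSmooth S v) (s₁ : StripSmooth S α₁) (s₂ : StripSmooth S α₂)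
    (s₃ : StripSmooth S α₃) (s₄ : StripSmooth S α₄) (r₁ : StripSmooth S β₁)
    (r₂ : StripSmooth S β₂) (ha : ∀ t ∈ Ioo 0 S, ∀ x, 0 < a x t)
    (pa : ∀ t ∈ Ioo 0 S, ∀ x, a (x + L) t = a x t) (pu : ∀ t ∈ Ioo 0 S, ∀ x, u (x + L) t = u x t)
    (hu : ∀ t ∈ Ioo 0 S, ∀ x, dt u x t = dx (fun x t => a x t * dx u x t) x t
      + (α₁ x t * v x t + α₂ x t * dx v x t + α₃ x t * u x t + α₄ x t * dx u x t))
    (hv : ∀ t ∈ Ioo 0 S, ∀ x, dt v x t = β₁ x t * v x t + β₂ x t * u x t)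
    (hu₁ : ∀ x, u x t₁ = 0) (hv₁ : ∀ x, v x t₁ = 0) :
    ∀ x ∈ Ioo 0 L, u x t₀ = 0 ∧ v x t₀ = 0 := by
  have hmem : ∀ t ∈ Icc t₀ t₁, t ∈ Ioo 0 S := fun t h => ⟨ht₀.trans_le h.1, h.2.trans_lt ht₁⟩
  have sq₀ : ∀ {f}, StripSmooth S f → StripSmooth S fun x t => f x t ^ 2 := fun h => h.pow 2
  set A : ℝ → ℝ → ℝ := dx (fun x t => a x t * dx u x t)
  have sA : StripSmooth S A := (sa.mul su.dx).dx
  set F : ℝ → ℝ → ℝ := fun x t =>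
    α₁ x t * v x t + α₂ x t * dx v x t + α₃ x t * u x t + α₄ x t * dx u x t
  have sF : StripSmooth S F :=
    (((s₁.mul sv).add (s₂.mul sv.dx)).add (s₃.mul su)).add (s₄.mul su.dx)
  set V : ℝ → ℝ → ℝ := fun x t => A x t + 1 / 2 * F x t
  have sV : StripSmooth S V := sA.add ((StripSmooth.const S (1 / 2)).mul sF)
  have hdz : ∀ t ∈ Ioo 0 S, ∀ x, dt (dx v) x t = dx β₁ x t * v x t + β₁ x t * dx v x t
      + dx β₂ x t * u x t + β₂ x t * dx u x t := by
    intro t ht x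
    rw [sv.dt_dx ht, dx_congr (g := fun x t => β₁ x t * v x t + β₂ x t * u x t) (hv t ht),
      dx_add (r₁.mul sv) (r₂.mul su) ht, dx_mul r₁ sv ht, dx_mul r₂ su ht]
    ring
  set e : ℝ → ℝ → ℝ := fun x t => u x t ^ 2 + v x t ^ 2 + dx v x t ^ 2 with he
  have se : StripSmooth S e := ((sq₀ su).add (sq₀ sv)).add (sq₀ sv.dx)
  set q : ℝ → ℝ → ℝ := fun x t => a x t * dx u x t ^ 2 with hq
  have sqq : StripSmooth S q := sa.mul (sq₀ su.dx)
  set w : ℝ → ℝ → ℝ := fun x t => v x t ^ 2 + dx v x t ^ 2 with hw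
  have sw : StripSmooth S w := (sq₀ sv).add (sq₀ sv.dx)
  obtain ⟨K, hK0, hK⟩ := (sa.inv fun x t ht => (ha t ht x).ne').exists_bound
    (a := 0) (b := L) ht₀ ht₁
  have hbd : ∀ g₁ g₂ g₃ g₄ : ℝ → ℝ → ℝ, StripSmooth S g₁ → StripSmooth S g₂ → StripSmooth S g₃ →
      StripSmooth S g₄ → ∃ C, 0 ≤ C ∧ ∀ t ∈ Icc t₀ t₁,
      ∫ x in (0)..L, (g₁ x t * v x t + g₂ x t * dx v x t + g₃ x t * u x t + g₄ x t * dx u x t) ^ 2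
        ≤ C * ((∫ x in (0)..L, q x t) + ∫ x in (0)..L, e x t) := by
    intro g₁ g₂ g₃ g₄ k₁ k₂ k₃ k₄
    obtain ⟨B₁, p₁, b₁⟩ := k₁.exists_bound (a := 0) (b := L) ht₀ ht₁
    obtain ⟨B₂, p₂, b₂⟩ := k₂.exists_bound (a := 0) (b := L) ht₀ ht₁
    obtain ⟨B₃, p₃, b₃⟩ := k₃.exists_bound (a := 0) (b := L) ht₀ ht₁
    obtain ⟨B₄, p₄, b₄⟩ := k₄.exists_bound (a := 0) (b := L) ht₀ ht₁
    refine ⟨4 * (B₁ + B₂ + B₃ + B₄) ^ 2 * (1 + K), by positivity, fun t ht => ?_⟩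
    have hT := hmem t ht
    rw [← intervalIntegral.integral_add ((sqq.continuous_x hT).intervalIntegrable _ _)
      ((se.continuous_x hT).intervalIntegrable _ _), ← intervalIntegral.integral_const_mul]
    refine intervalIntegral.integral_mono_on hL.le
      (((sq₀ ((((k₁.mul sv).add (k₂.mul sv.dx)).add (k₃.mul su)).add
        (k₄.mul su.dx))).continuous_x hT).intervalIntegrable _ _)
      ((((StripSmooth.const S _).mul (sqq.add se)).continuous_x hT).intervalIntegrable _ _) ?_
    intro x hx
    have := sq_linear_form_le (v := v x t) (z := dx v x t) (u := u x t) (w := dx u x t)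
      (B := B₁ + B₂ + B₃ + B₄) (by linarith [b₁ x hx t ht])
      (by linarith [b₂ x hx t ht]) (by linarith [b₃ x hx t ht]) (by linarith [b₄ x hx t ht])
      (ha t hT x) (hK x hx t ht)
    refine this.trans (le_of_eq ?_)
    simp only [hq, he]; ring
  obtain ⟨C₁, hC₁, hF⟩ := hbd α₁ α₂ α₃ α₄ s₁ s₂ s₃ s₄
  obtain ⟨C₂, hC₂, hV'⟩ := hbd β₁ (fun _ _ => 0) β₂ (fun _ _ => 0) r₁ (.const S 0) r₂ (.const S 0)
  obtain ⟨C₃, hC₃, hZ'⟩ := hbd (dx β₁) β₁ (dx β₂) β₂ r₁.dx r₁ r₂.dx r₂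
  obtain ⟨C₄, hC₄, hat⟩ := sa.dt.exists_bound (a := 0) (b := L) ht₀ ht₁
  set C := C₁ + 8 * (C₂ + C₃) + C₄ * K with hC
  have hC0 : 0 ≤ C := by positivity
  set R : ℝ → ℝ := fun t => 2 * (∫ x in (0)..L, v x t * dt v x t)
    + 2 * ∫ x in (0)..L, dx v x t * dt (dx v) x t with hRdef
  have ii : ∀ {f : ℝ → ℝ → ℝ}, StripSmooth S f → ∀ {t}, t ∈ Ioo 0 S →
      IntervalIntegrable (fun x => f x t) volume 0 L :=
    fun h _ ht => (h.continuous_x ht).intervalIntegrable _ _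
  have hA : ∀ t ∈ Ioo 0 S, ∀ f, StripSmooth S f → (∀ x, f (x + L) t = f x t) →
      ∫ x in (0)..L, f x t * A x t = -∫ x in (0)..L, dx f x t * (a x t * dx u x t) := by
    intro t ht f sf pf
    exact sf.integral_dx_mul (sa.mul su.dx) ht pf
      (fun x => by simp only [pa t ht, dx_periodic (pu t ht)])
  have hdH : ∀ t ∈ Icc t₀ t₁, HasDerivAt (fun t => ∫ x in (0)..L, e x t)
      (-2 * (∫ x in (0)..L, q x t) + 2 * (∫ x in (0)..L, u x t * F x t) + R t) t := by
    intro t ht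
    have hT := hmem t ht
    refine (se.hasDerivAt_integral hT L).congr_deriv ?_
    have h1 : ∫ x in (0)..L, u x t * A x t = -∫ x in (0)..L, q x t := by
      rw [hA t hT u su (pu t hT)]
      congr 2; ext x; simp only [hq]; ring
    have h2 : ∀ x, dt e x t = 2 * (u x t * A x t) + 2 * (u x t * F x t) + 2 * (v x t * dt v x t)
        + 2 * (dx v x t * dt (dx v) x t) := by
      intro x
      have := (((su.hasDerivAt_t hT x).fun_pow 2).fun_add
        ((sv.hasDerivAt_t hT x).fun_pow 2)).fun_add ((sv.dx.hasDerivAt_t hT x).fun_pow 2)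
      have h3 : dt e x t = _ := this.deriv
      rw [h3, hu t hT x]
      simp only [A, F]
      push_cast; ring
    have k1 := (StripSmooth.const S 2).mul (su.mul sA)
    have k2 := (StripSmooth.const S 2).mul (su.mul sF)
    have k3 := (StripSmooth.const S 2).mul (sv.mul sv.dt)
    have k4 := (StripSmooth.const S 2).mul (sv.dx.mul sv.dx.dt)
    rw [intervalIntegral.integral_congr (fun x _ => h2 x),
      intervalIntegral.integral_add (ii ((k1.add k2).add k3) hT) (ii k4 hT),
      intervalIntegral.integral_add (ii (k1.add k2) hT) (ii k3 hT),
      intervalIntegral.integral_add (ii k1 hT) (ii k2 hT)]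
    simp only [intervalIntegral.integral_const_mul, h1, hRdef]
    ring
  have hdD : ∀ t ∈ Icc t₀ t₁, HasDerivAt (fun t => ∫ x in (0)..L, q x t)
      (∫ x in (0)..L, dt q x t) t := fun t ht => sqq.hasDerivAt_integral (hmem t ht) L
  have hD' : ∀ t ∈ Icc t₀ t₁, ∫ x in (0)..L, dt q x t ≤ C * (∫ x in (0)..L, q x t)
      - 2 * (∫ x in (0)..L, V x t ^ 2) + (∫ x in (0)..L, F x t ^ 2) / 2 := by
    intro t ht
    have hT := hmem t ht
    have h1 : ∫ x in (0)..L, dt u x t * A x t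
        = -∫ x in (0)..L, dx (dt u) x t * (a x t * dx u x t) :=
      hA t hT (dt u) su.dt fun x => dt_periodic (fun s hs => pu s hs x) hT
    have h2 : ∫ x in (0)..L, dt u x t * A x t
        = (∫ x in (0)..L, V x t ^ 2) - 1 / 4 * ∫ x in (0)..L, F x t ^ 2 := by
      rw [← intervalIntegral.integral_const_mul, ← intervalIntegral.integral_sub (ii (sq₀ sV) hT)
        (ii ((StripSmooth.const S (1 / 4)).mul (sq₀ sF)) hT)]
      refine intervalIntegral.integral_congr fun x _ => ?_
      have h := hu t hT x
      simp only [V, F, A] at h ⊢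
      rw [h]; ring
    have h3 : ∀ x, dt q x t = dt a x t * dx u x t ^ 2
        + 2 * (dx (dt u) x t * (a x t * dx u x t)) := by
      intro x
      have := (sa.hasDerivAt_t hT x).fun_mul ((su.dx.hasDerivAt_t hT x).fun_pow 2)
      have h3 : dt q x t = _ := this.deriv
      rw [h3, su.dt_dx hT]
      push_cast; ring
    have k1 := sa.dt.mul (sq₀ su.dx)
    have k2 := (StripSmooth.const S 2).mul (su.dt.dx.mul (sa.mul su.dx))
    rw [intervalIntegral.integral_congr (fun x _ => h3 x),
      intervalIntegral.integral_add (ii k1 hT) (ii k2 hT), intervalIntegral.integral_const_mul]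
    have h4 : ∫ x in (0)..L, dt a x t * dx u x t ^ 2 ≤ C * ∫ x in (0)..L, q x t := by
      rw [← intervalIntegral.integral_const_mul]
      refine intervalIntegral.integral_mono_on hL.le (ii k1 hT)
        (ii ((StripSmooth.const S C).mul sqq) hT) fun x hx => ?_
      have ha0 := ha t hT x
      have i1 : dt a x t ≤ C₄ := (le_abs_self _).trans (hat x hx t ht)
      have i2 : (a x t)⁻¹ ≤ K := (le_abs_self _).trans (hK x hx t ht)
      have i3 : 1 ≤ K * a x t := by
        calc 1 = (a x t)⁻¹ * a x t := by field_simp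
          _ ≤ _ := by gcongr
      calc _ ≤ C₄ * dx u x t ^ 2 := by gcongr
        _ ≤ C₄ * (K * a x t) * dx u x t ^ 2 := by
          gcongr; exact le_mul_of_one_le_right hC₄.le i3
        _ = C₄ * K * q x t := by simp only [hq]; ring
        _ ≤ C * q x t := by
          have : 0 ≤ q x t := mul_nonneg ha0.le (sq_nonneg _)
          gcongr
          rw [hC]; linarith
    linarith
  have hq0 : ∀ t ∈ Icc t₀ t₁, 0 ≤ ∫ x in (0)..L, q x t := fun t ht =>
    intervalIntegral.integral_nonneg hL.le fun x _ =>
      mul_nonneg (ha t (hmem t ht) x).le (sq_nonneg _)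
  have he0 : ∀ t, 0 ≤ ∫ x in (0)..L, e x t := fun t =>
    intervalIntegral.integral_nonneg hL.le fun x _ => by simp only [he]; positivity
  have hw0 : ∀ t, 0 ≤ ∫ x in (0)..L, w x t := fun t =>
    intervalIntegral.integral_nonneg hL.le fun x _ => by simp only [hw]; positivity
  have hsq0 : ∀ (f : ℝ → ℝ → ℝ) t, 0 ≤ ∫ x in (0)..L, f x t ^ 2 := fun f t =>
    intervalIntegral.integral_nonneg hL.le fun x _ => sq_nonneg _
  have hew : ∀ t ∈ Icc t₀ t₁, ∫ x in (0)..L, e x t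
      = (∫ x in (0)..L, u x t ^ 2) + ∫ x in (0)..L, w x t := by
    intro t ht
    rw [← intervalIntegral.integral_add (ii (sq₀ su) (hmem t ht)) (ii sw (hmem t ht))]
    congr 1; ext x; simp only [he, hw]; ring
  have hwv : ∀ t ∈ Icc t₀ t₁, ∫ x in (0)..L, w x t
      = (∫ x in (0)..L, v x t ^ 2) + ∫ x in (0)..L, dx v x t ^ 2 := fun t ht =>
    intervalIntegral.integral_add (ii (sq₀ sv) (hmem t ht)) (ii (sq₀ sv.dx) (hmem t ht))
  have hCS : ∀ t ∈ Icc t₀ t₁, ∀ f, StripSmooth S f → (∫ x in (0)..L, u x t * f x t) ^ 2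
      ≤ ((∫ x in (0)..L, e x t) - ∫ x in (0)..L, w x t) * ∫ x in (0)..L, f x t ^ 2 := by
    intro t ht f sf
    rw [hew t ht, add_sub_cancel_right]
    exact integral_mul_sq_le hL.le (su.continuous_x (hmem t ht)) (sf.continuous_x (hmem t ht))
  have hR : ∀ t ∈ Icc t₀ t₁, R t ^ 2 ≤ C * (∫ x in (0)..L, w x t)
      * ((∫ x in (0)..L, q x t) + ∫ x in (0)..L, e x t) := by
    intro t ht
    have hT := hmem t ht
    have h1 := integral_mul_sq_le hL.le (sv.continuous_x hT) (sv.dt.continuous_x hT)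
    have h2 := integral_mul_sq_le hL.le (sv.dx.continuous_x hT) (sv.dx.dt.continuous_x hT)
    have h3 : ∫ x in (0)..L, dt v x t ^ 2
        ≤ C₂ * ((∫ x in (0)..L, q x t) + ∫ x in (0)..L, e x t) := by
      refine le_trans (le_of_eq ?_) (hV' t ht)
      congr 1; ext x; rw [hv t hT]; ring
    have h4 : ∫ x in (0)..L, dt (dx v) x t ^ 2
        ≤ C₃ * ((∫ x in (0)..L, q x t) + ∫ x in (0)..L, e x t) := by
      refine le_trans (le_of_eq ?_) (hZ' t ht)
      congr 1; ext x; rw [hdz t hT]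
    have h5 := hwv t ht
    have h6 := hsq0 v t
    have h7 := hsq0 (dx v) t
    have h8 : 0 ≤ (∫ x in (0)..L, q x t) + ∫ x in (0)..L, e x t := add_nonneg (hq0 t ht) (he0 t)
    simp only [hRdef]
    set I₁ := ∫ x in (0)..L, v x t * dt v x t
    set I₂ := ∫ x in (0)..L, dx v x t * dt (dx v) x t
    set J := (∫ x in (0)..L, q x t) + ∫ x in (0)..L, e x t
    set y := ∫ x in (0)..L, w x t
    have i1 : I₁ ^ 2 ≤ y * (C₂ * J) := h1.trans (mul_le_mul (by linarith) h3 (hsq0 _ t) (hw0 t))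
    have i2 : I₂ ^ 2 ≤ y * (C₃ * J) := h2.trans (mul_le_mul (by linarith) h4 (hsq0 _ t) (hw0 t))
    calc (2 * I₁ + 2 * I₂) ^ 2 ≤ 8 * I₁ ^ 2 + 8 * I₂ ^ 2 := by nlinarith [sq_nonneg (I₁ - I₂)]
      _ ≤ 8 * (y * (C₂ * J)) + 8 * (y * (C₃ * J)) := by linarith
      _ = 8 * (C₂ + C₃) * y * J := by ring
      _ ≤ C * y * J := by
        gcongr
        · exact hw0 t
        · have : 0 ≤ C₄ * K := by positivity
          rw [hC]; linarith
  have hFb : ∀ t ∈ Icc t₀ t₁, ∫ x in (0)..L, F x t ^ 2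
      ≤ C * ((∫ x in (0)..L, q x t) + ∫ x in (0)..L, e x t) := by
    intro t ht
    refine (hF t ht).trans (mul_le_mul_of_nonneg_right ?_ (add_nonneg (hq0 t ht) (he0 t)))
    have : 0 ≤ C₄ * K := by positivity
    rw [hC]; linarith
  have hwe : ∀ t ∈ Icc t₀ t₁, ∫ x in (0)..L, w x t ≤ ∫ x in (0)..L, e x t := fun t ht => by
    linarith [hew t ht, hsq0 u t]
  have hDE : ∀ t ∈ Icc t₀ t₁, ∫ x in (0)..L, q x t
      = (∫ x in (0)..L, u x t * F x t) / 2 - ∫ x in (0)..L, u x t * V x t := by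
    intro t ht
    have hT := hmem t ht
    have h1 : ∫ x in (0)..L, u x t * A x t = -∫ x in (0)..L, q x t := by
      rw [hA t hT u su (pu t hT)]
      congr 2; ext x; simp only [hq]; ring
    have h2 : ∫ x in (0)..L, u x t * V x t
        = (∫ x in (0)..L, u x t * A x t) + 1 / 2 * ∫ x in (0)..L, u x t * F x t := by
      rw [← intervalIntegral.integral_const_mul, ← intervalIntegral.integral_add
        (ii (su.mul sA) hT) (ii ((StripSmooth.const S (1 / 2)).mul (su.mul sF)) hT)]
      congr 1; ext x; simp only [V]; ring
    linarith
  have hend : ∫ x in (0)..L, e x t₁ = 0 := by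
    have h : ∀ x, e x t₁ = 0 := by
      intro x
      have : dx v x t₁ = 0 := by
        have : (fun y => v y t₁) = fun _ => (0 : ℝ) := funext hv₁
        simp only [dx, this, deriv_const]
      simp only [he, hu₁, hv₁, this]; norm_num
    simp [h]
  have hzero := eq_zero_of_frequency_le h01 (K := 3 + 3 * C) (by positivity) hdH hdD
    (fun t _ => he0 t) hq0
    (fun t ht => by
      have h := frequency_numerator_le hC0 (hw0 t) (hwe t ht) (hsq0 V t) (hq0 t ht)
        (hCS t ht V sV) (hCS t ht F sF) (hsq0 F t) (hFb t ht) (hR t ht) (hDE t ht) rfl (hD' t ht)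
      have h2 : 0 ≤ ((∫ x in (0)..L, q x t) + ∫ x in (0)..L, e x t) * ∫ x in (0)..L, e x t :=
        mul_nonneg (add_nonneg (hq0 t ht) (he0 t)) (he0 t)
      linarith)
    (fun t ht => by
      have h := frequency_deriv_ge hC0 (hw0 t) (hwe t ht) (hq0 t ht)
        (hCS t ht F sF) (hsq0 F t) (hFb t ht) (hR t ht) rfl
      have h2 := mul_nonneg hC0 (add_nonneg (hq0 t ht) (he0 t))
      linarith) hend
  have hT := hmem t₀ (left_mem_Icc.2 h01)
  intro x hx
  by_contra hne
  have hcont := se.continuous_x hT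
  have hpos : 0 < ∫ x in (0)..L, e x t₀ := by
    refine intervalIntegral.integral_pos hL hcont.continuousOn
      (fun y _ => by simp only [he]; positivity) ⟨x, Ioo_subset_Icc_self hx, ?_⟩
    simp only [he]
    rcases not_and_or.1 hne with h | h <;> positivity
  exact hpos.ne' hzero

lemma eqOn_zero_of_hasDerivAt_zero {f : ℝ → ℝ} {a b : ℝ} (hf : ∀ t ∈ Icc a b, HasDerivAt f 0 t)
    (hb : f b = 0) {t : ℝ} (ht : t ∈ Icc a b) : f t = 0 := by
  have h := constant_of_has_deriv_right_zero
    (fun x hx => (hf x hx).continuousAt.continuousWithinAt)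
    (fun x hx => (hf x (Ico_subset_Icc_self hx)).hasDerivWithinAt)
  rw [h t ht, ← h b (right_mem_Icc.2 (ht.1.trans ht.2)), hb]

namespace NormalFlow
variable {S L : ℝ}

lemma backward_unique_curvature (Γ₁ Γ₂ : NormalFlow S L) (hL : 0 < L) {t₀ t₁ : ℝ} (ht₀ : 0 < t₀)
    (h01 : t₀ ≤ t₁) (ht₁ : t₁ < S) (hκ : ∀ x, Γ₁.κ x t₁ = Γ₂.κ x t₁)
    (hh : ∀ x, Γ₁.h x t₁ = Γ₂.h x t₁) :
    ∀ x ∈ Ioo 0 L, Γ₁.κ x t₀ = Γ₂.κ x t₀ ∧ Γ₁.h x t₀ = Γ₂.h x t₀ := by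
  have a₁ := Γ₁.sm_h
  have a₂ := Γ₂.sm_h
  have k₁ := Γ₁.sm_κ
  have k₂ := Γ₂.sm_κ
  have hmain := backward_unique hL ht₀ h01 ht₁
    (a := fun x t => Γ₁.h x t ^ 2) (u := fun x t => Γ₁.κ x t - Γ₂.κ x t)
    (v := fun x t => Γ₁.h x t - Γ₂.h x t)
    (α₁ := fun x t => (Γ₁.h x t + Γ₂.h x t) * dx (dx Γ₂.κ) x t + dx Γ₂.h x t * dx Γ₂.κ x t)
    (α₂ := fun x t => Γ₁.h x t * dx Γ₂.κ x t)
    (α₃ := fun x t => Γ₁.κ x t ^ 2 + Γ₁.κ x t * Γ₂.κ x t + Γ₂.κ x t ^ 2)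
    (α₄ := fun x t => -(Γ₁.h x t * dx Γ₁.h x t))
    (β₁ := fun x t => Γ₁.κ x t ^ 2) (β₂ := fun x t => Γ₂.h x t * (Γ₁.κ x t + Γ₂.κ x t))
    (a₁.pow 2) (k₁.sub k₂) (a₁.sub a₂)
    (((a₁.add a₂).mul k₂.dx.dx).add (a₂.dx.mul k₂.dx)) (a₁.mul k₂.dx)
    (((k₁.pow 2).add (k₁.mul k₂)).add (k₂.pow 2)) (a₁.mul a₁.dx).neg (k₁.pow 2)
    (a₂.mul (k₁.add k₂)) (fun t ht x => pow_pos (Γ₁.h_pos ht) 2)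
    (fun t ht x => by simp only [Γ₁.h_periodic ht])
    (fun t ht x => by simp only [Γ₁.κ_periodic ht, Γ₂.κ_periodic ht])
    (fun t ht x => by
      have e1 : ∀ x, dx (fun x t => Γ₁.κ x t - Γ₂.κ x t) x t = dx Γ₁.κ x t - dx Γ₂.κ x t :=
        fun x => dx_sub k₁ k₂ ht x
      have e2 : dx (fun x t => Γ₁.h x t ^ 2 * dx (fun x t => Γ₁.κ x t - Γ₂.κ x t) x t) x t
          = 2 * Γ₁.h x t * dx Γ₁.h x t * (dx Γ₁.κ x t - dx Γ₂.κ x t)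
            + Γ₁.h x t ^ 2 * (dx (dx Γ₁.κ) x t - dx (dx Γ₂.κ) x t) := by
        rw [dx_congr (g := fun x t => Γ₁.h x t ^ 2 * (dx Γ₁.κ x t - dx Γ₂.κ x t))
          (fun x => by simp only [e1])]
        have := ((a₁.hasDerivAt_x ht x).fun_pow 2).fun_mul
          ((k₁.dx.hasDerivAt_x ht x).fun_sub (k₂.dx.hasDerivAt_x ht x))
        refine this.deriv.trans ?_
        push_cast; ring
      have e3 : ∀ Γ : NormalFlow S L, Γ.D (Γ.D Γ.κ) x t
          = Γ.h x t * (dx Γ.h x t * dx Γ.κ x t + Γ.h x t * dx (dx Γ.κ) x t) := fun Γ => by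
        have : dx (Γ.D Γ.κ) x t = _ := dx_mul Γ.sm_h Γ.sm_κ.dx ht x
        show Γ.h x t * dx (Γ.D Γ.κ) x t = _
        rw [this]
      rw [dt_sub k₁ k₂ ht, e2, e1, dx_sub a₁ a₂ ht, Γ₁.dt_κ ht, Γ₂.dt_κ ht, e3, e3]
      ring)
    (fun t ht x => by rw [dt_sub a₁ a₂ ht, Γ₁.dt_h ht, Γ₂.dt_h ht]; ring)
    (fun x => by simp only [hκ, sub_self]) (fun x => by simp only [hh, sub_self])
  exact fun x hx => ⟨sub_eq_zero.1 (hmain x hx).1, sub_eq_zero.1 (hmain x hx).2⟩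

theorem eq_of_eq_of_le (Γ₁ Γ₂ : NormalFlow S L) (hL : 0 < L) {t₁ : ℝ} (ht₁ : t₁ ∈ Ioo 0 S)
    (hX : ∀ x, Γ₁.X x t₁ = Γ₂.X x t₁) (hY : ∀ x, Γ₁.Y x t₁ = Γ₂.Y x t₁) {t₀ : ℝ} (ht₀ : 0 < t₀)
    (h01 : t₀ ≤ t₁) (x : ℝ) : Γ₁.X x t₀ = Γ₂.X x t₀ ∧ Γ₁.Y x t₀ = Γ₂.Y x t₀ := by
  have hmem : ∀ t ∈ Icc t₀ t₁, t ∈ Ioo 0 S := fun t h => ⟨ht₀.trans_le h.1, h.2.trans_lt ht₁.2⟩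
  have dX : ∀ x, dx Γ₁.X x t₁ = dx Γ₂.X x t₁ := dx_congr hX
  have dY : ∀ x, dx Γ₁.Y x t₁ = dx Γ₂.Y x t₁ := dx_congr hY
  have ddX : ∀ x, dx (dx Γ₁.X) x t₁ = dx (dx Γ₂.X) x t₁ := dx_congr dX
  have ddY : ∀ x, dx (dx Γ₁.Y) x t₁ = dx (dx Γ₂.Y) x t₁ := dx_congr dY
  have hh : ∀ x, Γ₁.h x t₁ = Γ₂.h x t₁ := fun x => by simp only [h, invSpeed, dX, dY]
  have hκ : ∀ x, Γ₁.κ x t₁ = Γ₂.κ x t₁ := fun x => by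
    simp only [κ, signedCurv, invSpeed, dX, dY, ddX, ddY]
  have hκh : ∀ t ∈ Icc t₀ t₁, ∀ x ∈ Ioo 0 L, Γ₁.κ x t = Γ₂.κ x t ∧ Γ₁.h x t = Γ₂.h x t :=
    fun t ht => backward_unique_curvature Γ₁ Γ₂ hL (hmem t ht).1 ht.2 ht₁.2 hκ hh
  have hDκ : ∀ t ∈ Icc t₀ t₁, ∀ x ∈ Ioo 0 L, Γ₁.D Γ₁.κ x t = Γ₂.D Γ₂.κ x t := by
    intro t ht x hx
    simp only [D, (hκh t ht x hx).2]
    congr 1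
    refine Filter.EventuallyEq.deriv_eq ?_
    filter_upwards [Ioo_mem_nhds hx.1 hx.2] with y hy using (hκh t ht y hy).1
  have hcs : ∀ x ∈ Ioo 0 L, ∀ t ∈ Icc t₀ t₁,
      (Γ₁.c x t - Γ₂.c x t) ^ 2 + (Γ₁.s x t - Γ₂.s x t) ^ 2 = 0 := by
    intro x hx t ht
    refine eqOn_zero_of_hasDerivAt_zero
      (f := fun t => (Γ₁.c x t - Γ₂.c x t) ^ 2 + (Γ₁.s x t - Γ₂.s x t) ^ 2) (b := t₁) ?_ ?_ ht
    · intro t ht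
      have hT := hmem t ht
      have := (((Γ₁.sm_c.hasDerivAt_t hT x).fun_sub (Γ₂.sm_c.hasDerivAt_t hT x)).fun_pow 2).fun_add
        (((Γ₁.sm_s.hasDerivAt_t hT x).fun_sub (Γ₂.sm_s.hasDerivAt_t hT x)).fun_pow 2)
      refine this.congr_deriv ?_
      rw [Γ₁.dt_c hT, Γ₂.dt_c hT, Γ₁.dt_s hT, Γ₂.dt_s hT, hDκ t ht x hx]
      push_cast; ring
    · simp only [c, s, hh, dX, dY]; ring
  have hXY : ∀ x ∈ Ioo 0 L, Γ₁.X x t₀ - Γ₂.X x t₀ = 0 ∧ Γ₁.Y x t₀ - Γ₂.Y x t₀ = 0 := by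
    intro x hx
    have h0 := left_mem_Icc.2 h01
    constructor
    · refine eqOn_zero_of_hasDerivAt_zero
        (f := fun t => Γ₁.X x t - Γ₂.X x t) (b := t₁) (fun t ht => ?_) (by simp only [hX, sub_self]) h0
      have hT := hmem t ht
      refine ((Γ₁.smX.hasDerivAt_t hT x).fun_sub (Γ₂.smX.hasDerivAt_t hT x)).congr_deriv ?_
      have : Γ₁.s x t = Γ₂.s x t := by nlinarith [hcs x hx t ht, sq_nonneg (Γ₁.c x t - Γ₂.c x t)]
      rw [Γ₁.dt_X hT, Γ₂.dt_X hT, (hκh t ht x hx).1, this, sub_self]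
    · refine eqOn_zero_of_hasDerivAt_zero
        (f := fun t => Γ₁.Y x t - Γ₂.Y x t) (b := t₁) (fun t ht => ?_) (by simp only [hY, sub_self]) h0
      have hT := hmem t ht
      refine ((Γ₁.smY.hasDerivAt_t hT x).fun_sub (Γ₂.smY.hasDerivAt_t hT x)).congr_deriv ?_
      have : Γ₁.c x t = Γ₂.c x t := by nlinarith [hcs x hx t ht, sq_nonneg (Γ₁.s x t - Γ₂.s x t)]
      rw [Γ₁.dt_Y hT, Γ₂.dt_Y hT, (hκh t ht x hx).1, this, sub_self]
  have hT := hmem t₀ (left_mem_Icc.2 h01)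
  have hext : ∀ f : ℝ → ℝ, Continuous f → Function.Periodic f L → (∀ x ∈ Ioo 0 L, f x = 0) →
      ∀ x, f x = 0 := by
    intro f hf hp h0 x
    obtain ⟨y, hy, hxy⟩ := hp.exists_mem_Ico₀ hL x
    rw [hxy]
    have hcl : closure (Ioo 0 L) ⊆ f ⁻¹' {0} :=
      closure_minimal (fun x hx => h0 x hx) (isClosed_singleton.preimage hf)
    rw [closure_Ioo hL.ne] at hcl
    exact hcl ⟨hy.1, hy.2.le⟩
  constructor
  · refine sub_eq_zero.1 (hext (fun x => Γ₁.X x t₀ - Γ₂.X x t₀)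
      ((Γ₁.smX.sub Γ₂.smX).continuous_x hT) (fun x => ?_) (fun x hx => (hXY x hx).1) x)
    simp only [Γ₁.perX x t₀ hT, Γ₂.perX x t₀ hT]
  · refine sub_eq_zero.1 (hext (fun x => Γ₁.Y x t₀ - Γ₂.Y x t₀)
      ((Γ₁.smY.sub Γ₂.smY).continuous_x hT) (fun x => ?_) (fun x hx => (hXY x hx).2) x)
    simp only [Γ₁.perY x t₀ hT, Γ₂.perY x t₀ hT]

end NormalFlow

lemma touching_inequality {w₁ w₂ c₁ s₁ c₂ s₂ G h hx Φ Φx Φxx Φt : ℝ}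
    (h₁ : c₁ ^ 2 + s₁ ^ 2 = 1) (h₂ : c₂ ^ 2 + s₂ ^ 2 = 1) (hw : w₁ ^ 2 + w₂ ^ 2 = Φ) (hΦ : 0 < Φ)
    (hT₂ : w₁ * c₂ + w₂ * s₂ = 0) (hT₁ : 2 * (w₁ * c₁ + w₂ * s₁) = h * Φx)
    (hG : ∀ σ : ℝ, σ = 1 ∨ σ = -1 →
      0 ≤ 2 * ((c₁ - σ * c₂) ^ 2 + (s₁ - σ * s₂) ^ 2) + G - h * hx * Φx - h ^ 2 * Φxx)
    (ht : G ≤ Φt) (hm : h ^ 2 * Φx ^ 2 ≤ 3 * Φ) :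
    (h ^ 2 * Φxx + h * hx * Φx) * Φ - 2 / 3 * (h ^ 2 * Φx ^ 2) ≤ Φt * Φ := by
  set q := c₁ * c₂ + s₁ * s₂ with hq
  set k := c₁ * s₂ - s₁ * c₂ with hk
  have hqk : q ^ 2 + k ^ 2 = 1 := by
    rw [hq, hk]; linear_combination (c₂ ^ 2 + s₂ ^ 2) * h₁ + h₂
  have hkΦ : 4 * (k ^ 2 * Φ) = h ^ 2 * Φx ^ 2 := by
    have e1 : w₁ * c₁ + w₂ * s₁ = (w₁ * s₂ - w₂ * c₂) * k := by
      rw [hk]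
      linear_combination (-(w₁ * c₁ + w₂ * s₁)) * h₂ + (c₁ * c₂ + s₁ * s₂) * hT₂
    have e2 : (w₁ * s₂ - w₂ * c₂) ^ 2 = Φ := by
      linear_combination (c₂ ^ 2 + s₂ ^ 2) * hw + Φ * h₂ - (w₁ * c₂ + w₂ * s₂) * hT₂
    rw [← mul_pow, ← hT₁, e1, ← e2]; ring
  have hk2 : k ^ 2 ≤ 3 / 4 := by
    by_contra! hlt
    nlinarith
  have hqabs : 1 - 2 / 3 * k ^ 2 ≤ |q| := by
    refine abs_le_of_sq_le_sq' ?_ (abs_nonneg q) |>.2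
    rw [sq_abs]
    nlinarith [sq_nonneg k]
  have hmain : h ^ 2 * Φxx + h * hx * Φx - 8 / 3 * k ^ 2 ≤ Φt := by
    rcases le_total 0 q with h0 | h0
    · rw [abs_of_nonneg h0] at hqabs
      have := hG 1 (Or.inl rfl)
      have e : (c₁ - 1 * c₂) ^ 2 + (s₁ - 1 * s₂) ^ 2 = 2 - 2 * q := by
        rw [hq]; linear_combination h₁ + h₂
      rw [e] at this; linarith
    · rw [abs_of_nonpos h0] at hqabs
      have := hG (-1) (Or.inr rfl)
      have e : (c₁ - -1 * c₂) ^ 2 + (s₁ - -1 * s₂) ^ 2 = 2 + 2 * q := by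
        rw [hq]; linear_combination h₁ + h₂
      rw [e] at this; linarith
  have := mul_le_mul_of_nonneg_right hmain hΦ.le
  nlinarith

lemma barrier_inequality {δ K ξ ρ r h hx : ℝ} (hδ : 0 < δ) (hr : 0 < r) (hρ : ρ = r ^ 2 - ξ ^ 2)
    (hρ0 : 0 < ρ) (hh : 0 < h) (hK : 8 * hx ^ 2 + 10 * h ^ 2 / r ^ 2 ≤ K) :
    -K * (δ * ρ ^ 4) * (δ * ρ ^ 4) <
      (h ^ 2 * (δ * (48 * ξ ^ 2 * ρ ^ 2 - 8 * ρ ^ 3)) + h * hx * (-8 * δ * ξ * ρ ^ 3)) * (δ * ρ ^ 4)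
        - 2 / 3 * (h ^ 2 * (-8 * δ * ξ * ρ ^ 3) ^ 2) := by
  have key : 0 < K * ρ ^ 2 + h ^ 2 * (16 / 3 * ξ ^ 2 - 8 * ρ) - 8 * h * hx * ξ * ρ := by
    have h1 : (8 * hx ^ 2 + 10 * h ^ 2 / r ^ 2) * ρ ^ 2 ≤ K * ρ ^ 2 := by gcongr
    have h2 : 8 * h * hx * ξ * ρ ≤ 2 * h ^ 2 * ξ ^ 2 + 8 * hx ^ 2 * ρ ^ 2 := by
      nlinarith [sq_nonneg (h * ξ - 2 * (hx * ρ))]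
    have h3 : 0 < 10 * h ^ 2 / r ^ 2 * ρ ^ 2 + h ^ 2 * (10 / 3 * ξ ^ 2 - 8 * ρ) := by
      have e : 10 * h ^ 2 / r ^ 2 * ρ ^ 2 + h ^ 2 * (10 / 3 * ξ ^ 2 - 8 * ρ)
          = h ^ 2 / r ^ 2 * (10 * ρ ^ 2 - 34 / 3 * ρ * r ^ 2 + 10 / 3 * (r ^ 2) ^ 2) := by
        have : ξ ^ 2 = r ^ 2 - ρ := by linarith
        rw [this]; field_simp; ring
      rw [e]
      have : 0 < r ^ 2 := by positivity
      have : 0 < 10 * ρ ^ 2 - 34 / 3 * ρ * r ^ 2 + 10 / 3 * (r ^ 2) ^ 2 := by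
        nlinarith [sq_nonneg (ρ - 17 / 30 * r ^ 2)]
      positivity
    linarith
  have hp : 0 < δ ^ 2 * ρ ^ 6 := by positivity
  have := mul_pos hp key
  nlinarith

namespace NormalFlow
variable {S L₁ L₂ : ℝ}

/-- The squared distance between points of two flows. -/
def sqDist (Γ₁ : NormalFlow S L₁) (Γ₂ : NormalFlow S L₂) (x y t : ℝ) : ℝ :=
  (Γ₁.X x t - Γ₂.X y t) ^ 2 + (Γ₁.Y x t - Γ₂.Y y t) ^ 2

variable (Γ₁ : NormalFlow S L₁) (Γ₂ : NormalFlow S L₂)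

lemma hasDerivAt_sqDist_t {t : ℝ} (ht : t ∈ Ioo 0 S) (x y : ℝ) :
    HasDerivAt (fun t => sqDist Γ₁ Γ₂ x y t)
      (2 * ((Γ₁.X x t - Γ₂.X y t) * (-(Γ₁.κ x t * Γ₁.s x t) + Γ₂.κ y t * Γ₂.s y t)
        + (Γ₁.Y x t - Γ₂.Y y t) * (Γ₁.κ x t * Γ₁.c x t - Γ₂.κ y t * Γ₂.c y t))) t := by
  have := (((Γ₁.smX.hasDerivAt_t ht x).fun_sub (Γ₂.smX.hasDerivAt_t ht y)).fun_pow 2).fun_add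
    (((Γ₁.smY.hasDerivAt_t ht x).fun_sub (Γ₂.smY.hasDerivAt_t ht y)).fun_pow 2)
  refine this.congr_deriv ?_
  rw [Γ₁.dt_X ht, Γ₂.dt_X ht, Γ₁.dt_Y ht, Γ₂.dt_Y ht]
  push_cast; ring

lemma hasDerivAt_comp_line {f : ℝ → ℝ → ℝ} (hf : StripSmooth S f) {t : ℝ} (ht : t ∈ Ioo 0 S)
    (x v τ : ℝ) : HasDerivAt (fun τ => f (x + v * τ) t) (v * dx f (x + v * τ) t) τ := by
  have := (hf.hasDerivAt_x ht (x + v * τ)).comp τ (((hasDerivAt_id τ).const_mul v).const_add x)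
  refine this.congr_deriv ?_
  simp only [mul_one, mul_comm]

lemma h_sq_mul_dx_dx_X (Γ : NormalFlow S L₁) {t : ℝ} (ht : t ∈ Ioo 0 S) (x : ℝ) :
    Γ.h x t ^ 2 * dx (dx Γ.X) x t = -(Γ.κ x t * Γ.s x t) - dx Γ.h x t * Γ.c x t := by
  have h1 := Γ.dx_c (x := x) ht
  have h2 : dx Γ.c x t = _ := dx_mul Γ.sm_h Γ.smX.dx ht x
  rw [h2] at h1
  simp only [s, c]
  linear_combination Γ.h x t * h1

lemma h_sq_mul_dx_dx_Y (Γ : NormalFlow S L₁) {t : ℝ} (ht : t ∈ Ioo 0 S) (x : ℝ) :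
    Γ.h x t ^ 2 * dx (dx Γ.Y) x t = Γ.κ x t * Γ.c x t - dx Γ.h x t * Γ.s x t := by
  have h1 := Γ.dx_s (x := x) ht
  have h2 : dx Γ.s x t = _ := dx_mul Γ.sm_h Γ.smY.dx ht x
  rw [h2] at h1
  simp only [s, c]
  linear_combination Γ.h x t * h1

end NormalFlow

lemma second_deriv_test_isLocalMin {f f' : ℝ → ℝ} {f'' x : ℝ} (hf : ∀ y, HasDerivAt f (f' y) y)
    (hf' : HasDerivAt f' f'' x) (h : IsLocalMin f x) : f' x = 0 ∧ 0 ≤ f'' := by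
  refine ⟨h.hasDerivAt_eq_zero (hf x), ?_⟩
  have h1 := deriv_deriv_nonpos_of_isLocalMax (f := fun y => -f y) h.neg
    (hf x).continuousAt.neg
  have h2 : deriv (fun y => -f y) = fun y => -f' y := funext fun y => (hf y).fun_neg.deriv
  rw [h2, hf'.fun_neg.deriv] at h1
  linarith

lemma HasDerivAt.nonpos_of_left {f : ℝ → ℝ} {f' a t : ℝ} (hf : HasDerivAt f f' t) (hat : a < t)
    (h : ∀ s ∈ Ioo a t, f t ≤ f s) : f' ≤ 0 := by
  have h1 := hf.tendsto_slope.mono_left (nhdsLT_le_nhdsNE t)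
  refine le_of_tendsto h1 ?_
  filter_upwards [Ioo_mem_nhdsLT hat] with s hs
  rw [slope_def_field]
  exact div_nonpos_of_nonneg_of_nonpos (sub_nonneg.2 (h s hs)) (sub_nonpos.2 hs.2.le)

namespace NormalFlow
variable {S L₁ L₂ : ℝ} (Γ₁ : NormalFlow S L₁) (Γ₂ : NormalFlow S L₂)

lemma sqDist_second_deriv_test {t x y : ℝ} (ht : t ∈ Ioo 0 S) {Φ Φ' : ℝ → ℝ} {Φ'' : ℝ}
    (hΦ : ∀ z, HasDerivAt Φ (Φ' z) z) (hΦ' : HasDerivAt Φ' Φ'' x)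
    (hmin : ∀ᶠ z in 𝓝 x, ∀ w, sqDist Γ₁ Γ₂ x y t - Φ x ≤ sqDist Γ₁ Γ₂ z w t - Φ z) (v₁ v₂ : ℝ) :
    2 * ((Γ₁.X x t - Γ₂.X y t) * (v₁ * dx Γ₁.X x t - v₂ * dx Γ₂.X y t)
      + (Γ₁.Y x t - Γ₂.Y y t) * (v₁ * dx Γ₁.Y x t - v₂ * dx Γ₂.Y y t)) - v₁ * Φ' x = 0 ∧
    0 ≤ 2 * ((v₁ * dx Γ₁.X x t - v₂ * dx Γ₂.X y t) ^ 2 + (v₁ * dx Γ₁.Y x t - v₂ * dx Γ₂.Y y t) ^ 2)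
      + 2 * ((Γ₁.X x t - Γ₂.X y t) * (v₁ ^ 2 * dx (dx Γ₁.X) x t - v₂ ^ 2 * dx (dx Γ₂.X) y t)
      + (Γ₁.Y x t - Γ₂.Y y t) * (v₁ ^ 2 * dx (dx Γ₁.Y) x t - v₂ ^ 2 * dx (dx Γ₂.Y) y t))
      - v₁ ^ 2 * Φ'' := by
  have hline : ∀ v x τ : ℝ, HasDerivAt (fun τ => x + v * τ) v τ := fun v x τ => by
    simpa using ((hasDerivAt_id τ).const_mul v).const_add x
  set f : ℝ → ℝ := fun τ => sqDist Γ₁ Γ₂ (x + v₁ * τ) (y + v₂ * τ) t - Φ (x + v₁ * τ)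
  set f' : ℝ → ℝ := fun τ =>
    2 * ((Γ₁.X (x + v₁ * τ) t - Γ₂.X (y + v₂ * τ) t)
        * (v₁ * dx Γ₁.X (x + v₁ * τ) t - v₂ * dx Γ₂.X (y + v₂ * τ) t)
      + (Γ₁.Y (x + v₁ * τ) t - Γ₂.Y (y + v₂ * τ) t)
        * (v₁ * dx Γ₁.Y (x + v₁ * τ) t - v₂ * dx Γ₂.Y (y + v₂ * τ) t)) - v₁ * Φ' (x + v₁ * τ)
  have hX : ∀ τ, HasDerivAt (fun τ => Γ₁.X (x + v₁ * τ) t - Γ₂.X (y + v₂ * τ) t)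
      (v₁ * dx Γ₁.X (x + v₁ * τ) t - v₂ * dx Γ₂.X (y + v₂ * τ) t) τ := fun τ =>
    (hasDerivAt_comp_line Γ₁.smX ht x v₁ τ).fun_sub (hasDerivAt_comp_line Γ₂.smX ht y v₂ τ)
  have hY : ∀ τ, HasDerivAt (fun τ => Γ₁.Y (x + v₁ * τ) t - Γ₂.Y (y + v₂ * τ) t)
      (v₁ * dx Γ₁.Y (x + v₁ * τ) t - v₂ * dx Γ₂.Y (y + v₂ * τ) t) τ := fun τ =>
    (hasDerivAt_comp_line Γ₁.smY ht x v₁ τ).fun_sub (hasDerivAt_comp_line Γ₂.smY ht y v₂ τ)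
  have hX' := ((hasDerivAt_comp_line Γ₁.smX.dx ht x v₁ 0).const_mul v₁).fun_sub
    ((hasDerivAt_comp_line Γ₂.smX.dx ht y v₂ 0).const_mul v₂)
  have hY' := ((hasDerivAt_comp_line Γ₁.smY.dx ht x v₁ 0).const_mul v₁).fun_sub
    ((hasDerivAt_comp_line Γ₂.smY.dx ht y v₂ 0).const_mul v₂)
  have hf : ∀ τ, HasDerivAt f (f' τ) τ := fun τ => by
    have := (((hX τ).fun_pow 2).fun_add ((hY τ).fun_pow 2)).fun_sub
      ((hΦ (x + v₁ * τ)).comp τ (hline v₁ x τ))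
    refine this.congr_deriv ?_
    simp only [f']
    push_cast; ring
  have hΦ0 : HasDerivAt Φ' Φ'' (x + v₁ * 0) := by simpa using hΦ'
  have hf' := ((((hX 0).fun_mul hX').fun_add ((hY 0).fun_mul hY')).const_mul 2).fun_sub
    ((hΦ0.comp 0 (hline v₁ x 0)).const_mul v₁)
  have hloc : IsLocalMin f 0 := by
    have hc : Tendsto (fun τ => x + v₁ * τ) (𝓝 0) (𝓝 x) := by
      simpa using (hline v₁ x 0).continuousAt.tendsto
    filter_upwards [hc.eventually hmin] with τ hτ
    have := hτ (y + v₂ * τ)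
    simpa [f] using this
  have := second_deriv_test_isLocalMin hf hf' hloc
  constructor
  · simpa [f'] using this.1
  · refine this.2.trans (le_of_eq ?_)
    simp only [mul_zero, add_zero]
    ring

lemma sqDist_periodic {t : ℝ} (ht : t ∈ Ioo 0 S) (x : ℝ) :
    Function.Periodic (fun y => sqDist Γ₁ Γ₂ x y t) L₂ := fun y => by
  simp only [sqDist, Γ₂.perX y t ht, Γ₂.perY y t ht]

set_option maxHeartbeats 400000 in
lemma touching_barrier_false {x₀ r ε K t₀ t x y : ℝ} (hr : 0 < r) (hε : 0 < ε) (ht : t ∈ Ioo 0 S)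
    (ht₀ : t₀ < t) (hx : x ∈ Ioo (x₀ - r) (x₀ + r))
    (hK : 8 * dx Γ₁.h x t ^ 2 + 10 * Γ₁.h x t ^ 2 / r ^ 2 ≤ K)
    (hεh : 64 * Γ₁.h x t ^ 2 * ε * r ^ 6 ≤ 3)
    (h0 : sqDist Γ₁ Γ₂ x y t = ε * exp (-(K * (t - t₀))) * (r ^ 2 - (x - x₀) ^ 2) ^ 4)
    (hmin : ∀ z ∈ Icc (x₀ - r) (x₀ + r), ∀ w,
      ε * exp (-(K * (t - t₀))) * (r ^ 2 - (z - x₀) ^ 2) ^ 4 ≤ sqDist Γ₁ Γ₂ z w t)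
    (hleft : ∀ s ∈ Ioo t₀ t,
      ε * exp (-(K * (s - t₀))) * (r ^ 2 - (x - x₀) ^ 2) ^ 4 ≤ sqDist Γ₁ Γ₂ x y s) : False := by
  have hh := Γ₁.h_pos (x := x) ht
  have hK0 : 0 ≤ K := le_trans (by positivity) hK
  set δ := ε * exp (-(K * (t - t₀))) with hδdef
  have hδ : 0 < δ := by positivity
  have hδε : δ ≤ ε := by
    rw [hδdef]
    refine mul_le_of_le_one_right hε.le (exp_le_one_iff.2 ?_)
    have := mul_nonneg hK0 (sub_nonneg.2 ht₀.le)
    linarith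
  set ξ := x - x₀ with hξ
  set ρ := r ^ 2 - ξ ^ 2 with hρ
  have hξr : ξ ^ 2 < r ^ 2 := by
    refine sq_lt_sq' ?_ ?_ <;> linarith [hx.1, hx.2]
  have hρ0 : 0 < ρ := by linarith
  have hpoly : ∀ z, HasDerivAt (fun z => r ^ 2 - (z - x₀) ^ 2) (-(2 * (z - x₀))) z := fun z => by
    refine ((((hasDerivAt_id z).sub_const x₀).fun_pow 2).const_sub (r ^ 2)).congr_deriv ?_
    simp
  have hΦ : ∀ z, HasDerivAt (fun z => δ * (r ^ 2 - (z - x₀) ^ 2) ^ 4)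
      (-8 * δ * ((z - x₀) * (r ^ 2 - (z - x₀) ^ 2) ^ 3)) z := fun z => by
    refine (((hpoly z).fun_pow 4).const_mul δ).congr_deriv ?_
    push_cast; ring
  have hΦ' : HasDerivAt (fun z => -8 * δ * ((z - x₀) * (r ^ 2 - (z - x₀) ^ 2) ^ 3))
      (δ * (48 * ξ ^ 2 * ρ ^ 2 - 8 * ρ ^ 3)) x := by
    refine ((((hasDerivAt_id x).sub_const x₀).fun_mul ((hpoly x).fun_pow 3)).const_mul
      (-8 * δ)).congr_deriv ?_
    simp only [id, ← hξ, ← hρ]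
    push_cast; ring
  have htest := Γ₁.sqDist_second_deriv_test Γ₂ (y := y) ht hΦ hΦ' (by
    filter_upwards [Icc_mem_nhds hx.1 hx.2] with z hz w
    have := hmin z hz w
    simp only [← hξ, ← hρ, h0]
    linarith)
  have hft : HasDerivAt (fun s => ε * exp (-(K * (s - t₀))) * ρ ^ 4) (-K * (δ * ρ ^ 4)) t := by
    have := (((((hasDerivAt_id t).sub_const t₀).const_mul K).fun_neg.exp).const_mul ε).mul_const
      (ρ ^ 4)
    refine this.congr_deriv ?_
    simp only [id, hδdef]; ring
  have htime := HasDerivAt.nonpos_of_left ((hasDerivAt_sqDist_t Γ₁ Γ₂ ht x y).fun_sub hft) ht₀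
    (fun s hs => by
      have := hleft s hs
      rw [h0]; linarith)
  have e1 := (htest 0 1).1
  have e2 := (htest 1 0).1
  have e3 := fun σ : ℝ => (htest (Γ₁.h x t) (σ * Γ₂.h y t)).2
  have f1 := Γ₁.h_sq_mul_dx_dx_X ht x
  have f2 := Γ₁.h_sq_mul_dx_dx_Y ht x
  have f3 := Γ₂.h_sq_mul_dx_dx_X ht y
  have f4 := Γ₂.h_sq_mul_dx_dx_Y ht y
  have g2 : (Γ₁.X x t - Γ₂.X y t) * Γ₂.c y t + (Γ₁.Y x t - Γ₂.Y y t) * Γ₂.s y t = 0 := by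
    simp only [c, s]; linear_combination (-(1 / 2) * Γ₂.h y t) * e1
  have g1 : 2 * ((Γ₁.X x t - Γ₂.X y t) * Γ₁.c x t + (Γ₁.Y x t - Γ₂.Y y t) * Γ₁.s x t)
      = Γ₁.h x t * (-8 * δ * ξ * ρ ^ 3) := by
    simp only [c, s]; linear_combination Γ₁.h x t * e2
  have hm : Γ₁.h x t ^ 2 * (-8 * δ * ξ * ρ ^ 3) ^ 2 ≤ 3 * (δ * ρ ^ 4) := by
    have i1 : 64 * Γ₁.h x t ^ 2 * δ * (ξ ^ 2 * ρ ^ 2) ≤ 3 := by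
      refine le_trans ?_ hεh
      have : ξ ^ 2 * ρ ^ 2 ≤ r ^ 6 := by
        calc ξ ^ 2 * ρ ^ 2 ≤ r ^ 2 * (r ^ 2) ^ 2 := by
              gcongr; linarith [sq_nonneg ξ]
          _ = r ^ 6 := by ring
      calc _ ≤ 64 * Γ₁.h x t ^ 2 * ε * r ^ 6 := by gcongr
        _ = _ := rfl
    have := mul_le_mul_of_nonneg_right i1 (by positivity : 0 ≤ δ * ρ ^ 4)
    refine le_trans (le_of_eq ?_) this
    ring
  have hlow := touching_inequality (Γ₁.c_sq_add_s_sq (x := x) ht) (Γ₂.c_sq_add_s_sq (x := y) ht)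
    (w₁ := Γ₁.X x t - Γ₂.X y t) (w₂ := Γ₁.Y x t - Γ₂.Y y t) (h0) (by positivity) g2 g1
    (hx := dx Γ₁.h x t) (Φxx := δ * (48 * ξ ^ 2 * ρ ^ 2 - 8 * ρ ^ 3))
    (G := 2 * ((Γ₁.X x t - Γ₂.X y t) * (-(Γ₁.κ x t * Γ₁.s x t) + Γ₂.κ y t * Γ₂.s y t)
        + (Γ₁.Y x t - Γ₂.Y y t) * (Γ₁.κ x t * Γ₁.c x t - Γ₂.κ y t * Γ₂.c y t)))
    (fun σ hσ => by
      have hσ2 : σ ^ 2 = 1 := by rcases hσ with rfl | rfl <;> norm_num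
      refine (e3 σ).trans (le_of_eq ?_)
      rw [mul_pow, hσ2, one_mul, f1, f2, f3, f4]
      have i1 : Γ₁.h x t * dx Γ₁.X x t = Γ₁.c x t := rfl
      have i2 : Γ₁.h x t * dx Γ₁.Y x t = Γ₁.s x t := rfl
      have i3 : σ * Γ₂.h y t * dx Γ₂.X y t = σ * Γ₂.c y t := mul_assoc _ _ _
      have i4 : σ * Γ₂.h y t * dx Γ₂.Y y t = σ * Γ₂.s y t := mul_assoc _ _ _
      rw [i1, i2, i3, i4]
      linear_combination (-dx Γ₁.h x t) * g1 + 2 * dx Γ₂.h y t * g2)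
    (Φt := -K * (δ * ρ ^ 4)) (by linarith) hm
  exact absurd (barrier_inequality hδ hr hρ hρ0 hh hK) (not_lt.2 hlow)

/-- Intersections of two flows do not appear out of nothing. -/
theorem no_birth (hL₂ : 0 < L₂) {x₀ y₀ t₁ t₀ r : ℝ} (ht₁ : t₁ < S) (ht₀ : 0 < t₀) (h01 : t₀ < t₁)
    (hr : 0 < r) (h : sqDist Γ₁ Γ₂ x₀ y₀ t₁ = 0) :
    ∃ t ∈ Ico t₀ t₁, ∃ x ∈ Icc (x₀ - r) (x₀ + r), ∃ y, sqDist Γ₁ Γ₂ x y t = 0 := by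
  by_contra! hne
  have hmem : ∀ t ∈ Icc t₀ t₁, t ∈ Ioo 0 S := fun t h => ⟨ht₀.trans_le h.1, h.2.trans_lt ht₁⟩
  have hpos : ∀ t ∈ Ico t₀ t₁, ∀ x ∈ Icc (x₀ - r) (x₀ + r), ∀ y, 0 < sqDist Γ₁ Γ₂ x y t :=
    fun t ht x hx y => lt_of_le_of_ne (by simp only [sqDist]; positivity) (hne t ht x hx y).symm
  obtain ⟨H₁, hH₁, hb₁⟩ := Γ₁.sm_h.exists_bound (a := x₀ - r) (b := x₀ + r) ht₀ ht₁
  obtain ⟨H₂, hH₂, hb₂⟩ := Γ₁.sm_h.dx.exists_bound (a := x₀ - r) (b := x₀ + r) ht₀ ht₁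
  set K := 8 * H₂ ^ 2 + 10 * H₁ ^ 2 / r ^ 2 with hK
  have hcont : ContinuousOn (fun p : ℝ × ℝ × ℝ => sqDist Γ₁ Γ₂ p.1 p.2.1 p.2.2)
      (univ ×ˢ univ ×ˢ Ioo 0 S) := by
    have k1 : ∀ {f : ℝ → ℝ → ℝ}, StripSmooth S f →
        ContinuousOn (fun p : ℝ × ℝ × ℝ => f p.1 p.2.2) (univ ×ˢ univ ×ˢ Ioo 0 S) := fun hf =>
      hf.continuousOn.comp (f := fun p : ℝ × ℝ × ℝ => (p.1, p.2.2)) (by fun_prop)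
        fun p hp => ⟨mem_univ _, hp.2.2⟩
    have k2 : ∀ {f : ℝ → ℝ → ℝ}, StripSmooth S f →
        ContinuousOn (fun p : ℝ × ℝ × ℝ => f p.2.1 p.2.2) (univ ×ˢ univ ×ˢ Ioo 0 S) := fun hf =>
      hf.continuousOn.comp (f := fun p : ℝ × ℝ × ℝ => (p.2.1, p.2.2)) (by fun_prop)
        fun p hp => ⟨mem_univ _, hp.2.2⟩
    exact (((k1 Γ₁.smX).sub (k2 Γ₂.smX)).pow 2).add (((k1 Γ₁.smY).sub (k2 Γ₂.smY)).pow 2)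
  obtain ⟨m, hm0, hm⟩ : ∃ m, 0 < m ∧ ∀ x ∈ Icc (x₀ - r) (x₀ + r), ∀ y ∈ Icc 0 L₂,
      m ≤ sqDist Γ₁ Γ₂ x y t₀ := by
    have hc : ContinuousOn (fun p : ℝ × ℝ => sqDist Γ₁ Γ₂ p.1 p.2 t₀)
        (Icc (x₀ - r) (x₀ + r) ×ˢ Icc 0 L₂) :=
      hcont.comp (f := fun p : ℝ × ℝ => (p.1, p.2, t₀)) (by fun_prop)
        fun p hp => ⟨mem_univ _, mem_univ _, hmem t₀ (left_mem_Icc.2 h01.le)⟩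
    obtain ⟨p, hp, hmin⟩ := (isCompact_Icc.prod isCompact_Icc).exists_isMinOn
      ⟨(x₀, 0), ⟨by linarith, by linarith⟩, ⟨le_rfl, hL₂.le⟩⟩ hc
    exact ⟨_, hpos t₀ (left_mem_Ico.2 h01) p.1 hp.1 p.2, fun x hx y hy => isMinOn_iff.1 hmin (x, y) ⟨hx, hy⟩⟩
  obtain ⟨ε, hε, hεm, hεh⟩ : ∃ ε, 0 < ε ∧ ε * r ^ 8 < m ∧ 64 * H₁ ^ 2 * ε * r ^ 6 ≤ 3 := by
    refine ⟨min (m / (2 * r ^ 8)) (3 / (64 * H₁ ^ 2 * r ^ 6)), by positivity, ?_, ?_⟩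
    · calc _ ≤ m / (2 * r ^ 8) * r ^ 8 := by gcongr; exact min_le_left _ _
        _ = m / 2 := by field_simp
        _ < m := by linarith
    · calc _ ≤ 64 * H₁ ^ 2 * (3 / (64 * H₁ ^ 2 * r ^ 6)) * r ^ 6 := by
            gcongr; exact min_le_right _ _
        _ = 3 := by field_simp
        _ ≤ 3 := le_rfl
  have hρ : ∀ x ∈ Icc (x₀ - r) (x₀ + r), 0 ≤ r ^ 2 - (x - x₀) ^ 2 := fun x hx => by
    have : (x - x₀) ^ 2 ≤ r ^ 2 := by
      refine sq_le_sq' ?_ ?_ <;> linarith [hx.1, hx.2]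
    linarith
  set Φ : ℝ → ℝ → ℝ := fun x t => ε * exp (-(K * (t - t₀))) * (r ^ 2 - (x - x₀) ^ 2) ^ 4 with hΦ
  have hΦ0 : ∀ x ∈ Icc (x₀ - r) (x₀ + r), ∀ y, Φ x t₀ < sqDist Γ₁ Γ₂ x y t₀ := by
    intro x hx y
    obtain ⟨z, hz, hyz⟩ := (Γ₁.sqDist_periodic Γ₂
      (hmem t₀ (left_mem_Icc.2 h01.le)) x).exists_mem_Ico₀ hL₂ y
    rw [hyz]
    refine lt_of_lt_of_le ?_ (hm x hx z ⟨hz.1, hz.2.le⟩)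
    calc Φ x t₀ = ε * (r ^ 2 - (x - x₀) ^ 2) ^ 4 := by simp [hΦ]
      _ ≤ ε * (r ^ 2) ^ 4 := by
        have := hρ x hx
        gcongr; linarith [sq_nonneg (x - x₀)]
      _ < m := by rw [← pow_mul]; exact hεm
  have hbar : ∀ t' ∈ Ioo t₀ t₁, Φ x₀ t' ≤ sqDist Γ₁ Γ₂ x₀ y₀ t' := by
    intro t' ht'
    by_contra! hlt
    set Q : Set (ℝ × ℝ × ℝ) := (Icc (x₀ - r) (x₀ + r) ×ˢ Icc 0 L₂ ×ˢ Icc t₀ t')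
      ∩ (fun p => sqDist Γ₁ Γ₂ p.1 p.2.1 p.2.2 - Φ p.1 p.2.2) ⁻¹' Iic 0
    have hbox : IsCompact (Icc (x₀ - r) (x₀ + r) ×ˢ Icc 0 L₂ ×ˢ Icc t₀ t') :=
      isCompact_Icc.prod (isCompact_Icc.prod isCompact_Icc)
    have hQ : IsCompact Q := by
      refine hbox.of_isClosed_subset (ContinuousOn.preimage_isClosed_of_isClosed ?_ hbox.isClosed
        isClosed_Iic) inter_subset_left
      refine (hcont.mono fun p hp => ⟨mem_univ _, mem_univ _,
        hmem _ ⟨hp.2.2.1, hp.2.2.2.trans ht'.2.le⟩⟩).sub (Continuous.continuousOn ?_)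
      simp only [hΦ]; fun_prop
    have hQne : Q.Nonempty := by
      obtain ⟨z, hz, hyz⟩ := (Γ₁.sqDist_periodic Γ₂
        (hmem t' (Ioo_subset_Icc_self ht')) x₀).exists_mem_Ico₀ hL₂ y₀
      refine ⟨(x₀, z, t'), ⟨⟨by linarith, by linarith⟩, ⟨hz.1, hz.2.le⟩, ⟨ht'.1.le, le_rfl⟩⟩, ?_⟩
      have : sqDist Γ₁ Γ₂ x₀ y₀ t' = sqDist Γ₁ Γ₂ x₀ z t' := hyz
      show sqDist Γ₁ Γ₂ x₀ z t' - Φ x₀ t' ≤ 0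
      linarith
    obtain ⟨⟨x, y, t⟩, ⟨⟨hx, hy, ht⟩, hle⟩, hfirst⟩ :=
      hQ.exists_isMinOn hQne (f := fun p => p.2.2) (by fun_prop)
    dsimp only at hx hy ht hfirst
    have hle : sqDist Γ₁ Γ₂ x y t - Φ x t ≤ 0 := hle
    have hT : t ∈ Ioo 0 S := hmem t ⟨ht.1, ht.2.trans ht'.2.le⟩
    have hbefore : ∀ s ∈ Ico t₀ t, ∀ z ∈ Icc (x₀ - r) (x₀ + r), ∀ w,
        Φ z s < sqDist Γ₁ Γ₂ z w s := by
      intro s hs z hz w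
      by_contra! hcon
      obtain ⟨w', hw', hww⟩ := (Γ₁.sqDist_periodic Γ₂
        (hmem s ⟨hs.1, hs.2.le.trans (ht.2.trans ht'.2.le)⟩) z).exists_mem_Ico₀ hL₂ w
      have hww : sqDist Γ₁ Γ₂ z w s = sqDist Γ₁ Γ₂ z w' s := hww
      have hin : (z, w', s) ∈ Q := ⟨⟨hz, ⟨hw'.1, hw'.2.le⟩, ⟨hs.1, hs.2.le.trans ht.2⟩⟩,
        show sqDist Γ₁ Γ₂ z w' s - Φ z s ≤ 0 by linarith⟩
      exact absurd (hfirst hin) (not_le.2 hs.2)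
    have ht0 : t₀ < t := lt_of_le_of_ne ht.1 (by
      rintro rfl
      linarith [hΦ0 x hx y])
    have hat : ∀ z ∈ Icc (x₀ - r) (x₀ + r), ∀ w, Φ z t ≤ sqDist Γ₁ Γ₂ z w t := by
      intro z hz w
      have c1 : ContinuousAt (fun s => sqDist Γ₁ Γ₂ z w s) t :=
        (hasDerivAt_sqDist_t Γ₁ Γ₂ hT z w).continuousAt
      have c2 : ContinuousAt (fun s => Φ z s) t := by
        refine Continuous.continuousAt ?_
        simp only [hΦ]; fun_prop
      refine le_of_tendsto_of_tendsto (c2.tendsto.mono_left nhdsWithin_le_nhds)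
        (c1.tendsto.mono_left nhdsWithin_le_nhds) (b := 𝓝[<] t) ?_
      filter_upwards [Ioo_mem_nhdsLT ht0] with s hs
      exact (hbefore s ⟨hs.1.le, hs.2⟩ z hz w).le
    have heq : sqDist Γ₁ Γ₂ x y t = Φ x t := le_antisymm (by linarith) (hat x hx y)
    have hΦpos : 0 < Φ x t := heq ▸ hpos t ⟨ht.1, ht.2.trans_lt ht'.2⟩ x hx y
    have hxi : x ∈ Ioo (x₀ - r) (x₀ + r) := by
      refine ⟨lt_of_le_of_ne hx.1 ?_, lt_of_le_of_ne hx.2 ?_⟩ <;> rintro rfl <;>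
        simp [hΦ] at hΦpos
    have htt : t ∈ Icc t₀ t₁ := ⟨ht.1, ht.2.trans ht'.2.le⟩
    have hh1 : Γ₁.h x t ^ 2 ≤ H₁ ^ 2 := by
      rw [← sq_abs]; exact pow_le_pow_left₀ (abs_nonneg _) (hb₁ x hx t htt) 2
    have hh2 : dx Γ₁.h x t ^ 2 ≤ H₂ ^ 2 := by
      rw [← sq_abs]; exact pow_le_pow_left₀ (abs_nonneg _) (hb₂ x hx t htt) 2
    exact touching_barrier_false Γ₁ Γ₂ hr hε hT ht0 hxi (by rw [hK]; gcongr)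
      (le_trans (by gcongr) hεh) heq hat (fun s hs => (hbefore s ⟨hs.1.le, hs.2⟩ x hx y).le)
  have hT₁ := hmem t₁ (right_mem_Icc.2 h01.le)
  have hlim : Φ x₀ t₁ ≤ sqDist Γ₁ Γ₂ x₀ y₀ t₁ := by
    have c1 : ContinuousAt (fun s => sqDist Γ₁ Γ₂ x₀ y₀ s) t₁ :=
      (hasDerivAt_sqDist_t Γ₁ Γ₂ hT₁ x₀ y₀).continuousAt
    have c2 : ContinuousAt (fun s => Φ x₀ s) t₁ := by
      refine Continuous.continuousAt ?_
      simp only [hΦ]; fun_prop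
    refine le_of_tendsto_of_tendsto (c2.tendsto.mono_left nhdsWithin_le_nhds)
      (c1.tendsto.mono_left nhdsWithin_le_nhds) (b := 𝓝[<] t₁) ?_
    filter_upwards [Ioo_mem_nhdsLT h01] with s hs using hbar s hs
  rw [h] at hlim
  refine absurd hlim (not_le.2 ?_)
  have : r ^ 2 - (0 : ℝ) ^ 2 = r ^ 2 := by ring
  simp only [hΦ, sub_self, this]
  positivity

end NormalFlow

lemma exists_smooth_left_inverse {f : ℝ → ℝ} {a f' : ℝ} (hf : ContDiff ℝ ∞ f)
    (hf' : HasDerivAt f f' a) (h0 : f' ≠ 0) :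
    ∃ ψ : ℝ → ℝ, ContDiffAt ℝ ∞ ψ (f a) ∧ ∀ᶠ x in 𝓝 a, ψ (f x) = x := by
  have hn : (∞ : WithTop ℕ∞) ≠ 0 := by simp
  have hF := hf'.hasFDerivAt_equiv h0
  refine ⟨hf.contDiffAt.localInverse hF hn, hf.contDiffAt.to_localInverse hF hn, ?_⟩
  exact (hf.contDiffAt.hasStrictFDerivAt' hF hn).eventually_left_inverse

lemma eq_one_or_neg_one_of_sq {a : ℝ} (h : a ^ 2 = 1) : a = 1 ∨ a = -1 :=
  sq_eq_sq_iff_eq_or_eq_neg.1 (by rw [h, one_pow])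

namespace NormalFlow
variable {S L₁ L₂ : ℝ}

/-- Lifting a piece of one arclength-parametrized flow through another. -/
lemma exists_continuous_lift (Γ₁ : NormalFlow S L₁) (Γ₂ : NormalFlow S L₂) (hL₂ : 0 < L₂) {t : ℝ}
    (ht : t ∈ Ioo 0 S) {x₀ y₀ : ℝ} (hX₀ : Γ₁.X x₀ t = Γ₂.X y₀ t) (hY₀ : Γ₁.Y x₀ t = Γ₂.Y y₀ t)
    (h : ∀ᶠ x in 𝓝 x₀, ∃ y, Γ₁.X x t = Γ₂.X y t ∧ Γ₁.Y x t = Γ₂.Y y t) :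
    ∃ g : ℝ → ℝ, Tendsto g (𝓝 x₀) (𝓝 y₀) ∧
      ∀ᶠ x in 𝓝 x₀, Γ₁.X x t = Γ₂.X (g x) t ∧ Γ₁.Y x t = Γ₂.Y (g x) t := by
  have hloc : ∀ x, ∃ y ∈ Icc (y₀ - L₂ / 2) (y₀ + L₂ / 2),
      (∃ y, Γ₁.X x t = Γ₂.X y t ∧ Γ₁.Y x t = Γ₂.Y y t) →
        Γ₁.X x t = Γ₂.X y t ∧ Γ₁.Y x t = Γ₂.Y y t := by
    intro x
    by_cases hx : ∃ y, Γ₁.X x t = Γ₂.X y t ∧ Γ₁.Y x t = Γ₂.Y y t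
    · obtain ⟨y, hy⟩ := hx
      obtain ⟨n, hn, -⟩ := existsUnique_add_zsmul_mem_Ico hL₂ y (y₀ - L₂ / 2)
      have pX : Function.Periodic (fun y => Γ₂.X y t) L₂ := fun y => Γ₂.perX y t ht
      have pY : Function.Periodic (fun y => Γ₂.Y y t) L₂ := fun y => Γ₂.perY y t ht
      refine ⟨y + n • L₂, ⟨hn.1, by linarith [hn.2]⟩, fun _ => ?_⟩
      have e1 := pX.zsmul n y
      have e2 := pY.zsmul n y
      rw [e1, e2]; exact hy
    · exact ⟨y₀, ⟨by linarith, by linarith⟩, fun h => absurd h hx⟩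
  choose g hgmem hg using hloc
  refine ⟨g, ?_, h.mono fun x hx => hg x hx⟩
  refine isCompact_Icc.tendsto_nhds_of_unique_mapClusterPt (.of_forall hgmem) fun y hy hc => ?_
  have key : ∀ {f₁ f₂ : ℝ → ℝ}, Continuous f₁ → Continuous f₂ →
      (∀ᶠ x in 𝓝 x₀, f₁ x = f₂ (g x)) → f₁ x₀ = f₂ y := by
    intro f₁ f₂ h₁ h₂ he
    have c1 : MapClusterPt (f₂ y) (𝓝 x₀) (f₂ ∘ g) := hc.continuousAt_comp h₂.continuousAt
    have c2 : Tendsto (f₂ ∘ g) (𝓝 x₀) (𝓝 (f₁ x₀)) := (h₁.tendsto x₀).congr' he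
    exact (eq_of_nhds_neBot (c1.clusterPt.mono c2 :)).symm
  have hX := key (Γ₁.smX.continuous_x ht) (Γ₂.smX.continuous_x ht) (h.mono fun x hx => (hg x hx).1)
  have hY := key (Γ₁.smY.continuous_x ht) (Γ₂.smY.continuous_x ht) (h.mono fun x hx => (hg x hx).2)
  obtain ⟨n, hn⟩ := Γ₂.inj t ht y₀ y (hX₀.symm.trans hX) (hY₀.symm.trans hY)
  have h1 : (n : ℝ) < 1 := by
    by_contra! h1
    have := mul_le_mul_of_nonneg_right h1 hL₂.le
    linarith [hy.2]
  have h2 : (-1 : ℝ) < n := by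
    by_contra! h1
    have := mul_le_mul_of_nonneg_right h1 hL₂.le
    linarith [hy.1]
  have : n = 0 := by
    have h1 : n < 1 := by exact_mod_cast h1
    have h2 : -1 < n := by exact_mod_cast h2
    omega
  simpa [this] using hn

/-- A local overlap of two arclength-parametrized curves is an affine reparametrization. -/
lemma exists_affine_of_eventually (Γ₁ : NormalFlow S L₁) (Γ₂ : NormalFlow S L₂) (hL₂ : 0 < L₂)
    {t : ℝ} (ht : t ∈ Ioo 0 S) (hh₁ : ∀ x, Γ₁.h x t = 1) (hh₂ : ∀ x, Γ₂.h x t = 1) {x₀ : ℝ}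
    (h : ∀ᶠ x in 𝓝 x₀, ∃ y, Γ₁.X x t = Γ₂.X y t ∧ Γ₁.Y x t = Γ₂.Y y t) :
    ∃ σ b : ℝ, (σ = 1 ∨ σ = -1) ∧
      ∀ᶠ x in 𝓝 x₀, Γ₁.X x t = Γ₂.X (σ * x + b) t ∧ Γ₁.Y x t = Γ₂.Y (σ * x + b) t := by
  obtain ⟨y₀, hX₀, hY₀⟩ := h.self_of_nhds
  obtain ⟨g, hg, he⟩ := exists_continuous_lift Γ₁ Γ₂ hL₂ ht hX₀ hY₀ h
  set A := dx Γ₂.X y₀ t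
  set B := dx Γ₂.Y y₀ t
  have hu : ∀ y, HasDerivAt (fun y => A * Γ₂.X y t + B * Γ₂.Y y t)
      (A * dx Γ₂.X y t + B * dx Γ₂.Y y t) y := fun y =>
    ((Γ₂.smX.hasDerivAt_x ht y).const_mul A).fun_add ((Γ₂.smY.hasDerivAt_x ht y).const_mul B)
  obtain ⟨ψ, hψ, hψu⟩ := exists_smooth_left_inverse
    ((contDiff_const.mul (Γ₂.smX.contDiff_x ht)).add (contDiff_const.mul (Γ₂.smY.contDiff_x ht)))
    (hu y₀) (by have := Γ₂.imm y₀ t ht; nlinarith)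
  have hgeq : g =ᶠ[𝓝 x₀] fun x => ψ (A * Γ₁.X x t + B * Γ₁.Y x t) := by
    filter_upwards [hg.eventually hψu, he] with x h1 h2
    rw [h2.1, h2.2, h1]
  have hgsm : ContDiffAt ℝ ∞ g x₀ := by
    refine ContDiffAt.congr_of_eventuallyEq ?_ hgeq
    refine ContDiffAt.comp (g := ψ) x₀ ?_ ((contDiff_const.mul (Γ₁.smX.contDiff_x ht)).add
      (contDiff_const.mul (Γ₁.smY.contDiff_x ht))).contDiffAt
    rw [hX₀, hY₀]; exact hψ
  have hgd : ∀ᶠ x in 𝓝 x₀, DifferentiableAt ℝ g x := by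
    filter_upwards [(hgsm.of_le (m := 1) (by simp)).eventually (by simp)] with x hx
    exact hx.differentiableAt (by simp)
  have hg' : ContinuousAt (deriv g) x₀ :=
    ((hgsm.fderiv_right (m := 0) (by simp)).clm_apply contDiffAt_const).continuousAt
  have hsq : ∀ᶠ x in 𝓝 x₀, deriv g x ^ 2 = 1 := by
    filter_upwards [hgd, he.eventually_nhds] with x hx hex
    have d1 : dx Γ₁.X x t = dx Γ₂.X (g x) t * deriv g x := by
      have := (Γ₂.smX.hasDerivAt_x ht (g x)).comp x hx.hasDerivAt
      exact ((Γ₁.smX.hasDerivAt_x ht x).congr_of_eventuallyEq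
        (hex.mono fun z hz => hz.1.symm)).unique this
    have d2 : dx Γ₁.Y x t = dx Γ₂.Y (g x) t * deriv g x := by
      have := (Γ₂.smY.hasDerivAt_x ht (g x)).comp x hx.hasDerivAt
      exact ((Γ₁.smY.hasDerivAt_x ht x).congr_of_eventuallyEq
        (hex.mono fun z hz => hz.2.symm)).unique this
    have s1 := Γ₁.h_sq (x := x) ht
    have s2 := Γ₂.h_sq (x := g x) ht
    rw [hh₁, d1, d2] at s1
    rw [hh₂] at s2
    linear_combination s1 - deriv g x ^ 2 * s2
  set σ := deriv g x₀ with hσ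
  have hσ2 : σ = 1 ∨ σ = -1 := eq_one_or_neg_one_of_sq hsq.self_of_nhds
  have hconst : ∀ᶠ x in 𝓝 x₀, deriv g x = σ := by
    filter_upwards [hsq, hg'.eventually (ball_mem_nhds _ one_pos)] with x h1 h2
    rw [Real.dist_eq, ← hσ, abs_lt] at h2
    rcases eq_one_or_neg_one_of_sq h1 with h | h <;> rcases hσ2 with h' | h' <;>
      simp only [h, h'] at h2 ⊢ <;> norm_num at h2
  refine ⟨σ, g x₀ - σ * x₀, hσ2, ?_⟩
  obtain ⟨ε, hε, hball⟩ := Metric.eventually_nhds_iff_ball.1 (hgd.and hconst)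
  filter_upwards [ball_mem_nhds x₀ hε, he] with x hx hex
  have hd : ∀ z ∈ ball x₀ ε, HasDerivAt (fun z => g z - σ * z) 0 z := fun z hz => by
    have := (hball z hz).1.hasDerivAt.fun_sub ((hasDerivAt_id z).const_mul σ)
    refine this.congr_deriv ?_
    rw [(hball z hz).2]; simp
  have := isOpen_ball.is_const_of_deriv_eq_zero (convex_ball x₀ ε).isPreconnected
    (fun z hz => (hd z hz).differentiableAt.differentiableWithinAt)
    (fun z hz => (hd z hz).deriv) hx (mem_ball_self hε)
  rw [show σ * x + (g x₀ - σ * x₀) = g x by linarith]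
  exact hex

/-- Two flows sharing an arc at time `t₁` trace out the same curves at all earlier times. -/
theorem forall_mem_of_common_arc (Γ₁ : NormalFlow S L₁) (Γ₂ : NormalFlow S L₂) (hL₁ : 0 < L₁)
    (hL₂ : 0 < L₂) {t₁ : ℝ} (ht₁ : t₁ ∈ Ioo 0 S) {a b : ℝ} (hab : a < b)
    (h : ∀ x ∈ Ioo a b, ∃ y, Γ₁.X x t₁ = Γ₂.X y t₁ ∧ Γ₁.Y x t₁ = Γ₂.Y y t₁) {t : ℝ} (ht : 0 < t)
    (htt : t ≤ t₁) (x : ℝ) : ∃ y, Γ₁.X x t = Γ₂.X y t ∧ Γ₁.Y x t = Γ₂.Y y t := by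
  obtain ⟨M₁, hM₁, Δ₁, hh₁, φ₁, hφ₁⟩ := Γ₁.exists_arclength hL₁ ht₁
  obtain ⟨M₂, hM₂, Δ₂, hh₂, φ₂, hφ₂⟩ := Γ₂.exists_arclength hL₂ ht₁
  obtain ⟨z, hz⟩ := exists_between hab
  have hev : ∀ᶠ x in 𝓝 (φ₁.symm z), ∃ y, Δ₁.X x t₁ = Δ₂.X y t₁ ∧ Δ₁.Y x t₁ = Δ₂.Y y t₁ := by
    have : ∀ᶠ x in 𝓝 (φ₁.symm z), φ₁ x ∈ Ioo a b :=
      φ₁.continuous.continuousAt.eventually (by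
        rw [φ₁.apply_symm_apply]; exact Ioo_mem_nhds hz.1 hz.2)
    filter_upwards [this] with x hx
    obtain ⟨y, hy⟩ := h _ hx
    refine ⟨φ₂.symm y, ?_⟩
    rw [(hφ₁ x t₁).1, (hφ₁ x t₁).2, (hφ₂ _ t₁).1, (hφ₂ _ t₁).2, φ₂.apply_symm_apply]
    exact hy
  obtain ⟨σ, c, hσ, hev⟩ := exists_affine_of_eventually Δ₁ Δ₂ hM₂ ht₁ hh₁ hh₂ hev
  obtain ⟨rfl, heq⟩ := eq_of_eventuallyEq Δ₁ (Δ₂.affine σ c hσ) hM₁ hM₂ ht₁ hh₁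
    (fun x => by rw [Δ₂.affine_h σ c hσ ht₁, hh₂]) hev
  have key := eq_of_eq_of_le Δ₁ (Δ₂.affine σ c hσ) hM₁ ht₁ (fun x => (heq x).1)
    (fun x => (heq x).2) ht htt (φ₁.symm x)
  rw [affine_X, affine_Y, (hφ₁ _ t).1, (hφ₁ _ t).2, (hφ₂ _ t).1, (hφ₂ _ t).2,
    φ₁.apply_symm_apply] at key
  exact ⟨_, key⟩

end NormalFlow

section Selection
variable {E : Type*} [MetricSpace E]

/-- One step of size less than `δ`, strictly backwards in time, inside `Z`. -/
def BackStep (Z : Set (E × ℝ)) (δ : ℝ) (z w : E × ℝ) : Prop :=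
  w ∈ Z ∧ w.2 < z.2 ∧ dist z w < δ

lemma BackStep.mono {Z : Set (E × ℝ)} {δ δ' : ℝ} (h : δ ≤ δ') {z w : E × ℝ}
    (hs : BackStep Z δ z w) : BackStep Z δ' z w :=
  ⟨hs.1, hs.2.1, hs.2.2.trans_le h⟩

/-- Every time slice of `Z` is totally separated. -/
def SlicesSeparated (Z : Set (E × ℝ)) : Prop :=
  ∀ t a b, (a, t) ∈ Z → (b, t) ∈ Z → a ≠ b → ∃ U V : Set E, IsOpen U ∧ IsOpen V ∧ Disjoint U V ∧
    (∀ p, (p, t) ∈ Z → p ∈ U ∪ V) ∧ a ∈ U ∧ b ∈ V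

variable {Z : Set (E × ℝ)}

lemma exists_ultralimit (hZ : IsCompact Z) {f : ℕ → E × ℝ} (hf : ∀ n, f n ∈ Z) :
    ∃ z ∈ Z, Tendsto f (hyperfilter ℕ) (𝓝 z) :=
  hZ.ultrafilter_le_nhds ((hyperfilter ℕ).map f) (by
    rw [Ultrafilter.coe_map, le_principal_iff]
    exact mem_map.2 (univ_mem' hf))

lemma tendsto_one_div_hyperfilter :
    Tendsto (fun n : ℕ => 1 / ((n : ℝ) + 1)) (hyperfilter ℕ) (𝓝 0) :=
  tendsto_one_div_add_atTop_nhds_zero_nat.mono_left Nat.hyperfilter_le_atTop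

lemma exists_stable_nhd (hZ : IsCompact Z) {t : ℝ} {U V : Set E} (hU : IsOpen U) (hV : IsOpen V)
    (hd : Disjoint U V) (hcov : ∀ p, (p, t) ∈ Z → p ∈ U ∪ V) :
    ∃ η > 0, ∀ z ∈ Z, ∀ w ∈ Z, |z.2 - t| < η → dist z w < η → z.1 ∈ U → w.1 ∈ U := by
  by_contra! hcon
  choose z hz w hw hzt hzw hzU hwU using fun n : ℕ => hcon (1 / ((n : ℝ) + 1)) (by positivity)
  obtain ⟨a, ha, hza⟩ := exists_ultralimit hZ hz
  have hwa : Tendsto w (hyperfilter ℕ) (𝓝 a) := by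
    refine (tendsto_iff_of_dist ?_).1 hza
    exact squeeze_zero (fun _ => dist_nonneg) (fun n => (hzw n).le) tendsto_one_div_hyperfilter
  have hat : a.2 = t := by
    refine tendsto_nhds_unique ((continuous_snd.tendsto a).comp hza) ?_
    refine tendsto_iff_dist_tendsto_zero.2 ?_
    exact squeeze_zero (fun _ => dist_nonneg) (fun n => (hzt n).le) tendsto_one_div_hyperfilter
  have h1 := (continuous_fst.tendsto a).comp hza
  have h2 := (continuous_fst.tendsto a).comp hwa
  rcases hcov a.1 (hat ▸ ha) with h | h
  · obtain ⟨n, hn⟩ := (h2.eventually (hU.mem_nhds h)).exists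
    exact hwU n hn
  · obtain ⟨n, hn⟩ := (h1.eventually (hV.mem_nhds h)).exists
    exact disjoint_left.1 hd (hzU n) hn

/-- Backward chains of small steps spanning a short time do not travel far. -/
lemma exists_chain_modulus (hZ : IsCompact Z) (hsep : SlicesSeparated Z) {ε : ℝ} (hε : 0 < ε) :
    ∃ δ > 0, ∀ z ∈ Z, ∀ w ∈ Z, Relation.ReflTransGen (BackStep Z δ) z w → z.2 - w.2 ≤ δ →
      dist z.1 w.1 < ε := by
  by_contra! hcon
  choose z hz w hw hchain htime hdist using
    fun n : ℕ => hcon (1 / ((n : ℝ) + 1)) (by positivity)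
  have hle : ∀ {δ : ℝ} {z w : E × ℝ}, Relation.ReflTransGen (BackStep Z δ) z w → w.2 ≤ z.2 := by
    intro δ z w h
    induction h with
    | refl => rfl
    | tail _ h ih => exact h.2.1.le.trans ih
  obtain ⟨a, ha, hza⟩ := exists_ultralimit hZ hz
  obtain ⟨b, hb, hwb⟩ := exists_ultralimit hZ hw
  have za1 := (continuous_fst.tendsto a).comp hza
  have za2 := (continuous_snd.tendsto a).comp hza
  have wb1 := (continuous_fst.tendsto b).comp hwb
  have wb2 := (continuous_snd.tendsto b).comp hwb
  have hab2 : b.2 = a.2 := by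
    have : Tendsto (fun n => (z n).2 - (w n).2) (hyperfilter ℕ) (𝓝 0) :=
      squeeze_zero (fun n => sub_nonneg.2 (hle (hchain n))) htime tendsto_one_div_hyperfilter
    linarith [tendsto_nhds_unique this (za2.sub wb2)]
  have hab1 : a.1 ≠ b.1 := by
    have : ε ≤ dist a.1 b.1 := ge_of_tendsto (za1.dist wb1) (.of_forall hdist)
    exact dist_pos.1 (hε.trans_le this)
  obtain ⟨U, V, hU, hV, hd, hcov, haU, hbV⟩ := hsep a.2 a.1 b.1 ha (hab2 ▸ hb) hab1
  obtain ⟨η, hη, hst⟩ := exists_stable_nhd hZ hU hV hd hcov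
  have e1 := za1.eventually (hU.mem_nhds haU)
  have e2 := wb1.eventually (hV.mem_nhds hbV)
  have e3 := za2.eventually (ball_mem_nhds a.2 hη)
  have e4 := wb2.eventually (ball_mem_nhds b.2 hη)
  have e5 := tendsto_one_div_hyperfilter.eventually (gt_mem_nhds hη)
  obtain ⟨n, h1, h2, h3, h4, h5⟩ := (e1.and (e2.and (e3.and (e4.and e5)))).exists
  simp only [Function.comp_apply, Real.dist_eq, hab2, abs_lt] at h1 h2 h3 h4
  refine disjoint_left.1 hd ?_ h2
  have key : ∀ v, Relation.ReflTransGen (BackStep Z (1 / ((n : ℝ) + 1))) v (w n) → v ∈ Z →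
      v.2 ≤ (z n).2 → v.1 ∈ U → (w n).1 ∈ U := by
    intro v hv
    induction hv using Relation.ReflTransGen.head_induction_on with
    | refl => exact fun _ _ h => h
    | head hs hc ih =>
      intro hvZ hvt hvU
      have := hle hc
      refine ih hs.1 (hs.2.1.le.trans hvt) (hst _ hvZ _ hs.1 ?_ (hs.2.2.trans h5) hvU)
      rw [abs_lt]
      constructor <;> linarith [hs.2.1]
  exact key _ (hchain n) (hz n) le_rfl h1

/-- A set without births can be traced backwards in small steps to its initial time. -/
lemma exists_chain_to_zero (hZ : IsCompact Z) (hZ0 : ∀ z ∈ Z, 0 ≤ z.2)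
    (hback : ∀ z ∈ Z, 0 < z.2 → ∀ η > 0, ∃ w ∈ Z, w.2 < z.2 ∧ dist z w < η) {z₀ : E × ℝ}
    (hz₀ : z₀ ∈ Z) {δ : ℝ} (hδ : 0 < δ) :
    ∃ w ∈ Z, w.2 = 0 ∧ Relation.ReflTransGen (BackStep Z δ) z₀ w := by
  set Q := {w | w ∈ Z ∧ Relation.ReflTransGen (BackStep Z δ) z₀ w} with hQ
  have hcl : IsCompact (closure Q) :=
    hZ.of_isClosed_subset isClosed_closure (closure_minimal (fun w hw => hw.1) hZ.isClosed)
  obtain ⟨w, hw, hmin⟩ := hcl.exists_isMinOn ⟨z₀, subset_closure ⟨hz₀, .refl⟩⟩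
    continuous_snd.continuousOn
  have hwZ : w ∈ Z := closure_minimal (fun w hw => hw.1) hZ.isClosed hw
  have hmin : ∀ v ∈ Q, w.2 ≤ v.2 := fun v hv => hmin (subset_closure hv)
  have hw0 : w.2 = 0 := by
    by_contra hne
    obtain ⟨v, hvZ, hvw, hd⟩ := hback w hwZ (lt_of_le_of_ne (hZ0 w hwZ) (Ne.symm hne)) (δ / 2)
      (half_pos hδ)
    obtain ⟨u, hu, hdu⟩ := Metric.mem_closure_iff.1 hw (δ / 2) (half_pos hδ)
    have : v ∈ Q := ⟨hvZ, hu.2.tail ⟨hvZ, hvw.trans_le (hmin u hu), by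
      linarith [dist_triangle u w v, dist_comm w u]⟩⟩
    exact absurd (hmin v this) (not_le.2 hvw)
  obtain ⟨u, hu, hdu⟩ := Metric.mem_closure_iff.1 hw δ hδ
  rcases (hZ0 u hu.1).eq_or_lt with h | h
  · exact ⟨u, hu.1, h.symm, hu.2⟩
  · exact ⟨w, hwZ, hw0, hu.2.tail ⟨hwZ, by rwa [hw0], by rwa [dist_comm]⟩⟩

/-- A backward chain can be indexed by time. -/
lemma exists_timed_chain {δ : ℝ} (hδ : 0 < δ) {z₀ w : E × ℝ} (hz₀ : z₀ ∈ Z)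
    (h : Relation.ReflTransGen (BackStep Z δ) z₀ w) :
    ∃ q : ℝ → E × ℝ, q z₀.2 = z₀ ∧
      (∀ t ∈ Icc w.2 z₀.2, q t ∈ Z ∧ t ≤ (q t).2 ∧ (q t).2 < t + δ) ∧
      ∀ s ∈ Icc w.2 z₀.2, ∀ t ∈ Icc w.2 z₀.2, s ≤ t →
        Relation.ReflTransGen (BackStep Z δ) (q t) (q s) := by
  suffices ∃ q : ℝ → E × ℝ, w ∈ Z ∧ w.2 ≤ z₀.2 ∧ q z₀.2 = z₀ ∧
      (∀ t ∈ Icc w.2 z₀.2, q t ∈ Z ∧ t ≤ (q t).2 ∧ (q t).2 < t + δ ∧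
        Relation.ReflTransGen (BackStep Z δ) (q t) w) ∧
      ∀ s ∈ Icc w.2 z₀.2, ∀ t ∈ Icc w.2 z₀.2, s ≤ t →
        Relation.ReflTransGen (BackStep Z δ) (q t) (q s) by
    obtain ⟨q, -, -, h1, h2, h3⟩ := this
    exact ⟨q, h1, fun t ht => ⟨(h2 t ht).1, (h2 t ht).2.1, (h2 t ht).2.2.1⟩, h3⟩
  induction h with
  | refl =>
    refine ⟨fun _ => z₀, hz₀, le_rfl, rfl, fun t ht => ⟨hz₀, ht.2, ?_, .refl⟩,
      fun _ _ _ _ _ => .refl⟩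
    linarith [ht.1]
  | @tail v w hc hs ih =>
    obtain ⟨q, hvZ, hle, h1, h2, h3⟩ := ih
    have hvw : v.2 - w.2 < δ := by
      refine lt_of_le_of_lt ((le_abs_self _).trans ?_) hs.2.2
      rw [← Real.dist_eq]; exact le_max_right _ _
    refine ⟨fun t => if t < v.2 then v else q t, hs.1, hs.2.1.le.trans hle, ?_, ?_, ?_⟩
    · simp only [not_lt.2 hle, if_false, h1]
    · intro t ht
      by_cases htv : t < v.2
      · simp only [htv, if_true]
        exact ⟨hvZ, htv.le, by linarith [ht.1], .single hs⟩
      · simp only [htv, if_false]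
        obtain ⟨k1, k2, k3, k4⟩ := h2 t ⟨not_lt.1 htv, ht.2⟩
        exact ⟨k1, k2, k3, k4.tail hs⟩
    · intro s hs' t ht hst
      by_cases htv : t < v.2
      · simp only [htv, hst.trans_lt htv, if_true]; exact .refl
      · simp only [htv, if_false]
        by_cases hsv : s < v.2
        · simp only [hsv, if_true]
          exact (h2 t ⟨not_lt.1 htv, ht.2⟩).2.2.2
        · simp only [hsv, if_false]
          exact h3 s ⟨not_lt.1 hsv, hs'.2⟩ t ⟨not_lt.1 htv, ht.2⟩ hst

/-- Continuous selection: a compact space-time set without births whose slices are totally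
separated contains a continuous trajectory through each of its points. -/
theorem exists_continuous_trajectory (hZ : IsCompact Z) (hZ0 : ∀ z ∈ Z, 0 ≤ z.2)
    (hsep : SlicesSeparated Z)
    (hback : ∀ z ∈ Z, 0 < z.2 → ∀ η > 0, ∃ w ∈ Z, w.2 < z.2 ∧ dist z w < η) {p₀ : E} {T : ℝ}
    (hz₀ : (p₀, T) ∈ Z) :
    ∃ p : ℝ → E, ContinuousOn p (Icc 0 T) ∧ (∀ t ∈ Icc 0 T, (p t, t) ∈ Z) ∧ p T = p₀ := by
  have hT : 0 ≤ T := hZ0 _ hz₀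
  have hq : ∀ n : ℕ, ∃ q : ℝ → E × ℝ, q T = (p₀, T) ∧
      (∀ t ∈ Icc 0 T, q t ∈ Z ∧ t ≤ (q t).2 ∧ (q t).2 < t + 1 / ((n : ℝ) + 1)) ∧
      ∀ s ∈ Icc 0 T, ∀ t ∈ Icc 0 T, s ≤ t →
        Relation.ReflTransGen (BackStep Z (1 / ((n : ℝ) + 1))) (q t) (q s) := by
    intro n
    have hn : 0 < 1 / ((n : ℝ) + 1) := by positivity
    obtain ⟨w, -, hw0, hc⟩ := exists_chain_to_zero hZ hZ0 hback hz₀ hn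
    have := exists_timed_chain hn hz₀ hc
    rwa [hw0] at this
  choose q hqT hqZ hqc using hq
  have hlim : ∀ t, ∃ z : E × ℝ, t ∈ Icc 0 T →
      z ∈ Z ∧ Tendsto (fun n => q n t) (hyperfilter ℕ) (𝓝 z) := by
    intro t
    by_cases ht : t ∈ Icc 0 T
    · obtain ⟨z, hz⟩ := exists_ultralimit hZ fun n => (hqZ n t ht).1
      exact ⟨z, fun _ => hz⟩
    · exact ⟨(p₀, T), fun h => absurd h ht⟩
  choose z hz using hlim
  have hz1 := fun t ht => (continuous_fst.tendsto (z t)).comp (hz t ht).2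
  have hz2 : ∀ t ∈ Icc 0 T, (z t).2 = t := by
    intro t ht
    have h1 := (continuous_snd.tendsto (z t)).comp (hz t ht).2
    have h2 : Tendsto (fun n : ℕ => t + 1 / ((n : ℝ) + 1)) (hyperfilter ℕ) (𝓝 t) := by
      simpa using tendsto_const_nhds.add tendsto_one_div_hyperfilter
    exact tendsto_nhds_unique h1 (tendsto_of_tendsto_of_tendsto_of_le_of_le tendsto_const_nhds h2
      (fun n => (hqZ n t ht).2.1) (fun n => (hqZ n t ht).2.2.le))
  refine ⟨fun t => (z t).1, ?_, ?_, ?_⟩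
  · have key : ∀ ε > 0, ∃ δ > 0, ∀ s ∈ Icc 0 T, ∀ t ∈ Icc 0 T, s ≤ t → t - s < δ →
        dist (z t).1 (z s).1 ≤ ε := by
      intro ε hε
      obtain ⟨δ, hδ, hmod⟩ := exists_chain_modulus hZ hsep hε
      refine ⟨δ / 2, half_pos hδ, fun s hs t ht hst hlt => ?_⟩
      refine le_of_tendsto ((hz1 t ht).dist (hz1 s hs)) ?_
      filter_upwards [tendsto_one_div_hyperfilter.eventually (gt_mem_nhds (half_pos hδ))]
        with n hn
      refine (hmod _ (hqZ n t ht).1 _ (hqZ n s hs).1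
        (Relation.ReflTransGen.mono (fun _ _ h => h.mono (by linarith)) _ _ (hqc n s hs t ht hst))
        ?_).le
      linarith [(hqZ n t ht).2.2, (hqZ n s hs).2.1]
    rw [Metric.continuousOn_iff]
    intro t ht ε hε
    obtain ⟨δ, hδ, h⟩ := key (ε / 2) (half_pos hε)
    refine ⟨δ, hδ, fun s hs hst => ?_⟩
    rw [Real.dist_eq, abs_lt] at hst
    rcases le_total s t with hle | hle
    · rw [dist_comm]
      exact (h s hs t ht hle (by linarith)).trans_lt (half_lt_self hε)
    · exact (h t ht s hs hle (by linarith)).trans_lt (half_lt_self hε)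
  · intro t ht
    have : ((z t).1, t) = z t := Prod.ext rfl (hz2 t ht).symm
    rw [this]; exact (hz t ht).1
  · have hTT : T ∈ Icc 0 T := ⟨hT, le_rfl⟩
    have := (hz T hTT).2
    simp only [hqT] at this
    exact congrArg Prod.fst (tendsto_nhds_unique this tendsto_const_nhds)

end Selection

lemma infinite_circle : Infinite Circle :=
  have : Infinite (Ioc (-π) π) := (Ioc_infinite (by linarith [pi_pos])).to_subtype
  Infinite.of_injective _ Circle.argEquiv.symm.injective

namespace IsJordanCurve
variable {γ γ' : Set E2}

lemma isCompact (h : IsJordanCurve γ) : IsCompact γ := by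
  obtain ⟨φ, hc, -, rfl⟩ := h
  exact isCompact_range hc

lemma nonempty (h : IsJordanCurve γ) : γ.Nonempty := by
  obtain ⟨φ, -, -, rfl⟩ := h
  exact range_nonempty φ

lemma infinite (h : IsJordanCurve γ) : γ.Infinite := by
  obtain ⟨φ, -, hi, rfl⟩ := h
  have := infinite_circle
  exact infinite_range_of_injective hi

lemma near_of_frechetDist_lt (h : IsJordanCurve γ) (h' : IsJordanCurve γ') {ε : ℝ}
    (hd : frechetDist γ γ' < ε) :
    (∀ a ∈ γ, ∃ b ∈ γ', dist a b < ε) ∧ ∀ b ∈ γ', ∃ a ∈ γ, dist a b < ε := by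
  obtain ⟨ψ, hψ⟩ := h
  obtain ⟨ψ', hψ'⟩ := h'
  have hne : { d : ℝ | ∃ φ₁ φ₂ : Circle → E2, IsParam γ φ₁ ∧ IsParam γ' φ₂ ∧
      d = ⨆ x : Circle, ‖φ₁ x - φ₂ x‖ }.Nonempty := ⟨_, ψ, ψ', hψ, hψ', rfl⟩
  obtain ⟨d, ⟨φ, φ', hφ, hφ', rfl⟩, hlt⟩ := exists_lt_of_csInf_lt hne hd
  have hbdd : BddAbove (range fun x : Circle => ‖φ x - φ' x‖) :=
    (isCompact_range (hφ.1.sub hφ'.1).norm).bddAbove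
  have key : ∀ x, dist (φ x) (φ' x) < ε := fun x => by
    rw [dist_eq_norm]
    exact (le_ciSup hbdd x).trans_lt hlt
  rw [← hφ.2.2, ← hφ'.2.2]
  constructor
  · rintro _ ⟨x, rfl⟩
    exact ⟨_, mem_range_self x, key x⟩
  · rintro _ ⟨x, rfl⟩
    exact ⟨_, mem_range_self x, key x⟩

end IsJordanCurve

namespace CurvatureFlowSolution
variable {γ₀ : Set E2} {S : ℝ} (sol : CurvatureFlowSolution γ₀ S)

lemma cf_zero : sol.cf 0 = γ₀ := if_pos rfl

lemma cf_of_pos {t : ℝ} (ht : 0 < t) : sol.cf t = range fun x => sol.Γ x t := if_neg ht.ne'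

lemma eq_iff {γ₁ : Set E2} (sol' : CurvatureFlowSolution γ₁ S) {x y t : ℝ} :
    sol.Γ x t = sol'.Γ y t ↔ sol.toNormalFlow.X x t = sol'.toNormalFlow.X y t ∧
      sol.toNormalFlow.Y x t = sol'.toNormalFlow.Y y t := by
  refine ⟨fun h => ⟨congrArg (fun v : E2 => v 0) h, congrArg (fun v : E2 => v 1) h⟩, fun h => ?_⟩
  ext i
  fin_cases i
  · exact h.1
  · exact h.2

lemma exists_int_of_eq {t : ℝ} (ht : t ∈ Ioo 0 S) {x y : ℝ} (h : sol.Γ x t = sol.Γ y t) :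
    ∃ n : ℤ, y = x + n * (2 * π) :=
  sol.toNormalFlow.inj t ht x y ((sol.eq_iff sol).1 h).1 ((sol.eq_iff sol).1 h).2

lemma continuous_x {t : ℝ} (ht : t ∈ Ioo 0 S) : Continuous fun x => sol.Γ x t :=
  sol.smooth.continuousOn.comp_continuous (f := fun x : ℝ => (x, t)) (by fun_prop)
    fun _ => ⟨mem_univ _, ht⟩

lemma isJordanCurve_range {t : ℝ} (ht : t ∈ Ioo 0 S) :
    IsJordanCurve (range fun x => sol.Γ x t) := by
  have hc : Continuous (sol.periodic t).lift :=
    continuous_coinduced_dom.2 (sol.continuous_x ht)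
  refine ⟨(sol.periodic t).lift ∘ AddCircle.homeomorphCircle'.symm,
    hc.comp (Homeomorph.continuous _), Function.Injective.comp ?_ (Homeomorph.injective _), ?_⟩
  · intro a b
    induction a using QuotientAddGroup.induction_on with | H x =>
    induction b using QuotientAddGroup.induction_on with | H y =>
    intro h
    obtain ⟨n, hn⟩ := sol.exists_int_of_eq ht (x := x) (y := y) h
    rw [hn]
    refine (QuotientAddGroup.eq).2 ?_
    refine AddSubgroup.mem_zmultiples_iff.2 ⟨n, ?_⟩
    rw [zsmul_eq_mul]; ring
  · rw [(Homeomorph.surjective _).range_comp]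
    ext p
    constructor
    · rintro ⟨a, rfl⟩
      induction a using QuotientAddGroup.induction_on with | H x =>
      exact ⟨x, rfl⟩
    · rintro ⟨x, rfl⟩
      exact ⟨(x : AddCircle (2 * π)), rfl⟩

lemma eventually_near (h₀ : IsJordanCurve γ₀) (hS : 0 < S) {ε : ℝ} (hε : 0 < ε) :
    ∃ δ > 0, ∀ t ∈ Ioo 0 δ, (∀ a ∈ sol.cf t, ∃ b ∈ γ₀, dist a b < ε) ∧
      ∀ b ∈ γ₀, ∃ a ∈ sol.cf t, dist a b < ε := by
  have h1 := sol.init.eventually (gt_mem_nhds hε)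
  obtain ⟨δ, hδ, h⟩ := mem_nhdsGT_iff_exists_Ioo_subset.1 h1
  refine ⟨min δ S, lt_min hδ hS, fun t ht => ?_⟩
  rw [sol.cf_of_pos ht.1]
  exact (sol.isJordanCurve_range ⟨ht.1, ht.2.trans_le (min_le_right _ _)⟩).near_of_frechetDist_lt h₀
    (h ⟨ht.1, ht.2.trans_le (min_le_left _ _)⟩)

/-- The space-time track of a solution up to time `T`. -/
def track (T : ℝ) : Set (E2 × ℝ) := {z | z.2 ∈ Icc 0 T ∧ z.1 ∈ sol.cf z.2}

lemma isCompact_track (h₀ : IsJordanCurve γ₀) {T : ℝ} (hT : T < S) : IsCompact (sol.track T) := by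
  rw [isCompact_iff_ultrafilter_le_nhds']
  intro f hf
  have hf0 : ∀ᶠ z : E2 × ℝ in f, z.2 ∈ Icc 0 T ∧ z.1 ∈ sol.cf z.2 := hf
  obtain ⟨t, ht, hft⟩ := (isCompact_Icc (a := (0 : ℝ)) (b := T)).ultrafilter_le_nhds (f.map Prod.snd)
    (by rw [Ultrafilter.coe_map, le_principal_iff]; exact hf0.mono fun z hz => hz.1)
  have hft : Tendsto (Prod.snd : E2 × ℝ → ℝ) f (𝓝 t) := hft
  suffices ∃ p ∈ sol.cf t, Tendsto (Prod.fst : E2 × ℝ → E2) f (𝓝 p) by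
    obtain ⟨p, hp, hfp⟩ := this
    exact ⟨(p, t), ⟨ht, hp⟩, hfp.prodMk_nhds hft⟩
  rcases ht.1.eq_or_lt with h0 | h0
  · rw [← h0, cf_zero]
    rw [← h0] at hft
    choose b hb hdist using fun z : E2 × ℝ => h₀.isCompact.exists_infDist_eq_dist h₀.nonempty z.1
    obtain ⟨p, hp, hfp⟩ := h₀.isCompact.ultrafilter_le_nhds (f.map b)
      (by rw [Ultrafilter.coe_map, le_principal_iff]; exact mem_map.2 (univ_mem' hb))
    have hfp : Tendsto b f (𝓝 p) := hfp
    refine ⟨p, hp, (tendsto_iff_of_dist ?_).1 hfp⟩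
    rw [Metric.tendsto_nhds]
    intro ε hε
    obtain ⟨δ, hδ, h⟩ := sol.eventually_near h₀ (ht.1.trans_lt (ht.2.trans_lt hT)) hε
    filter_upwards [hf0, hft.eventually (gt_mem_nhds hδ)] with z hz hzδ
    rw [Real.dist_eq, sub_zero, abs_of_nonneg dist_nonneg, dist_comm, ← hdist]
    rcases hz.1.1.eq_or_lt with hz0 | hz0
    · have := hz.2
      rw [← hz0, cf_zero] at this
      rwa [infDist_zero_of_mem this]
    · obtain ⟨c, hc, hlt⟩ := (h z.2 ⟨hz0, hzδ⟩).1 _ hz.2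
      exact (infDist_le_dist_of_mem hc).trans_lt hlt
  · have hξ : ∀ z : E2 × ℝ, ∃ x ∈ Icc 0 (2 * π), 0 < z.2 → z.1 ∈ sol.cf z.2 →
        sol.Γ x z.2 = z.1 := by
      intro z
      by_cases hz : 0 < z.2 ∧ z.1 ∈ sol.cf z.2
      · have hz2 := hz.2
        rw [sol.cf_of_pos hz.1] at hz2
        obtain ⟨x, hx⟩ := hz2
        obtain ⟨y, hy, hxy⟩ := (sol.periodic z.2).exists_mem_Ico₀ two_pi_pos x
        exact ⟨y, ⟨hy.1, hy.2.le⟩, fun _ _ => hxy.symm.trans hx⟩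
      · exact ⟨0, ⟨le_rfl, two_pi_pos.le⟩, fun h1 h2 => absurd ⟨h1, h2⟩ hz⟩
    choose ξ hξmem hξ using hξ
    obtain ⟨x, -, hfx⟩ := (isCompact_Icc (a := (0 : ℝ)) (b := 2 * π)).ultrafilter_le_nhds (f.map ξ)
      (by rw [Ultrafilter.coe_map, le_principal_iff]; exact mem_map.2 (univ_mem' hξmem))
    have hfx : Tendsto ξ f (𝓝 x) := hfx
    refine ⟨sol.Γ x t, by rw [sol.cf_of_pos h0]; exact mem_range_self x, ?_⟩
    have hcont : ContinuousAt (fun p : ℝ × ℝ => sol.Γ p.1 p.2) (x, t) :=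
      sol.smooth.continuousOn.continuousAt
        ((isOpen_strip S).mem_nhds ⟨mem_univ _, h0, ht.2.trans_lt hT⟩)
    refine (hcont.tendsto.comp (hfx.prodMk_nhds hft)).congr' ?_
    filter_upwards [hf0, hft.eventually (lt_mem_nhds h0)] with z hz hz0
    exact hξ z hz0 hz.2

variable {γ₁ γ₂ : Set E2}

/-- Two flows whose initial curves meet finitely often never share an arc. -/
lemma exists_notMem_of_lt (h₁ : IsJordanCurve γ₁) (h₂ : IsJordanCurve γ₂)
    (hfin : (γ₁ ∩ γ₂).Finite) (sol₁ : CurvatureFlowSolution γ₁ S)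
    (sol₂ : CurvatureFlowSolution γ₂ S) {t : ℝ} (ht : t ∈ Ioo 0 S) {a b : ℝ} (hab : a < b) :
    ∃ x ∈ Ioo a b, sol₁.Γ x t ∉ sol₂.cf t := by
  by_contra! hcon
  have hsub : ∀ s, 0 < s → s ≤ t → sol₁.cf s ⊆ sol₂.cf s := by
    intro s hs hst
    rw [sol₁.cf_of_pos hs, sol₂.cf_of_pos hs]
    rintro _ ⟨x, rfl⟩
    obtain ⟨y, hy⟩ := sol₁.toNormalFlow.forall_mem_of_common_arc sol₂.toNormalFlow two_pi_pos
      two_pi_pos ht hab (fun x hx => by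
        have := hcon x hx
        rw [sol₂.cf_of_pos ht.1] at this
        obtain ⟨y, hy⟩ := this
        exact ⟨y, (sol₁.eq_iff sol₂).1 hy.symm⟩) hs hst x
    exact ⟨y, ((sol₁.eq_iff sol₂).2 hy).symm⟩
  have hγ : γ₁ ⊆ γ₂ := by
    intro p hp
    rw [h₂.isCompact.isClosed.mem_iff_infDist_zero h₂.nonempty]
    refine le_antisymm (le_of_forall_pos_le_add fun ε hε => ?_) infDist_nonneg
    have hS : 0 < S := ht.1.trans ht.2
    obtain ⟨δ₁, hδ₁, k₁⟩ := sol₁.eventually_near h₁ hS (half_pos hε)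
    obtain ⟨δ₂, hδ₂, k₂⟩ := sol₂.eventually_near h₂ hS (half_pos hε)
    obtain ⟨s, hs0, hs⟩ := exists_between (lt_min ht.1 (lt_min hδ₁ hδ₂))
    obtain ⟨hst, hs1, hs2⟩ := by simpa using hs
    obtain ⟨q, hq, hqp⟩ := (k₁ s ⟨hs0, hs1⟩).2 p hp
    obtain ⟨r, hr, hrq⟩ := (k₂ s ⟨hs0, hs2⟩).1 q (hsub s hs0 hst.le hq)
    refine (infDist_le_dist_of_mem hr).trans ?_
    linarith [dist_triangle p q r, dist_comm p q]
  exact h₁.infinite (hfin.subset fun p hp => ⟨hp, hγ hp⟩)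

lemma slicesSeparated_inter (h₁ : IsJordanCurve γ₁) (h₂ : IsJordanCurve γ₂)
    (hfin : (γ₁ ∩ γ₂).Finite) (sol₁ : CurvatureFlowSolution γ₁ S)
    (sol₂ : CurvatureFlowSolution γ₂ S) {T : ℝ} (hT : T < S) :
    SlicesSeparated (sol₁.track T ∩ sol₂.track T) := by
  intro t p q hp hq hpq
  suffices ∃ A B : Set E2, IsCompact A ∧ IsCompact B ∧ Disjoint A B ∧
      sol₁.cf t ∩ sol₂.cf t ⊆ A ∪ B ∧ p ∈ A ∧ q ∈ B by
    obtain ⟨A, B, hA, hB, hd, hcov, hpA, hqB⟩ := this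
    obtain ⟨U, V, hU, hV, hAU, hBV, hUV⟩ := SeparatedNhds.of_isCompact_isCompact hA hB hd
    exact ⟨U, V, hU, hV, hUV, fun r hr => union_subset_union hAU hBV (hcov ⟨hr.1.2, hr.2.2⟩),
      hAU hpA, hBV hqB⟩
  have hp1 : p ∈ sol₁.cf t := hp.1.2
  have hp2 : p ∈ sol₂.cf t := hp.2.2
  have hq1 : q ∈ sol₁.cf t := hq.1.2
  have hq2 : q ∈ sol₂.cf t := hq.2.2
  have htT : t ∈ Icc 0 T := hp.1.1
  rcases htT.1.eq_or_lt with h0 | h0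
  · rw [← h0, cf_zero] at hp1 hp2 hq1 hq2
    rw [← h0, cf_zero, cf_zero]
    refine ⟨{p}, (γ₁ ∩ γ₂) \ {p}, isCompact_singleton, hfin.sdiff.isCompact,
      disjoint_sdiff_right, ?_, rfl, ⟨hq1, hq2⟩, hpq.symm⟩
    rw [union_sdiff_self]
    exact subset_union_right
  have ht : t ∈ Ioo 0 S := ⟨h0, htT.2.trans_lt hT⟩
  have hcf2 : IsClosed (sol₂.cf t) := by
    rw [sol₂.cf_of_pos h0]
    exact (sol₂.isJordanCurve_range ht).isCompact.isClosed
  rw [sol₁.cf_of_pos h0] at hp1 hq1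
  obtain ⟨a, rfl⟩ := hp1
  obtain ⟨b', rfl⟩ := hq1
  dsimp only at hp2 hq2 hpq ⊢
  obtain ⟨n, ⟨hb1, hb2⟩, -⟩ := existsUnique_add_zsmul_mem_Ico two_pi_pos b' a
  have hbb : sol₁.Γ (b' + n • (2 * π)) t = sol₁.Γ b' t := (sol₁.periodic t).zsmul n b'
  rw [← hbb] at hq2 hpq ⊢
  set b := b' + n • (2 * π)
  have hab : a < b := lt_of_le_of_ne hb1 fun h => hpq (by rw [h])
  obtain ⟨c, hc, hcn⟩ := exists_notMem_of_lt h₁ h₂ hfin sol₁ sol₂ ht hab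
  obtain ⟨d, hd, hdn⟩ := exists_notMem_of_lt h₁ h₂ hfin sol₁ sol₂ ht hb2
  have hcomp : ∀ u v, IsCompact ((fun x => sol₁.Γ x t) '' Icc u v ∩ sol₂.cf t) := fun u v =>
    (isCompact_Icc.image (sol₁.continuous_x ht)).inter_right hcf2
  have hper : ∀ x, sol₁.Γ (x + 2 * π) t = sol₁.Γ x t := sol₁.periodic t
  refine ⟨_, _, hcomp d (c + 2 * π), hcomp c d, ?_, ?_, ⟨⟨a + 2 * π, ⟨hd.2.le, by
    linarith [hc.1]⟩, hper a⟩, hp2⟩, ⟨b, ⟨hc.2.le, hd.1.le⟩, rfl⟩, hq2⟩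
  · rw [disjoint_left]
    rintro _ ⟨⟨v, hv, rfl⟩, hv2⟩ ⟨⟨u, hu, huv⟩, -⟩
    dsimp only at huv hv2
    obtain ⟨k, hk⟩ := sol₁.exists_int_of_eq ht huv
    have hv1 : d < v := lt_of_le_of_ne hv.1 (by rintro rfl; exact hdn hv2)
    have hv3 : v < c + 2 * π := lt_of_le_of_ne hv.2 (by
      rintro rfl; rw [hper] at hv2; exact hcn hv2)
    have k1 : 0 < (k : ℝ) := by
      by_contra! h
      have := mul_nonpos_of_nonpos_of_nonneg h two_pi_pos.le
      linarith [hu.2]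
    have k2 : (k : ℝ) < 1 := by
      by_contra! h
      have := mul_le_mul_of_nonneg_right h two_pi_pos.le
      linarith [hu.1]
    have k1 : 0 < k := by exact_mod_cast k1
    have k2 : k < 1 := by exact_mod_cast k2
    omega
  · rw [sol₁.cf_of_pos h0]
    rintro _ ⟨⟨x, rfl⟩, hx⟩
    dsimp only at hx ⊢
    obtain ⟨m, ⟨hm1, hm2⟩, -⟩ := existsUnique_add_zsmul_mem_Ico two_pi_pos x c
    have hxm : sol₁.Γ (x + m • (2 * π)) t = sol₁.Γ x t := (sol₁.periodic t).zsmul m x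
    rcases le_total (x + m • (2 * π)) d with h | h
    · exact Or.inr ⟨⟨_, ⟨hm1, h⟩, hxm⟩, hx⟩
    · exact Or.inl ⟨⟨_, ⟨h, hm2.le⟩, hxm⟩, hx⟩

/-- Every intersection point at a positive time is approached by earlier ones. -/
lemma exists_earlier_inter (sol₁ : CurvatureFlowSolution γ₁ S)
    (sol₂ : CurvatureFlowSolution γ₂ S) {T : ℝ} (hT : T < S) {z : E2 × ℝ}
    (hz : z ∈ sol₁.track T ∩ sol₂.track T) (hz0 : 0 < z.2) {η : ℝ} (hη : 0 < η) :
    ∃ w ∈ sol₁.track T ∩ sol₂.track T, w.2 < z.2 ∧ dist z w < η := by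
  obtain ⟨p, t⟩ := z
  obtain ⟨⟨htT, hp1⟩, -, hp2⟩ := hz
  dsimp only at hz0 htT hp1 hp2 ⊢
  rw [sol₁.cf_of_pos hz0] at hp1
  rw [sol₂.cf_of_pos hz0] at hp2
  obtain ⟨x₀, rfl⟩ := hp1
  obtain ⟨y₀, hy₀⟩ := hp2
  have ht : t ∈ Ioo 0 S := ⟨hz0, htT.2.trans_lt hT⟩
  have hcont : ContinuousAt (fun p : ℝ × ℝ => sol₁.Γ p.1 p.2) (x₀, t) :=
    sol₁.smooth.continuousOn.continuousAt ((isOpen_strip S).mem_nhds ⟨mem_univ _, ht⟩)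
  obtain ⟨δ, hδ, hball⟩ := Metric.continuousAt_iff.1 hcont η hη
  obtain ⟨t₀, ht₀, ht₀t⟩ := exists_between
    (max_lt hz0 (max_lt (sub_lt_self t hδ) (sub_lt_self t hη)))
  simp only [max_lt_iff] at ht₀
  obtain ⟨hE1, hE2⟩ := (sol₁.eq_iff sol₂).1 hy₀.symm
  obtain ⟨s, hs, x, hx, y, hxy⟩ := sol₁.toNormalFlow.no_birth sol₂.toNormalFlow two_pi_pos
    (x₀ := x₀) (y₀ := y₀) ht.2 ht₀.1 ht₀t (half_pos hδ) (by
      simp only [NormalFlow.sqDist, hE1, hE2]; ring)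
  have hs0 : 0 < s := ht₀.1.trans_le hs.1
  have hxy' : sol₁.Γ x s = sol₂.Γ y s := by
    simp only [NormalFlow.sqDist] at hxy
    rw [sol₁.eq_iff sol₂]
    constructor <;> nlinarith
  have hsI : s ∈ Icc 0 T := ⟨hs0.le, hs.2.le.trans htT.2⟩
  have hts : dist t s < min δ η := by
    rw [Real.dist_eq, abs_lt]
    have : t - s < min δ η := lt_min (by linarith [hs.1]) (by linarith [hs.1])
    constructor <;> linarith [hs.2]
  refine ⟨(sol₁.Γ x s, s), ⟨⟨hsI, ?_⟩, hsI, ?_⟩, hs.2, ?_⟩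
  · dsimp only; rw [sol₁.cf_of_pos hs0]; exact mem_range_self x
  · dsimp only; rw [sol₂.cf_of_pos hs0, hxy']; exact mem_range_self y
  · refine max_lt ?_ (hts.trans_le (min_le_right _ _))
    rw [dist_comm]
    refine hball (x := (x, s)) (max_lt ?_ ?_)
    · rw [Real.dist_eq, abs_lt]
      constructor <;> linarith [hx.1, hx.2]
    · rw [dist_comm]; exact hts.trans_le (min_le_left _ _)

end CurvatureFlowSolution

end Auxiliary

/-- Lemma 2.3: an intersection point of two evolving curves at time `T`
extends backwards to a continuous trajectory of intersection points on `[0,T]`. -/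
theorem intersection_trajectory_exists
    (S : ℝ) (hS : 0 < S)
    (γ₁ γ₂ : Set E2) (h₁ : IsJordanCurve γ₁) (h₂ : IsJordanCurve γ₂)
    (hvol₁ : volume γ₁ = 0) (hvol₂ : volume γ₂ = 0)
    (hfin : (γ₁ ∩ γ₂).Finite)
    (sol₁ : CurvatureFlowSolution γ₁ S) (sol₂ : CurvatureFlowSolution γ₂ S)
    (T : ℝ) (hT : T ∈ Ioo (0 : ℝ) S)
    (pT : E2) (hpT : pT ∈ sol₁.cf T ∩ sol₂.cf T) :
    ∃ p : ℝ → E2, ContinuousOn p (Icc 0 T) ∧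
      (∀ t ∈ Icc (0 : ℝ) T, p t ∈ sol₁.cf t ∩ sol₂.cf t) ∧ p T = pT := by
  have hTT : T ∈ Icc 0 T := ⟨hT.1.le, le_rfl⟩
  obtain ⟨p, hp, hpZ, hpT⟩ := exists_continuous_trajectory
    (Z := sol₁.track T ∩ sol₂.track T) (p₀ := pT) (T := T)
    ((sol₁.isCompact_track h₁ hT.2).inter (sol₂.isCompact_track h₂ hT.2))
    (fun z hz => hz.1.1.1)
    (CurvatureFlowSolution.slicesSeparated_inter h₁ h₂ hfin sol₁ sol₂ hT.2)
    (fun z hz hz0 η hη => sol₁.exists_earlier_inter sol₂ hT.2 hz hz0 hη)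
    ⟨⟨hTT, hpT.1⟩, hTT, hpT.2⟩
  exact ⟨p, hp, fun t ht => ⟨(hpZ t ht).1.2, (hpZ t ht).2.2⟩, hpT⟩

end
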